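/- arXiv:2410.22341 — 4 statements merged into one kernel-verified Lean document; each statement's English description precedes it below -/
import Mathlib

section
/- For every n ≥ 2, every weight threshold ρ ∈ (0,1/2], and every m with 1 ≤ m ≤ n−1, the maximum 1-energy satisfies 𝓔_{m,1} ≤ 3·e·n·(1/ρ)^{⌊n/2⌋}. -/
open scoped BigOperators ENNReal

/-- An averaging system on `n` agents with weight threshold `ρ`: a sequence of
row-stochastic matrices `P t` whose positive entries (the edges of the graph `G t`,
including a self-loop at every vertex) are at least `ρ`, with symmetric support,
together with the orbit `x (t+1) = P t * x t`. -/
structure AvgSystem (n : ℕ) (ρ : ℝ) where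
  P : ℕ → Matrix (Fin n) (Fin n) ℝ
  x : ℕ → Fin n → ℝ
  nonneg : ∀ t i j, 0 ≤ P t i j
  rowSum : ∀ t i, ∑ j, P t i j = 1
  diagPos : ∀ t i, 0 < P t i i
  symm : ∀ t i j, P t i j = 0 ↔ P t j i = 0
  threshold : ∀ t i j, P t i j ≠ 0 → ρ ≤ P t i j
  update : ∀ t, x (t + 1) = (P t).mulVec (x t)

/-- The union of the embedded edges of `G t` on the real line. -/
def AvgSystem.edgeUnion {n : ℕ} {ρ : ℝ} (S : AvgSystem n ρ) (t : ℕ) : Set ℝ :=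
  ⋃ (i : Fin n) (j : Fin n) (_ : S.P t i j ≠ 0), Set.uIcc (S.x t i) (S.x t j)

/-- The blocks of a union of embedded edges: its connected components. -/
def blockSet (U : Set ℝ) : Set (Set ℝ) :=
  {C | ∃ a ∈ U, C = connectedComponentIn U a}

/-- `E_{s,t}`: the sum of the `s`-th powers of the block lengths. -/
noncomputable def stepEnergy (s : ℝ) (U : Set ℝ) : ℝ≥0∞ :=
  ∑' C : blockSet U, ENNReal.ofReal (Metric.diam (C : Set ℝ) ^ s)

/-- The `s`-energy of an averaging system. -/
noncomputable def AvgSystem.energy {n : ℕ} {ρ : ℝ} (S : AvgSystem n ρ) (s : ℝ) : ℝ≥0∞ :=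
  ∑' t : ℕ, stepEnergy s (S.edgeUnion t)

/-- Every graph `G t` of the system has at most `m` connected components. -/
def AvgSystem.componentsLE {n : ℕ} {ρ : ℝ} (S : AvgSystem n ρ) (m : ℕ) : Prop :=
  ∀ t : ℕ, ∃ c : Fin n → Fin m,
    (∀ i j, S.P t i j ≠ 0 → c i = c j) ∧
    (∀ i j, c i = c j → Relation.ReflTransGen (fun a b => S.P t a b ≠ 0) i j)

namespace AvgAux

open Finset MeasureTheory

noncomputable def A (ρ : ℝ) (j : ℕ) : ℝ := if j = 0 then 0 else (1 / ρ) ^ j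

noncomputable def W (n : ℕ) (ρ : ℝ) (i : ℕ) : ℝ := A ρ (i + 1 - (n - n / 2))

noncomputable def c (n : ℕ) (ρ : ℝ) (i : Fin n) : ℝ := W n ρ i - W n ρ (Fin.rev i)

lemma A_nonneg {ρ : ℝ} (h0 : 0 < ρ) (j : ℕ) : 0 ≤ A ρ j := by
  unfold A; split_ifs <;> positivity

lemma A_mono {ρ : ℝ} (h0 : 0 < ρ) (h1 : ρ ≤ 1 / 2) : Monotone (A ρ) := by
  intro a b hab
  by_cases ha : a = 0
  · subst ha; simpa [A] using A_nonneg h0 b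
  · have hb : b ≠ 0 := by omega
    simp only [A, ha, hb, if_false]
    apply pow_le_pow_right₀ _ hab
    rw [le_div_iff₀ h0]; linarith

lemma W_nonneg {ρ : ℝ} (h0 : 0 < ρ) (n j : ℕ) : 0 ≤ W n ρ j := A_nonneg h0 _

lemma W_mono {ρ : ℝ} (h0 : 0 < ρ) (h1 : ρ ≤ 1 / 2) (n : ℕ) : Monotone (W n ρ) := by
  intro a b hab
  exact A_mono h0 h1 (by omega)

lemma c_rev (n : ℕ) (ρ : ℝ) (i : Fin n) : c n ρ (Fin.rev i) = - c n ρ i := by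
  simp [c]

lemma c_mono {ρ : ℝ} (h0 : 0 < ρ) (h1 : ρ ≤ 1 / 2) (n : ℕ) : Monotone (c n ρ) := by
  intro a b hab
  have := W_mono h0 h1 n (show (a : ℕ) ≤ b from hab)
  have := W_mono h0 h1 n (show ((Fin.rev b : Fin n) : ℕ) ≤ (Fin.rev a : Fin n) from
    Fin.rev_le_rev.2 hab)
  unfold c; linarith

lemma sum_rev {n : ℕ} (f : Fin n → ℝ) : ∑ i, f (Fin.rev i) = ∑ i, f i :=
  Equiv.sum_comp Fin.revPerm f

lemma c_sum (n : ℕ) (ρ : ℝ) : ∑ i, c n ρ i = 0 := by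
  have h := sum_rev (c n ρ)
  simp only [c_rev, sum_neg_distrib] at h
  linarith

lemma W_key {ρ : ℝ} (h0 : 0 < ρ) (n k : ℕ) (hk : n - n / 2 ≤ k) :
    (1 - ρ) * ∑ i ∈ range k, W n ρ i + 1 ≤ ρ * W n ρ k := by
  induction k, hk using Nat.le_induction with
  | base =>
    have : ∑ i ∈ range (n - n / 2), W n ρ i = 0 := by
      apply sum_eq_zero
      intro i hi
      have : i + 1 - (n - n / 2) = 0 := by have := mem_range.1 hi; omega
      simp [W, A, this]
    rw [this]
    have h2 : n - n / 2 + 1 - (n - n / 2) = 1 := by omega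
    simp [W, A, h2, h0.ne']
  | succ k hk ih =>
    rw [sum_range_succ]
    have h3 : ρ * W n ρ (k + 1) = W n ρ k := by
      have e1 : k + 1 + 1 - (n - n / 2) = (k + 1 - (n - n / 2)) + 1 := by omega
      have e2 : k + 1 - (n - n / 2) ≠ 0 := by omega
      simp only [W, A, e1, e2, if_false, Nat.succ_ne_zero]
      rw [pow_succ]; field_simp
    rw [h3]; linarith

lemma W_sum {ρ : ℝ} (h0 : 0 < ρ) (h1 : ρ ≤ 1 / 2) (n : ℕ) :
    ∑ i : Fin n, W n ρ i ≤ 2 * (1 / ρ) ^ (n / 2) := by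
  have h := W_key h0 n n (by omega)
  have e1 : n + 1 - (n - n / 2) = n / 2 + 1 := by omega
  have h3 : ρ * W n ρ n = (1 / ρ) ^ (n / 2) := by
    simp only [W, A, e1, if_false, Nat.succ_ne_zero]
    rw [pow_succ]; field_simp
  rw [Fin.sum_univ_eq_sum_range (fun i => W n ρ i) n]
  have : 0 ≤ ∑ i ∈ range n, W n ρ i := sum_nonneg fun i _ => W_nonneg h0 n i
  nlinarith

lemma card_ge (n k : ℕ) : #{i : Fin n | k ≤ (i : ℕ)} = n - k := by
  have h := card_filter_add_card_filter_not (s := (univ : Finset (Fin n))) (fun i => (i : ℕ) < k)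
  simp only [Fin.card_filter_val_lt, not_lt, card_univ, Fintype.card_fin] at h
  omega

lemma topsum {n : ℕ} (f : Fin n → ℝ) (hf : Monotone f) (k : ℕ) (O : Finset (Fin n))
    (hO : #O = n - k) : ∑ i ∈ O, f i ≤ ∑ i with k ≤ (i : Fin n).val, f i := by
  by_cases hk : k < n
  · set θ := f ⟨k, hk⟩ with hθ
    have key : ∑ i : Fin n, (f i - θ) * ((if i ∈ O then 1 else 0) - (if k ≤ i.val then 1 else 0))
        ≤ 0 := by
      apply sum_nonpos
      intro i _
      by_cases h : k ≤ i.val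
      · have : θ ≤ f i := hf h
        by_cases h2 : i ∈ O <;> simp [h, h2, this]
      · have : f i ≤ θ := hf (show i ≤ ⟨k, hk⟩ from by simp [Fin.le_def]; omega)
        by_cases h2 : i ∈ O <;> simp [h, h2, this]
    simp only [mul_sub, sum_sub_distrib, mul_ite, mul_one, mul_zero,
      ← sum_filter, filter_mem_eq_inter, univ_inter, sum_const, card_ge, hO] at key
    linarith
  · have : O = ∅ := by rw [← card_eq_zero, hO]; omega
    subst this
    have : (univ.filter fun i : Fin n => k ≤ i.val) = ∅ := by
      rw [← card_eq_zero, card_ge]; omega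
    simp [this]

lemma topsum_le {n : ℕ} (f : Fin n → ℝ) (hf : Monotone f) (hf0 : ∀ i, 0 ≤ f i) (k : ℕ)
    (O : Finset (Fin n))
    (hO : #O ≤ n - k) : ∑ i ∈ O, f i ≤ ∑ i with k ≤ (i : Fin n).val, f i := by
  obtain ⟨O', h1, h2⟩ := exists_superset_card_eq hO (by simp)
  exact (sum_le_sum_of_subset_of_nonneg h1 fun i _ _ => hf0 i).trans (topsum f hf k O' h2)

lemma core_right {n : ℕ} {ρ : ℝ} (h0 : 0 < ρ) (h1 : ρ ≤ 1 / 2) (u : Fin n → ℝ)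
    (hu0 : ∀ i, 0 ≤ u i) (hu1 : ∀ i, u i = 1 ∨ u i ≤ 1 - ρ) (k : ℕ) (hk : n - n / 2 ≤ k)
    (hc : #{i | u i = 1} < n - k) :
    ∑ i, c n ρ i * u i + 1 ≤ ∑ i with k ≤ (i : Fin n).val, c n ρ i := by
  have hkn : k < n := by omega
  have e1 : ∑ i with k ≤ (i : Fin n).val, c n ρ i = ∑ i with k ≤ (i : Fin n).val, W n ρ i := by
    apply sum_congr rfl
    intro i hi
    have hi := (mem_filter.1 hi).2
    have : (Fin.rev i : Fin n).val + 1 - (n - n / 2) = 0 := by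
      rw [Fin.val_rev]; omega
    have : W n ρ (Fin.rev i : Fin n) = 0 := by unfold W; rw [this]; simp [A]
    rw [c, this, sub_zero]
  have e2 : ∑ i, c n ρ i * u i ≤
      (1 - ρ) * ∑ i : Fin n, W n ρ i + ρ * ∑ i with u i = 1, W n ρ i := by
    rw [sum_filter, mul_sum, mul_sum, ← sum_add_distrib]
    apply sum_le_sum
    intro i _
    have a := W_nonneg h0 n i
    have b := W_nonneg h0 n (Fin.rev i : Fin n)
    have d := hu0 i
    have : c n ρ i * u i ≤ W n ρ i * u i := by
      apply mul_le_mul_of_nonneg_right _ d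
      unfold c; linarith
    refine this.trans ?_
    by_cases h : u i = 1
    · simp [h]; linarith
    · have := (hu1 i).resolve_left h
      simp only [h, if_false]
      nlinarith
  have e3 := topsum_le (fun i : Fin n => W n ρ i) (fun a b hab => W_mono h0 h1 n hab)
    (fun i => W_nonneg h0 n i) (k + 1) (univ.filter fun i => u i = 1) (by omega)
  have e4 : ∑ i with k ≤ (i : Fin n).val, W n ρ i =
      W n ρ k + ∑ i with k + 1 ≤ (i : Fin n).val, W n ρ i := by
    have : (univ.filter fun i : Fin n => k ≤ i.val) =
      insert ⟨k, hkn⟩ (univ.filter fun i : Fin n => k + 1 ≤ i.val) := by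
      ext i; simp [Fin.ext_iff]; omega
    rw [this, sum_insert (by simp)]
  have e5 : ∑ i : Fin n, W n ρ i = ∑ i ∈ range k, W n ρ i +
      ∑ i with k ≤ (i : Fin n).val, W n ρ i := by
    rw [Fin.sum_univ_eq_sum_range (fun i => W n ρ i) n, sum_filter,
      Fin.sum_univ_eq_sum_range (fun i => if k ≤ i then W n ρ i else 0) n, ← sum_filter,
      ← sum_range_add_sum_Ico _ hkn.le]
    congr 1
    apply sum_congr _ (fun _ _ => rfl)
    ext i; simp; omega
  have e6 := W_key h0 n k hk
  rw [e1]
  rw [e5, e4] at e2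
  rw [e4]
  nlinarith

lemma core {n : ℕ} {ρ : ℝ} (h0 : 0 < ρ) (h1 : ρ ≤ 1 / 2) (u : Fin n → ℝ)
    (hu0 : ∀ i, u i = 0 ∨ ρ ≤ u i) (hu1 : ∀ i, u i = 1 ∨ u i ≤ 1 - ρ) (k : ℕ) (hkn : k ≤ n)
    (hc : #{i | u i = 1} < n - k) (hz : #{i | u i = 0} < k) :
    ∑ i, c n ρ i * u i + 1 ≤ ∑ i with k ≤ (i : Fin n).val, c n ρ i := by
  by_cases hk : n - n / 2 ≤ k
  · exact core_right h0 h1 u (fun i => by rcases hu0 i with h | h <;> linarith) hu1 k hk hc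
  · have := core_right (n := n) h0 h1 (fun i => 1 - u (Fin.rev i))
      (fun i => by rcases hu1 (Fin.rev i) with h | h <;> linarith)
      (fun i => by
        rcases hu0 (Fin.rev i) with h | h
        · left; simp [h]
        · right; linarith) (n - k) (by omega) (by
        have : #{i : Fin n | 1 - u (Fin.rev i) = 1} = #{i | u i = 0} := by
          apply card_bij (fun i _ => Fin.rev i)
          · intro i; simp
          · intro i _ j _; simp
          · intro i hi
            exact ⟨Fin.rev i, by simpa using hi, by simp⟩
        omega)
    have e1 : ∑ i, c n ρ i * (1 - u (Fin.rev i)) = ∑ i, c n ρ i * u i := by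
      rw [← sum_rev]
      simp only [c_rev, Fin.rev_rev]
      have : ∀ i, -c n ρ i * (1 - u i) = c n ρ i * u i - c n ρ i := fun i => by ring
      simp only [this, sum_sub_distrib, c_sum, sub_zero]
    have e2 : ∑ i with n - k ≤ (i : Fin n).val, c n ρ i = ∑ i with k ≤ (i : Fin n).val, c n ρ i := by
      have s1 := sum_filter_add_sum_filter_not univ (fun i : Fin n => k ≤ i.val) (c n ρ)
      rw [c_sum] at s1
      have s2 : ∑ i with n - k ≤ (i : Fin n).val, c n ρ i
          = - ∑ i with ¬ k ≤ (i : Fin n).val, c n ρ i := by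
        rw [sum_filter, sum_filter, ← sum_rev, ← sum_neg_distrib]
        apply sum_congr rfl
        intro i _
        rw [c_rev, Fin.val_rev]
        by_cases h : k ≤ i.val
        · rw [if_neg (by omega), if_neg (by omega)]; simp
        · rw [if_pos (by omega), if_pos (by omega)]
      linarith
    rw [e1, e2] at this
    exact this

lemma upper {n : ℕ} (p : Fin n → Prop) (hp : ∀ i j, i ≤ j → p i → p j) :
    ∃ k ≤ n, ∀ i : Fin n, p i ↔ k ≤ i.val := by
  classical
  have hex : ∃ k, ∀ i : Fin n, k ≤ i.val → p i := ⟨n, fun i hi => by omega⟩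
  refine ⟨Nat.find hex, Nat.find_min' hex (fun i hi => by omega), fun i => ⟨fun h => ?_, ?_⟩⟩
  · exact Nat.find_min' hex (fun j hj => hp i j hj h)
  · exact Nat.find_spec hex i

section step

variable {n : ℕ} {ρ : ℝ} (h0 : 0 < ρ) (h1 : ρ ≤ 1 / 2)
  (P : Matrix (Fin n) (Fin n) ℝ) (hnn : ∀ i j, 0 ≤ P i j) (hrow : ∀ i, ∑ j, P i j = 1)
  (hdiag : ∀ i, 0 < P i i) (hsymm : ∀ i j, P i j = 0 ↔ P j i = 0)
  (hthr : ∀ i j, P i j ≠ 0 → ρ ≤ P i j) (x : Fin n → ℝ) (hx : ∀ i, x i ∈ Set.Icc (0 : ℝ) 1)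
  (τ σ : Equiv.Perm (Fin n)) (hτ : Monotone (x ∘ τ))

include h0 h1 hnn hrow hdiag hsymm hthr hτ

lemma pointwise (y : ℝ) (q : ℝ)
    (hq : q = 0 ∨ (q = 1 ∧ ∃ i j, P i j ≠ 0 ∧ ¬ y < x i ∧ y < x j)) :
    ∑ v, c n ρ (σ v) * (∑ j with y < x j, P v j) + q ≤ ∑ j with y < x j, c n ρ (τ.symm j) := by
  obtain ⟨k, hkn, hk⟩ := upper (fun i => y < x (τ i)) (fun i j hij h => h.trans_le (hτ hij))
  have e1 : ∑ j with y < x j, c n ρ (τ.symm j) = ∑ i with k ≤ (i : Fin n).val, c n ρ i := by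
    rw [sum_filter, sum_filter, ← Equiv.sum_comp τ]
    simp only [hk, Equiv.symm_apply_apply]
  have hcard : #{j | y < x j} = n - k := by
    rw [← card_ge n k]
    apply card_bij (fun i _ => τ.symm i)
    · intro i; simp [← hk]
    · intro i _ j _; simp
    · intro i hi
      exact ⟨τ i, by simpa [← hk] using hi, by simp⟩
  have hsplit : ∀ v, (∑ j with y < x j, P v j) + (∑ j with ¬ y < x j, P v j) = 1 := fun v => by
    rw [sum_filter_add_sum_filter_not, hrow]
  set u : Fin n → ℝ := fun v => ∑ j with y < x j, P v j with hu
  set w : Fin n → ℝ := fun v => ∑ j with ¬ y < x j, P v j with hw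
  have hu_ge : ∀ v j, y < x j → P v j ≠ 0 → ρ ≤ u v := fun v j hj hP =>
    (hthr v j hP).trans (single_le_sum (f := fun j => P v j) (fun i _ => hnn v i)
      (mem_filter.2 ⟨mem_univ j, hj⟩))
  have hw_ge : ∀ v j, ¬ y < x j → P v j ≠ 0 → ρ ≤ w v := fun v j hj hP =>
    (hthr v j hP).trans (single_le_sum (f := fun j => P v j) (fun i _ => hnn v i)
      (mem_filter.2 ⟨mem_univ j, hj⟩))
  have hu0 : ∀ v, u v = 0 ∨ ρ ≤ u v := by
    intro v
    by_cases h : ∃ j, y < x j ∧ P v j ≠ 0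
    · obtain ⟨j, hj, hP⟩ := h; exact Or.inr (hu_ge v j hj hP)
    · push Not at h
      left; exact sum_eq_zero fun j hj => h j (mem_filter.1 hj).2
  have hw0 : ∀ v, w v = 0 ∨ ρ ≤ w v := by
    intro v
    by_cases h : ∃ j, ¬ y < x j ∧ P v j ≠ 0
    · obtain ⟨j, hj, hP⟩ := h; exact Or.inr (hw_ge v j hj hP)
    · push Not at h
      left; exact sum_eq_zero fun j hj => h j (not_lt.1 (mem_filter.1 hj).2)
  have hsp : ∀ v, u v + w v = 1 := hsplit
  have hu1 : ∀ v, u v = 1 ∨ u v ≤ 1 - ρ := by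
    intro v
    have := hsp v
    rcases hw0 v with h | h
    · left; linarith
    · right; linarith
  have e2 : ∑ v, c n ρ (σ v) * u v = ∑ i, c n ρ i * u (σ.symm i) := by
    rw [← Equiv.sum_comp σ (fun i => c n ρ i * u (σ.symm i))]
    simp only [Equiv.symm_apply_apply]
  have hcσ : ∀ a : ℝ, #{i | u (σ.symm i) = a} = #{v | u v = a} := by
    intro a
    apply card_bij (fun i _ => σ.symm i)
    · intro i; simp
    · intro i _ j _; simp
    · intro i hi
      exact ⟨σ i, by simpa using hi, by simp⟩
  have hcardn : #{j | ¬ y < x j} = k := by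
    have := card_filter_add_card_filter_not (s := (univ : Finset (Fin n))) (fun j => y < x j)
    simp only [card_univ, Fintype.card_fin] at this
    omega
  rw [e1]
  show ∑ v, c n ρ (σ v) * u v + q ≤ _
  rw [e2]
  by_cases hcr : ∃ i j, P i j ≠ 0 ∧ ¬ y < x i ∧ y < x j
  · have hq1 : q ≤ 1 := by rcases hq with h | h <;> linarith
    obtain ⟨i, j, hP, hi, hj⟩ := hcr
    have hP' : P j i ≠ 0 := fun h => hP ((hsymm i j).2 h)
    have := core h0 h1 (fun i => u (σ.symm i)) (fun i => hu0 _) (fun i => hu1 _) k hkn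
      (by
        rw [hcσ, ← hcard]
        apply card_lt_card
        refine (ssubset_iff_of_subset ?_).2 ⟨j, by simpa using hj, ?_⟩
        · intro v hv
          have hv := (mem_filter.1 hv).2
          by_contra hvn
          have := hw_ge v v (by simpa using hvn) (hdiag v).ne'
          have := hsp v
          linarith
        · intro hv
          have hv := (mem_filter.1 hv).2
          have := hw_ge j i hi hP'
          have := hsp j
          linarith)
      (by
        rw [hcσ]
        conv_rhs => rw [← hcardn]
        apply card_lt_card
        refine (ssubset_iff_of_subset ?_).2 ⟨i, by simpa using hi, ?_⟩
        · intro v hv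
          have hv := (mem_filter.1 hv).2
          by_contra hvn
          have := hu_ge v v (by simpa using hvn) (hdiag v).ne'
          linarith
        · intro hv
          have hv := (mem_filter.1 hv).2
          have := hu_ge i j hj hP
          linarith)
    linarith
  · have hq0 : q = 0 := by
      rcases hq with h | h
      · exact h
      · exact absurd h.2 hcr
    push Not at hcr
    have hu' : ∀ v, u v = if y < x v then 1 else 0 := by
      intro v
      by_cases hv : y < x v
      · rw [if_pos hv]
        have : w v = 0 := sum_eq_zero fun j hj => by
          have hj := (mem_filter.1 hj).2
          by_contra h
          have := hcr j v (fun h' => h ((hsymm j v).1 h')) (not_lt.1 hj)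
          linarith
        have := hsp v
        linarith
      · rw [if_neg hv]
        exact sum_eq_zero fun j hj => by
          have hj := (mem_filter.1 hj).2
          by_contra h
          have := hcr v j h (not_lt.1 hv)
          linarith
    have := topsum (c n ρ) (c_mono h0 h1 n) k (univ.filter fun i => y < x (σ.symm i)) (by
      rw [← hcard]
      apply card_bij (fun i _ => σ.symm i)
      · intro i; simp
      · intro i _ j _; simp
      · intro i hi
        exact ⟨σ i, by simpa using hi, by simp⟩)
    rw [hq0]
    simp only [hu', mul_ite, mul_one, mul_zero, ← sum_filter, add_zero]
    exact this

include hx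

lemma step :
    ∑ v, c n ρ (σ v) * (P.mulVec x) v +
      (volume (⋃ (i : Fin n) (j : Fin n) (_ : P i j ≠ 0), Set.uIcc (x i) (x j))).toReal
      ≤ ∑ v, c n ρ (τ.symm v) * x v := by
  set U := ⋃ (i : Fin n) (j : Fin n) (_ : P i j ≠ 0), Set.uIcc (x i) (x j) with hU
  have hUm : MeasurableSet U :=
    MeasurableSet.iUnion fun i => MeasurableSet.iUnion fun j => MeasurableSet.iUnion fun _ =>
      measurableSet_uIcc
  have hUs : U ⊆ Set.Icc 0 1 := by
    simp only [hU, Set.iUnion_subset_iff]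
    intro i j _
    exact Set.uIcc_subset_Icc (hx i) (hx j)
  have hUfin : volume U ≠ ⊤ := ((measure_mono hUs).trans_lt (by simp)).ne
  let g : Fin n → ℝ → ℝ := fun j => (Set.Ico 0 (x j)).indicator 1
  have hgi : ∀ j, Integrable (g j) volume := fun j =>
    (integrable_indicator_iff measurableSet_Ico).2 (integrableOn_const (by simp) (by simp))
  have hgint : ∀ j, ∫ y, g j y = x j := fun j => by
    simp only [g]
    rw [integral_indicator_one measurableSet_Ico]
    simp [Measure.real, (hx j).1]
  let b : Fin n → ℝ := fun j => c n ρ (τ.symm j) - ∑ v, c n ρ (σ v) * P v j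
  have hint : ∫ y, ∑ j, b j * g j y = ∑ j, b j * x j := by
    rw [integral_finsetSum _ (fun j _ => (hgi j).const_mul _)]
    simp only [integral_const_mul, hgint]
  have hle : ∫ y, U.indicator (1 : ℝ → ℝ) y ≤ ∫ y, ∑ j, b j * g j y := by
    apply integral_mono_ae
    · exact (integrable_indicator_iff hUm).2 (integrableOn_const (hUfin) (by simp))
    · exact integrable_finsetSum _ (fun j _ => (hgi j).const_mul _)
    · have hne : ∀ᵐ y ∂(volume : Measure ℝ), y ∉ Set.range x := by
        exact (Set.finite_range x).countable.ae_notMem volume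
      filter_upwards [hne] with y hy
      by_cases hy0 : y < 0
      · have h1 : y ∉ U := fun h => by have := (hUs h).1; linarith
        have h2 : ∀ j, g j y = 0 := fun j => by simp [g, hy0]
        simp [h1, h2]
      · push Not at hy0
        have hg : ∀ j, g j y = if y < x j then 1 else 0 := fun j => by
          simp [g, Set.indicator_apply, hy0]
        have := pointwise h0 h1 P hnn hrow hdiag hsymm hthr x τ σ hτ y (U.indicator 1 y) (by
          by_cases hyU : y ∈ U
          · right
            refine ⟨by simp [hyU], ?_⟩
            simp only [hU, Set.mem_iUnion] at hyU
            obtain ⟨i, j, hP, hm⟩ := hyU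
            have hi : y ≠ x i := fun h => hy ⟨i, h.symm⟩
            have hj : y ≠ x j := fun h => hy ⟨j, h.symm⟩
            rcases Set.mem_uIcc.1 hm with ⟨h1, h2⟩ | ⟨h1, h2⟩
            · exact ⟨i, j, hP, not_lt.2 h1, lt_of_le_of_ne h2 hj⟩
            · exact ⟨j, i, fun h => hP ((hsymm i j).2 h), not_lt.2 h1, lt_of_le_of_ne h2 hi⟩
          · left; simp [hyU])
        have e : ∑ j, b j * g j y = ∑ j with y < x j, c n ρ (τ.symm j) -
            ∑ v, c n ρ (σ v) * (∑ j with y < x j, P v j) := by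
          simp only [hg, mul_ite, mul_one, mul_zero, ← sum_filter, b, sum_sub_distrib, mul_sum]
          rw [sum_comm]
        rw [e]
        linarith
  rw [integral_indicator_one hUm, hint] at hle
  have e : ∑ j, b j * x j = ∑ v, c n ρ (τ.symm v) * x v -
      ∑ v, c n ρ (σ v) * (P.mulVec x) v := by
    simp only [b, sub_mul, sum_sub_distrib, Matrix.mulVec, dotProduct, mul_sum, sum_mul]
    rw [sum_comm]
    simp only [mul_assoc]
  rw [e] at hle
  simp only [Measure.real] at hle
  linarith

end step

lemma stepEnergy_le (U : Set ℝ) (hb : Bornology.IsBounded U) : stepEnergy 1 U ≤ volume U := by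
  unfold stepEnergy
  have hoc : ∀ C : blockSet U, (C : Set ℝ).OrdConnected := by
    rintro ⟨C, a, ha, rfl⟩
    exact isPreconnected_connectedComponentIn.ordConnected
  have hsub : ∀ C : blockSet U, (C : Set ℝ) ⊆ U := by
    rintro ⟨C, a, ha, rfl⟩
    exact connectedComponentIn_subset U a
  have hvol : ∀ C : blockSet U, ENNReal.ofReal (Metric.diam (C : Set ℝ) ^ (1 : ℝ)) ≤
      volume (C : Set ℝ) := by
    intro C
    rw [Real.rpow_one]
    refine ENNReal.ofReal_toReal_le.trans (Metric.ediam_le fun a ha b hb => ?_)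
    rw [edist_comm, edist_dist, Real.dist_eq, ← Real.volume_interval]
    exact measure_mono ((hoc C).uIcc_subset ha hb)
  calc _ ≤ ∑' C : blockSet U, volume (C : Set ℝ) := ENNReal.tsum_le_tsum hvol
    _ ≤ volume (⋃ C : blockSet U, (C : Set ℝ)) := by
      apply tsum_meas_le_meas_iUnion_of_disjoint
      · intro C; exact (hoc C).measurableSet
      · rintro ⟨C, a, ha, rfl⟩ ⟨D, b, hb, rfl⟩ hne
        refine Set.disjoint_left.2 fun z hz1 hz2 => hne ?_
        exact Subtype.ext ((connectedComponentIn_eq hz1).trans (connectedComponentIn_eq hz2).symm)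
    _ ≤ volume U := measure_mono (Set.iUnion_subset hsub)

end AvgAux

/-- For every `n ≥ 2`, every weight threshold `ρ ∈ (0,1/2]`, and every
`m` with `1 ≤ m ≤ n-1`, the maximum 1-energy satisfies
`𝓔_{m,1} ≤ 3·e·n·(1/ρ)^⌊n/2⌋`. -/
theorem maxOneEnergy_le (n m : ℕ) (ρ : ℝ) (hn : 2 ≤ n) (hρ0 : 0 < ρ) (hρ1 : ρ ≤ 1 / 2)
    (hm1 : 1 ≤ m) (hmn : m ≤ n - 1)
    (S : AvgSystem n ρ) (hx0 : ∀ i, S.x 0 i ∈ Set.Icc (0 : ℝ) 1)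
    (hcomp : S.componentsLE m) :
    S.energy 1 ≤ ENNReal.ofReal (3 * Real.exp 1 * n * (1 / ρ) ^ (n / 2)) := by
  classical
  have hx : ∀ t i, S.x t i ∈ Set.Icc (0 : ℝ) 1 := by
    intro t
    induction t with
    | zero => exact hx0
    | succ t ih =>
      intro i
      rw [S.update]
      simp only [Matrix.mulVec, dotProduct]
      refine ⟨Finset.sum_nonneg fun j _ => mul_nonneg (S.nonneg t i j) (ih j).1, ?_⟩
      rw [← S.rowSum t i]
      exact Finset.sum_le_sum fun j _ => mul_le_of_le_one_right (S.nonneg t i j) (ih j).2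
  let τ : ℕ → Equiv.Perm (Fin n) := fun t => Tuple.sort (S.x t)
  let Φ : ℕ → ℝ := fun t => ∑ v, AvgAux.c n ρ ((τ t).symm v) * S.x t v
  have hUs : ∀ t, S.edgeUnion t ⊆ Set.Icc 0 1 := by
    intro t
    simp only [AvgSystem.edgeUnion, Set.iUnion_subset_iff]
    intro i j _
    exact Set.uIcc_subset_Icc (hx t i) (hx t j)
  have hUfin : ∀ t, MeasureTheory.volume (S.edgeUnion t) ≠ ⊤ := fun t =>
    ((MeasureTheory.measure_mono (hUs t)).trans_lt (by simp)).ne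
  have hstep : ∀ t, Φ (t + 1) + (MeasureTheory.volume (S.edgeUnion t)).toReal ≤ Φ t := by
    intro t
    have := AvgAux.step hρ0 hρ1 (S.P t) (S.nonneg t) (S.rowSum t) (S.diagPos t) (S.symm t)
      (S.threshold t) (S.x t) (hx t) (τ t) (τ (t + 1)).symm (Tuple.monotone_sort _)
    rw [← S.update] at this
    exact this
  have hW := AvgAux.W_sum hρ0 hρ1 n
  have hΦ : ∀ t, |Φ t| ≤ 2 * (1 / ρ) ^ (n / 2) := by
    intro t
    have e1 : ∑ v, AvgAux.W n ρ ((τ t).symm v) = ∑ i : Fin n, AvgAux.W n ρ i :=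
      Equiv.sum_comp (τ t).symm (fun i : Fin n => AvgAux.W n ρ i)
    have e2 : ∑ v, AvgAux.W n ρ (Fin.rev ((τ t).symm v)) = ∑ i : Fin n, AvgAux.W n ρ i := by
      rw [Equiv.sum_comp (τ t).symm (fun i : Fin n => AvgAux.W n ρ (Fin.rev i))]
      exact AvgAux.sum_rev (fun i : Fin n => AvgAux.W n ρ i)
    rw [abs_le]
    constructor
    · refine le_trans (neg_le_neg hW) ?_
      rw [← e2, ← Finset.sum_neg_distrib]
      apply Finset.sum_le_sum
      intro v _
      have a := AvgAux.W_nonneg hρ0 n ((τ t).symm v)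
      have b := AvgAux.W_nonneg hρ0 n (Fin.rev ((τ t).symm v))
      have d := (hx t v).1
      have e := (hx t v).2
      unfold AvgAux.c
      nlinarith
    · refine le_trans ?_ hW
      rw [← e1]
      apply Finset.sum_le_sum
      intro v _
      have a := AvgAux.W_nonneg hρ0 n ((τ t).symm v)
      have b := AvgAux.W_nonneg hρ0 n (Fin.rev ((τ t).symm v))
      have d := (hx t v).1
      have e := (hx t v).2
      unfold AvgAux.c
      nlinarith
  have hsum : ∀ T, ∑ t ∈ Finset.range T, (MeasureTheory.volume (S.edgeUnion t)).toReal
      ≤ Φ 0 - Φ T := by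
    intro T
    induction T with
    | zero => simp
    | succ T ih =>
      rw [Finset.sum_range_succ]
      have := hstep T
      linarith
  have hr : 0 ≤ (1 / ρ) ^ (n / 2) := by positivity
  have hconst : 4 * (1 / ρ) ^ (n / 2) ≤ 3 * Real.exp 1 * n * (1 / ρ) ^ (n / 2) := by
    apply mul_le_mul_of_nonneg_right _ hr
    have h1 : (2 : ℝ) ≤ Real.exp 1 := by have := Real.add_one_le_exp 1; linarith
    have h2 : (2 : ℝ) ≤ n := by exact_mod_cast hn
    nlinarith
  unfold AvgSystem.energy
  rw [ENNReal.tsum_eq_iSup_nat]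
  apply iSup_le
  intro T
  calc ∑ t ∈ Finset.range T, stepEnergy 1 (S.edgeUnion t)
      ≤ ∑ t ∈ Finset.range T, MeasureTheory.volume (S.edgeUnion t) :=
        Finset.sum_le_sum fun t _ => AvgAux.stepEnergy_le _
          ((Metric.isBounded_Icc 0 1).subset (hUs t))
    _ = ENNReal.ofReal (∑ t ∈ Finset.range T, (MeasureTheory.volume (S.edgeUnion t)).toReal) := by
        rw [ENNReal.ofReal_sum_of_nonneg (fun _ _ => ENNReal.toReal_nonneg)]
        exact Finset.sum_congr rfl fun t _ => (ENNReal.ofReal_toReal (hUfin t)).symm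
    _ ≤ _ := by
        apply ENNReal.ofReal_le_ofReal
        have a := abs_le.1 (hΦ 0)
        have b := abs_le.1 (hΦ T)
        have := hsum T
        linarith [a.2, b.1]
end

section
/- There is an absolute constant a > 0 such that for every n ≥ 2, every weight threshold ρ ∈ (0,1/2], every s ∈ (0,1], and every m with 1 ≤ m ≤ n−1, the maximum s-energy satisfies 𝓔_{m,s} ≤ (a·m·n/s)^m · (1/ρ)^{n−1}. -/
open scoped BigOperators ENNReal

open Finset in
structure Tw (ρ : ℝ) (x lo hi : ℕ → ℕ → ℝ) (cov : ℕ → ℕ → Prop) : Prop where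
  mono : ∀ t j, x t j ≤ x t (j+1)
  lo_le : ∀ t j, lo t j ≤ x t j
  le_hi : ∀ t j, x t j ≤ hi t j
  lo_cov : ∀ t j, cov t j → lo t (j+1) = lo t j
  hi_cov : ∀ t j, cov t j → hi t j = hi t (j+1)
  lo_unc : ∀ t j, ¬ cov t j → lo t (j+1) = x t (j+1)
  hi_unc : ∀ t j, ¬ cov t j → hi t j = x t j
  step_lo : ∀ t j, lo t j ≤ x (t+1) j
  step_hi : ∀ t j, x (t+1) j ≤ hi t j
  push_lo : ∀ t j, cov t j → (1-ρ) * lo t j + ρ * x t (j+1) ≤ x (t+1) j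
  push_hi : ∀ t j, cov t j → x (t+1) (j+1) ≤ (1-ρ) * hi t (j+1) + ρ * x t j

namespace Tw

open Classical in
noncomputable def en (x lo : ℕ → ℕ → ℝ) (cov : ℕ → ℕ → Prop) (s : ℝ) (a b t : ℕ) : ℝ :=
  ∑ j ∈ Finset.Ioc a b with ¬ cov t j, (x t j - lo t j) ^ s

noncomputable def pot (ρ : ℝ) (x : ℕ → ℕ → ℝ) (a b t : ℕ) : ℝ :=
  ∑ j ∈ Finset.Ioc a b, (ρ^(j-a-1) * ((b:ℝ)+1-j) - ρ^(b-j) * ((j:ℝ)-a)) * x t j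

variable {ρ : ℝ} {x lo hi : ℕ → ℕ → ℝ} {cov : ℕ → ℕ → Prop}

open Classical in
lemma sumV (h : Tw ρ x lo hi cov) (w : ℕ → ℝ) (t a : ℕ) (ha : ¬ cov t a) (b : ℕ) (hb : a ≤ b)
    (hw : ∀ j ∈ Finset.Ioc a b, 0 ≤ w j) :
    ∑ j ∈ Finset.Ioc a b, ((if cov t j then ρ * w j else 0) - w (j+1)) * (x t (j+1) - lo t (j+1))
      + w (b+1) * (x t (b+1) - lo t (b+1)) ≤ ∑ j ∈ Finset.Ioc a b, w j * (x (t+1) j - x t j) := by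
  induction b, hb using Nat.le_induction with
  | base => simp [h.lo_unc t a ha]
  | succ b hb ih =>
    have ih' := ih (fun j hj => hw j (by simp at hj ⊢; omega))
    rw [← Finset.insert_Ioc_right_eq_Ioc_add_one hb, Finset.sum_insert (by simp),
      Finset.sum_insert (by simp)]
    have hwb := hw (b+1) (by simp; omega)
    by_cases hc : cov t (b+1)
    · simp only [hc, if_true]
      have h1 := h.push_lo t (b+1) hc
      have h2 := h.lo_cov t (b+1) hc
      rw [h2]
      nlinarith [mul_le_mul_of_nonneg_left h1 hwb]
    · simp only [hc, if_false]
      have h1 := h.step_lo t (b+1)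
      have h2 := h.lo_unc t (b+1) hc
      rw [h2]
      nlinarith [mul_le_mul_of_nonneg_left h1 hwb]

open Classical in
lemma sumQ (h : Tw ρ x lo hi cov) (q : ℕ → ℝ) (t a : ℕ) (b : ℕ) (hb : a ≤ b)
    (hq : ∀ j ∈ Finset.Ioc a b, 0 ≤ q j) :
    ∑ j ∈ Finset.Ico a b, ((if cov t j then ρ * q (j+1) else 0) - q j) * (hi t j - x t j)
      + q a * (hi t a - x t a) - q b * (hi t b - x t b)
      ≤ ∑ j ∈ Finset.Ioc a b, q j * (x t j - x (t+1) j) := by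
  induction b, hb using Nat.le_induction with
  | base => simp
  | succ b hb ih =>
    have ih' := ih (fun j hj => hq j (by simp at hj ⊢; omega))
    rw [← Finset.insert_Ioc_right_eq_Ioc_add_one hb, Finset.sum_insert (by simp),
      Finset.sum_Ico_succ_top hb]
    have hwb := hq (b+1) (by simp; omega)
    by_cases hc : cov t b
    · simp only [hc, if_true]
      have h1 := h.push_hi t b hc
      have h2 := h.hi_cov t b hc
      rw [h2] at ih' ⊢
      nlinarith [mul_le_mul_of_nonneg_left h1 hwb]
    · simp only [hc, if_false]
      have h1 := h.step_hi t (b+1)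
      have h2 := h.hi_unc t b hc
      rw [h2] at ih' ⊢
      nlinarith [mul_le_mul_of_nonneg_left h1 hwb]

open Classical in
lemma pot_step (h : Tw ρ x lo hi cov) (h0 : 0 < ρ) (t a b : ℕ) (hab : a < b)
    (ha : ¬ cov t a) (hb : ¬ cov t b) :
    ∑ j ∈ Finset.Ioo a b with cov t j, ρ^(j-a) * (x t (j+1) - lo t (j+1))
     + ∑ j ∈ Finset.Ioo a b with cov t j, ρ^(b-j) * (hi t j - x t j)
      ≤ pot ρ x a b (t+1) - pot ρ x a b t := by
  have hV := h.sumV (fun j => ρ^(j-a-1) * ((b:ℝ)+1-j)) t a ha b hab.le (by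
    intro j hj
    simp at hj
    have : (j:ℝ) ≤ b := by exact_mod_cast hj.2
    have : 0 ≤ (b:ℝ)+1-j := by linarith
    positivity)
  have hQ := h.sumQ (fun j => ρ^(b-j) * ((j:ℝ)-a)) t a b hab.le (by
    intro j hj
    simp at hj
    have : (a:ℝ) ≤ j := by exact_mod_cast hj.1.le
    have : 0 ≤ (j:ℝ)-a := by linarith
    positivity)
  have e : pot ρ x a b (t+1) - pot ρ x a b t =
    ∑ j ∈ Finset.Ioc a b, (ρ^(j-a-1) * ((b:ℝ)+1-j)) * (x (t+1) j - x t j)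
    + ∑ j ∈ Finset.Ioc a b, (ρ^(b-j) * ((j:ℝ)-a)) * (x t j - x (t+1) j) := by
    unfold pot
    rw [← Finset.sum_sub_distrib, ← Finset.sum_add_distrib]
    apply Finset.sum_congr rfl
    intros; ring
  rw [e]
  refine add_le_add (le_trans ?_ hV) (le_trans ?_ hQ)
  · have : ((fun j : ℕ => ρ^(j-a-1) * ((b:ℝ)+1-j)) (b+1)) * (x t (b+1) - lo t (b+1)) = 0 := by
      simp
    rw [this, add_zero, ← Finset.Ioo_insert_right hab, Finset.sum_insert (by simp),
      h.lo_unc t b hb, sub_self, mul_zero, zero_add, Finset.sum_filter]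
    apply Finset.sum_le_sum
    intro j hj
    simp at hj
    split_ifs with hc
    · apply le_of_eq
      obtain ⟨d, rfl⟩ : ∃ d, j = a + 1 + d := ⟨j - a - 1, by omega⟩
      have e1 : a + 1 + d - a = d + 1 := by omega
      have e2 : a + 1 + d + 1 - a = d + 2 := by omega
      rw [e1, e2]
      push_cast
      try rw [show d + 2 - 1 = d + 1 from rfl]
      try rw [show d + 1 - 1 = d from rfl]
      ring
    · rw [h.lo_unc t j hc]; simp
  · rw [h.hi_unc t b hb, h.hi_unc t a ha, sub_self (x t b), sub_self (x t a), mul_zero, mul_zero, sub_zero, add_zero,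
      ← Finset.Ioo_insert_left hab, Finset.sum_insert (by simp),
      h.hi_unc t a ha, sub_self (x t a), mul_zero, zero_add, Finset.sum_filter]
    apply Finset.sum_le_sum
    intro j hj
    simp at hj
    split_ifs with hc
    · apply le_of_eq
      obtain ⟨d, rfl⟩ : ∃ d, b = j + 1 + d := ⟨b - j - 1, by omega⟩
      have e1 : j + 1 + d - j = d + 1 := by omega
      have e2 : j + 1 + d - (j + 1) = d := by omega
      rw [e1, e2]
      push_cast
      ring
    · rw [h.hi_unc t j hc]; simp

lemma pot_mono (h : Tw ρ x lo hi cov) (h0 : 0 < ρ) (t a b : ℕ) (hab : a < b)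
    (ha : ¬ cov t a) (hb : ¬ cov t b) : 0 ≤ pot ρ x a b (t+1) - pot ρ x a b t := by
  classical
  refine le_trans ?_ (h.pot_step h0 t a b hab ha hb)
  refine add_nonneg (Finset.sum_nonneg ?_) (Finset.sum_nonneg ?_)
  · intro j _
    have := h.lo_le t (j+1)
    exact mul_nonneg (by positivity) (by linarith)
  · intro j _
    have := h.le_hi t j
    exact mul_nonneg (by positivity) (by linarith)

lemma pot_gap (h : Tw ρ x lo hi cov) (h0 : 0 < ρ) (t a b k : ℕ) (hak : a < k) (hkb : k < b)
    (ha : ¬ cov t a) (hb : ¬ cov t b) (hk : cov t k) :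
    (ρ^(k-a) + ρ^(b-k)) * (x t (k+1) - x t k) ≤ pot ρ x a b (t+1) - pot ρ x a b t := by
  classical
  refine le_trans ?_ (h.pot_step h0 t a b (by omega) ha hb)
  rw [add_mul]
  have hm : k ∈ Finset.filter (fun j => cov t j) (Finset.Ioo a b) := by simp; exact ⟨⟨hak, hkb⟩, hk⟩
  refine add_le_add ?_ ?_
  · refine le_trans ?_ (Finset.single_le_sum (f := fun j => ρ^(j-a) * (x t (j+1) - lo t (j+1))) ?_ hm)
    · have := h.lo_le t k
      have h2 := h.lo_cov t k hk
      exact mul_le_mul_of_nonneg_left (by linarith) (by positivity)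
    · intro j _
      have := h.lo_le t (j+1)
      exact mul_nonneg (by positivity) (by linarith)
  · refine le_trans ?_ (Finset.single_le_sum (f := fun j => ρ^(b-j) * (hi t j - x t j)) ?_ hm)
    · have := h.le_hi t (k+1)
      have h2 := h.hi_cov t k hk
      exact mul_le_mul_of_nonneg_left (by linarith) (by positivity)
    · intro j _
      have := h.le_hi t j
      exact mul_nonneg (by positivity) (by linarith)

lemma pot_block (h : Tw ρ x lo hi cov) (h0 : 0 < ρ) (h1 : ρ ≤ 1) (t a b v : ℕ) (hak : a < v) (hkb : v ≤ b)
    (ha : ¬ cov t a) (hb : ¬ cov t b) :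
    ρ^(b-a-1) * (x t v - lo t v) ≤ pot ρ x a b (t+1) - pot ρ x a b t := by
  classical
  obtain ⟨k, rfl⟩ : ∃ k, v = k+1 := ⟨v-1, by omega⟩
  by_cases hc : cov t k
  · have hak' : a < k := by
      rcases Nat.lt_or_ge a k with h | h
      · exact h
      · have : a = k := by omega
        subst this; exact absurd hc ha
    have hm : k ∈ Finset.filter (fun j => cov t j) (Finset.Ioo a b) := by
      simp; exact ⟨⟨hak', by omega⟩, hc⟩
    refine le_trans ?_ (h.pot_step h0 t a b (by omega) ha hb)
    refine le_add_of_le_of_nonneg ?_ (Finset.sum_nonneg ?_)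
    · refine le_trans ?_ (Finset.single_le_sum (f := fun j => ρ^(j-a) * (x t (j+1) - lo t (j+1))) ?_ hm)
      · have := h.lo_le t (k+1)
        exact mul_le_mul_of_nonneg_right (pow_le_pow_of_le_one h0.le h1 (by omega)) (by linarith)
      · intro j _
        have := h.lo_le t (j+1)
        exact mul_nonneg (by positivity) (by linarith)
    · intro j _
      have := h.le_hi t j
      exact mul_nonneg (by positivity) (by linarith)
  · rw [h.lo_unc t k hc, sub_self, mul_zero]
    exact h.pot_mono h0 t a b (by omega) ha hb

lemma mono' (h : Tw ρ x lo hi cov) (t : ℕ) : Monotone (x t) := monotone_nat_of_le_succ (h.mono t)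

lemma right_le (h : Tw ρ x lo hi cov) (b t t' : ℕ) (ht : t ≤ t')
    (hb : ∀ τ, t ≤ τ → τ < t' → ¬ cov τ b) : x t' b ≤ x t b := by
  induction t', ht using Nat.le_induction with
  | base => exact le_rfl
  | succ u hu ih =>
    have := h.step_hi u b
    rw [h.hi_unc u b (hb u hu (by omega))] at this
    exact this.trans (ih (fun τ h1 h2 => hb τ h1 (by omega)))

lemma left_le (h : Tw ρ x lo hi cov) (a t t' : ℕ) (ht : t ≤ t')
    (hb : ∀ τ, t ≤ τ → τ < t' → ¬ cov τ a) : x t (a+1) ≤ x t' (a+1) := by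
  induction t', ht using Nat.le_induction with
  | base => exact le_rfl
  | succ u hu ih =>
    have := h.step_lo u (a+1)
    rw [h.lo_unc u a (hb u hu (by omega))] at this
    exact le_trans (ih (fun τ h1 h2 => hb τ h1 (by omega))) this

lemma geo (h0 : 0 < ρ) (h1 : ρ ≤ 1/2) (n : ℕ) : ∑ i ∈ Finset.range n, ρ^i ≤ 2 := by
  have : ∑ i ∈ Finset.range n, ρ^i ≤ 2 - 2 * ρ^n := by
    induction n with
    | zero => simp
    | succ n ih =>
      rw [Finset.sum_range_succ]
      have : 0 < ρ^n := by positivity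
      rw [pow_succ]
      nlinarith
  have : 0 < ρ^n := by positivity
  linarith

lemma pot_range (h0 : 0 < ρ) (h1 : ρ ≤ 1/2) (a b t t' : ℕ) (hab : a ≤ b) (l r : ℝ) (hlr : l ≤ r)
    (hx : ∀ j ∈ Finset.Ioc a b, l ≤ x t j ∧ x t j ≤ r)
    (hx' : ∀ j ∈ Finset.Ioc a b, l ≤ x t' j ∧ x t' j ≤ r) :
    pot ρ x a b t' - pot ρ x a b t ≤ 4 * ((b:ℝ) - a) * (r - l) := by
  have hab' : (a:ℝ) ≤ b := by exact_mod_cast hab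
  have s1 : ∑ j ∈ Finset.Ioc a b, ρ^(j-a-1) ≤ 2 := by
    refine le_trans (le_of_eq ?_) (geo h0 h1 (b-a))
    refine Finset.sum_nbij' (fun j => j-a-1) (fun i => i+a+1) ?_ ?_ ?_ ?_ ?_
    · intro j hj; simp at hj ⊢; omega
    · intro j hj; simp at hj ⊢; omega
    · intro j hj; simp at hj ⊢; omega
    · intro j hj; simp at hj ⊢; omega
    · intro j hj; rfl
  have s2 : ∑ j ∈ Finset.Ioc a b, ρ^(b-j) ≤ 2 := by
    refine le_trans (le_of_eq ?_) (geo h0 h1 (b-a))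
    refine Finset.sum_nbij' (fun j => b-j) (fun i => b-i) ?_ ?_ ?_ ?_ ?_
    · intro j hj; simp at hj ⊢; omega
    · intro j hj; simp at hj ⊢; omega
    · intro j hj; simp at hj ⊢; omega
    · intro j hj; simp at hj ⊢; omega
    · intro j hj; rfl
  have key : pot ρ x a b t' - pot ρ x a b t ≤
      ∑ j ∈ Finset.Ioc a b, (ρ^(j-a-1) + ρ^(b-j)) * (((b:ℝ) - a) * (r-l)) := by
    unfold pot
    rw [← Finset.sum_sub_distrib]
    apply Finset.sum_le_sum
    intro j hj
    obtain ⟨p1, p2⟩ := hx j hj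
    obtain ⟨p3, p4⟩ := hx' j hj
    simp at hj
    have j1 : (a:ℝ) + 1 ≤ j := by exact_mod_cast hj.1
    have j2 : (j:ℝ) ≤ b := by exact_mod_cast hj.2
    have u1 : 0 < ρ^(j-a-1) := by positivity
    have u2 : 0 < ρ^(b-j) := by positivity
    generalize ρ^(j-a-1) = A at *
    generalize ρ^(b-j) = B at *
    have k1 : ((b:ℝ)+1-j) * (x t' j - x t j) ≤ ((b:ℝ)-a) * (r-l) := by
      refine le_trans (mul_le_mul_of_nonneg_left (show x t' j - x t j ≤ r - l by linarith) (by linarith)) ?_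
      exact mul_le_mul_of_nonneg_right (by linarith) (by linarith)
    have k2 : ((j:ℝ)-a) * (x t j - x t' j) ≤ ((b:ℝ)-a) * (r-l) := by
      refine le_trans (mul_le_mul_of_nonneg_left (show x t j - x t' j ≤ r - l by linarith) (by linarith)) ?_
      exact mul_le_mul_of_nonneg_right (by linarith) (by linarith)
    have := mul_le_mul_of_nonneg_left k1 u1.le
    have := mul_le_mul_of_nonneg_left k2 u2.le
    nlinarith
  rw [← Finset.sum_mul, Finset.sum_add_distrib] at key
  refine key.trans ?_
  have : 0 ≤ ((b:ℝ) - a) * (r-l) := mul_nonneg (by linarith) (by linarith)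
  nlinarith


lemma lo_ge (h : Tw ρ x lo hi cov) (t a : ℕ) (ha : ¬ cov t a) (j : ℕ) (hj : a + 1 ≤ j) :
    x t (a+1) ≤ lo t j := by
  induction j, hj using Nat.le_induction with
  | base => exact (h.lo_unc t a ha).ge
  | succ j hj ih =>
    by_cases hc : cov t j
    · rw [h.lo_cov t j hc]; exact ih
    · rw [h.lo_unc t j hc]; exact h.mono' t (by omega)

open Classical in
lemma width_eq (h : Tw ρ x lo hi cov) (t a : ℕ) (ha : ¬ cov t a) (b : ℕ) (hb : a + 1 ≤ b) :
    x t b - x t (a+1) = ∑ j ∈ Finset.Ioo a b with ¬ cov t j,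
      ((x t j - lo t j) + (x t (j+1) - x t j)) + (x t b - lo t b) := by
  induction b, hb using Nat.le_induction with
  | base =>
    have : Finset.Ioo a (a+1) = ∅ := by ext; simp
    simp [h.lo_unc t a ha, this]
  | succ b hb ih =>
    have e : Finset.Ioo a (b+1) = insert b (Finset.Ioo a b) := by
      ext; simp; omega
    rw [e, Finset.filter_insert]
    by_cases hc : cov t b
    · simp only [hc, not_true_eq_false, if_false]
      rw [h.lo_cov t b hc]; linarith
    · simp only [hc, not_false_eq_true, if_true]
      rw [Finset.sum_insert (by simp), h.lo_unc t b hc]; linarith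

open Classical in
def Good (cov : ℕ → ℕ → Prop) (a b t T M : ℕ) : Prop :=
  ∀ τ, t ≤ τ → τ < T → ¬ cov τ a ∧ ¬ cov τ b ∧
    (Finset.filter (fun j => ¬ cov τ j) (Finset.Ioo a b)).card + 1 ≤ M

lemma Good.sub {a b t T M t' T' : ℕ} (g : Good cov a b t T M) (h1 : t ≤ t') (h2 : T' ≤ T) :
    Good cov a b t' T' M := fun τ p q => g τ (by omega) (by omega)

lemma Good.left {a b t T M k t' : ℕ} (g : Good cov a b t T (M+1)) (hak : a < k) (hkb : k < b)
    (hT : t' ≤ T) (hk : ∀ τ, t ≤ τ → τ < t' → ¬ cov τ k) : Good cov a k t t' M := by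
  classical
  intro τ p q
  obtain ⟨g1, g2, g3⟩ := g τ p (by omega)
  refine ⟨g1, hk τ p q, ?_⟩
  have : (Finset.filter (fun j => ¬ cov τ j) (Finset.Ioo a k)).card <
    (Finset.filter (fun j => ¬ cov τ j) (Finset.Ioo a b)).card := by
    apply Finset.card_lt_card
    rw [Finset.ssubset_iff_of_subset]
    · exact ⟨k, by simp; exact ⟨⟨hak, hkb⟩, hk τ p q⟩, by simp⟩
    · intro j hj
      simp at hj ⊢
      exact ⟨⟨hj.1.1, by omega⟩, hj.2⟩
  omega

lemma Good.right {a b t T M k t' : ℕ} (g : Good cov a b t T (M+1)) (hak : a < k) (hkb : k < b)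
    (hT : t' ≤ T) (hk : ∀ τ, t ≤ τ → τ < t' → ¬ cov τ k) : Good cov k b t t' M := by
  classical
  intro τ p q
  obtain ⟨g1, g2, g3⟩ := g τ p (by omega)
  refine ⟨hk τ p q, g2, ?_⟩
  have : (Finset.filter (fun j => ¬ cov τ j) (Finset.Ioo k b)).card <
    (Finset.filter (fun j => ¬ cov τ j) (Finset.Ioo a b)).card := by
    apply Finset.card_lt_card
    rw [Finset.ssubset_iff_of_subset]
    · exact ⟨k, by simp; exact ⟨⟨hak, hkb⟩, hk τ p q⟩, by simp⟩
    · intro j hj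
      simp at hj ⊢
      exact ⟨⟨by omega, hj.1.2⟩, hj.2⟩
  omega

lemma dich (h : Tw ρ x lo hi cov) {a b t T M : ℕ} (hab : a < b) (g : Good cov a b t T M)
    (ht : t < T) (D : ℝ) (hD : 0 < D) (hw : D/2 ≤ x t b - x t (a+1)) :
    (∃ v, a < v ∧ v ≤ b ∧ D / (4*M) ≤ x t v - lo t v) ∨
    (∃ k, a < k ∧ k < b ∧ ¬ cov t k ∧ D / (4*M) ≤ x t (k+1) - x t k) := by
  classical
  by_contra hcon
  push Not at hcon
  obtain ⟨c1, c2⟩ := hcon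
  obtain ⟨g1, g2, g3⟩ := g t le_rfl ht
  rw [h.width_eq t a g1 b hab] at hw
  have hM : (1:ℝ) ≤ M := by exact_mod_cast (show 1 ≤ M by omega)
  have k1 : ∑ j ∈ Finset.Ioo a b with ¬ cov t j,
      ((x t j - lo t j) + (x t (j+1) - x t j)) ≤ ∑ j ∈ Finset.Ioo a b with ¬ cov t j, (2 * (D/(4*M))) := by
    apply Finset.sum_le_sum
    intro j hj
    simp at hj
    have := c1 j hj.1.1 hj.1.2.le
    have := c2 j hj.1.1 hj.1.2 hj.2
    linarith
  rw [Finset.sum_const, nsmul_eq_mul] at k1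
  have k2 := c1 b hab le_rfl
  have k3 : (((Finset.filter (fun j => ¬ cov t j) (Finset.Ioo a b)).card : ℕ):ℝ) + 1 ≤ M := by
    have : (Finset.filter (fun j => ¬ cov t j) (Finset.Ioo a b)).card + 1 ≤ M := by convert g3
    exact_mod_cast this
  have hd : 0 < D/(4*M) := by positivity
  have k4 : D/(4*M) * M = D/4 := by field_simp
  nlinarith

lemma en_nonneg (h : Tw ρ x lo hi cov) (s : ℝ) (a b t : ℕ) : 0 ≤ en x lo cov s a b t := by
  apply Finset.sum_nonneg
  intro j _
  have := h.lo_le t j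
  exact Real.rpow_nonneg (by linarith) _

lemma en_le (h : Tw ρ x lo hi cov) {s : ℝ} (hs : 0 ≤ s) {a b t T M : ℕ} (hab : a < b)
    (g : Good cov a b t T M) (ht : t < T) (D : ℝ) (hw : x t b - x t (a+1) ≤ D) :
    en x lo cov s a b t ≤ M * D ^ s := by
  classical
  obtain ⟨g1, g2, g3⟩ := g t le_rfl ht
  have : en x lo cov s a b t ≤ ∑ j ∈ Finset.Ioc a b with ¬ cov t j, D^s := by
    unfold en
    refine le_trans (le_of_eq ?_) (Finset.sum_le_sum (f := fun j => (x t j - lo t j)^s) ?_)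
    · congr
    intro j hj
    simp at hj
    have h1 := h.lo_ge t a g1 j hj.1.1
    have h2 := h.mono' t hj.1.2
    have h3 := h.lo_le t j
    exact Real.rpow_le_rpow (by linarith) (by linarith) hs
  rw [Finset.sum_const, nsmul_eq_mul] at this
  refine this.trans (mul_le_mul_of_nonneg_right ?_ ?_)
  · have : (Finset.filter (fun j => ¬ cov t j) (Finset.Ioc a b)).card ≤ M := by
      rw [← Finset.Ioo_insert_right hab, Finset.filter_insert, if_pos g2]
      refine (Finset.card_insert_le _ _).trans ?_
      convert g3
    exact_mod_cast this
  · have := h.mono' t (show a + 1 ≤ b by omega)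
    exact Real.rpow_nonneg (by linarith) _

lemma en_split (s : ℝ) (a k b t : ℕ) (hak : a ≤ k) (hkb : k ≤ b) :
    en x lo cov s a b t = en x lo cov s a k t + en x lo cov s k b t := by
  classical
  unfold en
  simp only [Finset.sum_filter]
  rw [Finset.sum_Ioc_consecutive _ hak hkb]

lemma window (h : Tw ρ x lo hi cov) (h0 : 0 < ρ) (h1 : ρ ≤ 1/2) {s : ℝ} (hs : 0 < s)
    {M : ℕ} {K : ℝ} (hK : 0 ≤ K) (a b : ℕ) (hab : a < b)
    (IH : ∀ a' b' t T, a ≤ a' → a' < b' → b' ≤ b → Good cov a' b' t T M →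
      ∑ τ ∈ Finset.Ico t T, en x lo cov s a' b' τ ≤
        K * ρ⁻¹^(b'-a'-1) * (x t b' - x t (a'+1))^s)
    (D c : ℝ) (hD : 0 < D)
    (hc : c * (D / (4*(M+1))) = (K+(M+1)) * D^s * ρ⁻¹^(b-a-1)) (T : ℕ) (d : ℕ) :
    ∀ t, T - t = d → t ≤ T → Good cov a b t T (M+1) →
      (∀ τ, t ≤ τ → τ < T → D/2 ≤ x τ b - x τ (a+1)) → x t b - x t (a+1) ≤ D →
      ∑ τ ∈ Finset.Ico t T, en x lo cov s a b τ ≤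
        c * (pot ρ x a b T - pot ρ x a b t) + 2 * K * ρ⁻¹^(b-a-1) * D^s := by
  induction d using Nat.strong_induction_on with
  | _ d ih =>
  intro t htd htT g hw hDt
  have hDs : 0 < D^s := Real.rpow_pos_of_pos hD s
  have hR0 : 0 < ρ⁻¹ := by positivity
  have hR : 1 ≤ ρ⁻¹ := by
    rw [one_le_inv₀ h0]; linarith
  have hM0 : (0:ℝ) ≤ M := by positivity
  have hd : 0 < D / (4*((M:ℝ)+1)) := by positivity
  have hc0 : 0 ≤ c := by
    by_contra hneg
    push Not at hneg
    have : 0 ≤ (K+(M+1)) * D^s * ρ⁻¹^(b-a-1) := by positivity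
    nlinarith
  rcases htT.eq_or_lt with rfl | hlt
  · simp; positivity
  have shift : ∀ t', t ≤ t' → t' < T → ∑ τ ∈ Finset.Ico (t'+1) T, en x lo cov s a b τ ≤
        c * (pot ρ x a b T - pot ρ x a b (t'+1)) + 2 * K * ρ⁻¹^(b-a-1) * D^s := by
    intro t' h1 h2
    refine ih (T - (t'+1)) (by omega) (t'+1) rfl (by omega) (g.sub (by omega) le_rfl)
      (fun τ p q => hw τ (by omega) q) ?_
    have e1 := h.right_le b t (t'+1) (by omega) (fun τ p q => (g τ p (by omega)).2.1)
    have e2 := h.left_le a t (t'+1) (by omega) (fun τ p q => (g τ p (by omega)).1)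
    linarith
  have wle : ∀ t', t ≤ t' → t' ≤ T → x t' b - x t' (a+1) ≤ D := by
    intro t' p1 p2
    have e1 := h.right_le b t t' (by omega) (fun τ p q => (g τ p (by omega)).2.1)
    have e2 := h.left_le a t t' (by omega) (fun τ p q => (g τ p (by omega)).1)
    linarith
  have hpow : ρ⁻¹^(b-a-1) * ρ^(b-a-1) = 1 := by
    rw [← mul_pow, inv_mul_cancel₀ h0.ne', one_pow]
  rcases h.dich hab g hlt D hD (hw t le_rfl hlt) with ⟨v, hv1, hv2, hv3⟩ | ⟨k, hk1, hk2, hk3, hk4⟩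
  · obtain ⟨g1, g2, g3⟩ := g t le_rfl hlt
    have p1 := h.pot_block h0 (by linarith) t a b v hv1 hv2 g1 g2
    have p2 := h.en_le hs.le hab g hlt D hDt
    have p3 := shift t le_rfl hlt
    rw [Finset.sum_eq_sum_Ico_succ_bot hlt]
    push_cast at hv3 p2
    have p4 : ρ^(b-a-1) * (D / (4*((M:ℝ)+1))) ≤ pot ρ x a b (t+1) - pot ρ x a b t :=
      le_trans (mul_le_mul_of_nonneg_left hv3 (by positivity)) p1
    have p5 := mul_le_mul_of_nonneg_left p4 hc0
    have p6 : c * (ρ^(b-a-1) * (D / (4*((M:ℝ)+1)))) = (K+(M+1)) * D^s := by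
      calc _ = (c * (D / (4*((M:ℝ)+1)))) * ρ^(b-a-1) := by ring
        _ = (K+(M+1)) * D^s * (ρ⁻¹^(b-a-1) * ρ^(b-a-1)) := by rw [hc]; ring
        _ = _ := by rw [hpow, mul_one]
    have : 0 ≤ K * D^s := by positivity
    nlinarith
  · -- split at gap k
    have bound : ∀ t', t ≤ t' → t' ≤ T → (∀ τ, t ≤ τ → τ < t' → ¬ cov τ k) →
        ∑ τ ∈ Finset.Ico t t', en x lo cov s a b τ ≤
          K * D^s * (ρ⁻¹^(k-a-1) + ρ⁻¹^(b-k-1)) := by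
      intro t' q1 q2 q3
      have e1 := IH a k t t' le_rfl hk1 hk2.le (g.left hk1 hk2 q2 q3)
      have e2 := IH k b t t' hk1.le hk2 le_rfl (g.right hk1 hk2 q2 q3)
      rw [Finset.sum_congr rfl (fun τ _ => en_split s a k b τ hk1.le hk2.le), Finset.sum_add_distrib]
      have m1 := h.mono' t (show a + 1 ≤ k by omega)
      have m2 := h.mono' t (show k + 1 ≤ b by omega)
      have m3 := h.mono t k
      have r1 : (x t k - x t (a+1))^s ≤ D^s := Real.rpow_le_rpow (by linarith) (by linarith) hs.le
      have r2 : (x t b - x t (k+1))^s ≤ D^s := Real.rpow_le_rpow (by linarith) (by linarith) hs.le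
      have r3 := mul_le_mul_of_nonneg_left r1 (show 0 ≤ K * ρ⁻¹^(k-a-1) by positivity)
      have r4 := mul_le_mul_of_nonneg_left r2 (show 0 ≤ K * ρ⁻¹^(b-k-1) by positivity)
      nlinarith
    by_cases hex : ∃ τ, t ≤ τ ∧ τ < T ∧ cov τ k
    · classical
      obtain ⟨q1, q2, q3⟩ := Nat.find_spec hex
      have q4 : ∀ τ, t ≤ τ → τ < Nat.find hex → ¬ cov τ k := by
        intro τ r1 r2 r3
        exact Nat.find_min hex r2 ⟨r1, by omega, r3⟩
      generalize Nat.find hex = t' at *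
      have b1 := bound t' q1 q2.le q4
      have b2 := shift t' q1 q2
      have b3 := h.en_le hs.le hab (g.sub q1 le_rfl) q2 D (wle t' q1 q2.le)
      obtain ⟨g1, g2, g3⟩ := g t' q1 q2
      have b4 := h.pot_gap h0 t' a b k hk1 hk2 g1 g2 q3
      have b5 := h.right_le k t t' q1 q4
      have b6 := h.left_le k t t' q1 q4
      push_cast at hk4 b3
      have b7 : (ρ^(k-a) + ρ^(b-k)) * (D / (4*((M:ℝ)+1))) ≤ pot ρ x a b (t'+1) - pot ρ x a b t' :=
        le_trans (mul_le_mul_of_nonneg_left (by linarith) (by positivity)) b4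
      have b8 := mul_le_mul_of_nonneg_left b7 hc0
      have f1 : ρ⁻¹^(b-a-1) * ρ^(k-a) = ρ⁻¹^(b-k-1) := by
        rw [show b-a-1 = (b-k-1) + (k-a) by omega, pow_add, mul_assoc, ← mul_pow,
          inv_mul_cancel₀ h0.ne', one_pow, mul_one]
      have f2 : ρ⁻¹^(b-a-1) * ρ^(b-k) = ρ⁻¹^(k-a-1) := by
        rw [show b-a-1 = (k-a-1) + (b-k) by omega, pow_add, mul_assoc, ← mul_pow,
          inv_mul_cancel₀ h0.ne', one_pow, mul_one]
      have b9 : c * ((ρ^(k-a) + ρ^(b-k)) * (D / (4*((M:ℝ)+1)))) =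
          (K+(M+1)) * D^s * (ρ⁻¹^(k-a-1) + ρ⁻¹^(b-k-1)) := by
        calc _ = (c * (D / (4*((M:ℝ)+1)))) * (ρ^(k-a) + ρ^(b-k)) := by ring
          _ = (K+(M+1)) * D^s * (ρ⁻¹^(b-a-1) * ρ^(b-k) + ρ⁻¹^(b-a-1) * ρ^(k-a)) := by rw [hc]; ring
          _ = _ := by rw [f1, f2]
      have b10 : 0 ≤ pot ρ x a b t' - pot ρ x a b t := by
        have : ∀ u, t ≤ u → u ≤ T → pot ρ x a b t ≤ pot ρ x a b u := by
          intro u hu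
          induction u, hu using Nat.le_induction with
          | base => intro _; exact le_rfl
          | succ u hu ihu =>
            intro hT
            have := h.pot_mono h0 u a b hab (g u hu (by omega)).1 (g u hu (by omega)).2.1
            have := ihu (by omega)
            linarith
        linarith [this t' q1 q2.le]
      have b11 := mul_nonneg hc0 b10
      have b12 : (1:ℝ) ≤ ρ⁻¹^(k-a-1) := one_le_pow₀ hR
      have b13 : (1:ℝ) ≤ ρ⁻¹^(b-k-1) := one_le_pow₀ hR
      rw [← Finset.sum_Ico_consecutive _ q1 q2.le, Finset.sum_eq_sum_Ico_succ_bot q2]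
      have b14 : (M+1:ℝ) * D^s ≤ (M+1) * D^s * (ρ⁻¹^(k-a-1) + ρ⁻¹^(b-k-1)) :=
        le_mul_of_one_le_right (by positivity) (by linarith)
      nlinarith
    · push Not at hex
      have b1 := bound T hlt.le le_rfl hex
      have b10 : 0 ≤ pot ρ x a b T - pot ρ x a b t := by
        have : ∀ u, t ≤ u → u ≤ T → pot ρ x a b t ≤ pot ρ x a b u := by
          intro u hu
          induction u, hu using Nat.le_induction with
          | base => intro _; exact le_rfl
          | succ u hu ihu =>
            intro hT
            have := h.pot_mono h0 u a b hab (g u hu (by omega)).1 (g u hu (by omega)).2.1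
            have := ihu (by omega)
            linarith
        linarith [this T hlt.le le_rfl]
      have b11 := mul_nonneg hc0 b10
      have f1 : ρ⁻¹^(k-a-1) ≤ ρ⁻¹^(b-a-1) := pow_le_pow_right₀ hR (by omega)
      have f2 : ρ⁻¹^(b-k-1) ≤ ρ⁻¹^(b-a-1) := pow_le_pow_right₀ hR (by omega)
      have f3 := mul_le_mul_of_nonneg_left (add_le_add f1 f2) (show 0 ≤ K * D^s by positivity)
      nlinarith

noncomputable def KK (s : ℝ) (N : ℕ) : ℕ → ℝ
  | 0 => 0
  | (m+1) => 36 / s * (m+1) * N * (KK s N m + (m+1))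

lemma KK_nonneg {s : ℝ} (hs : 0 < s) (N m : ℕ) : 0 ≤ KK s N m := by
  induction m with
  | zero => simp [KK]
  | succ m ih => simp only [KK]; positivity

lemma half_rpow {s D : ℝ} (hs : 0 < s) (hs1 : s ≤ 1) (hD : 0 ≤ D) : (D/2)^s ≤ D^s * (1 - s/2) := by
  rw [show D/2 = D * (1 + (-1/2)) by ring, Real.mul_rpow hD (by norm_num)]
  refine mul_le_mul_of_nonneg_left ?_ (Real.rpow_nonneg hD _)
  have := rpow_one_add_le_one_add_mul_self (s := (-1/2:ℝ)) (by norm_num) hs.le hs1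
  linarith

theorem main (h : Tw ρ x lo hi cov) (h0 : 0 < ρ) (h1 : ρ ≤ 1/2) {s : ℝ} (hs : 0 < s) (hs1 : s ≤ 1)
    (N M : ℕ) : ∀ a b t T, a < b → b - a ≤ N → Good cov a b t T M →
      ∑ τ ∈ Finset.Ico t T, en x lo cov s a b τ ≤
        KK s N M * ρ⁻¹^(b-a-1) * (x t b - x t (a+1))^s := by
  induction M with
  | zero =>
    intro a b t T hab hN g
    rcases Nat.lt_or_ge t T with hlt | hge
    · have := (g t le_rfl hlt).2.2; omega
    · simp [Finset.Ico_eq_empty_of_le hge, KK]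
  | succ M IH =>
    intro a b t T hab hN g
    obtain ⟨d, hd⟩ : ∃ d, T - t = d := ⟨_, rfl⟩
    induction d using Nat.strong_induction_on generalizing t with
    | _ d ih =>
    have hK := KK_nonneg hs N M
    have hK1 := KK_nonneg hs N (M+1)
    have hR0 : 0 < ρ⁻¹ := by positivity
    have hw0 := h.mono' t (show a + 1 ≤ b by omega)
    rcases Nat.lt_or_ge t T with hlt | hge
    swap
    · rw [Finset.Ico_eq_empty_of_le hge, Finset.sum_empty]
      have : 0 ≤ (x t b - x t (a+1))^s := Real.rpow_nonneg (by linarith) _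
      positivity
    have wle : ∀ t', t ≤ t' → t' ≤ T → x t' b ≤ x t b ∧ x t (a+1) ≤ x t' (a+1) := by
      intro t' p1 p2
      have e1 := h.right_le b t t' (by omega) (fun τ p q => (g τ p (by omega)).2.1)
      have e2 := h.left_le a t t' (by omega) (fun τ p q => (g τ p (by omega)).1)
      exact ⟨e1, e2⟩
    obtain ⟨D, hDdef⟩ : ∃ D, D = x t b - x t (a+1) := ⟨_, rfl⟩
    rw [← hDdef]
    rcases (show 0 ≤ D by linarith).eq_or_lt with hD0 | hD
    · rw [← hD0, Real.zero_rpow hs.ne', mul_zero]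
      apply Finset.sum_nonpos
      intro τ hτ
      simp at hτ
      have := wle τ hτ.1 hτ.2.le
      have := h.en_le hs.le hab (g.sub hτ.1 le_rfl) hτ.2 0 (by linarith)
      rw [Real.zero_rpow hs.ne', mul_zero] at this
      exact this
    have hDs : 0 < D^s := Real.rpow_pos_of_pos hD s
    have win : ∀ t', t ≤ t' → t' ≤ T → (∀ τ, t ≤ τ → τ < t' → D/2 ≤ x τ b - x τ (a+1)) →
        ∑ τ ∈ Finset.Ico t t', en x lo cov s a b τ ≤
          s / 2 * KK s N (M+1) * ρ⁻¹^(b-a-1) * D^s := by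
      intro t' p1 p2 p3
      have hM0 : (0:ℝ) < 4 * (M+1) := by positivity
      have := h.window h0 h1 hs hK a b hab
        (fun a' b' t T q1 q2 q3 q4 => IH a' b' t T q2 (by omega) q4) D
        ((KK s N M+(M+1)) * D^s * ρ⁻¹^(b-a-1) * (4 * (M+1)) / D) hD (by field_simp) t' _ t rfl p1
        (g.sub le_rfl p2) p3 hDdef.ge
      refine this.trans ?_
      have pr := pot_range (x := x) h0 h1 a b t t' hab.le (x t (a+1)) (x t b) hw0
        (by
          intro j hj; simp at hj
          exact ⟨h.mono' t (by omega), h.mono' t (by omega)⟩)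
        (by
          intro j hj; simp at hj
          have := wle t' p1 p2
          exact ⟨this.2.trans (h.mono' t' (by omega)), (h.mono' t' (by omega)).trans this.1⟩)
      rw [← hDdef] at pr
      have hn : (b:ℝ) - a ≤ N := by
        have : b ≤ N + a := by omega
        have : (b:ℝ) ≤ N + a := by exact_mod_cast this
        linarith
      have hN1 : (1:ℝ) ≤ N := by exact_mod_cast (show 1 ≤ N by omega)
      have pr2 : pot ρ x a b t' - pot ρ x a b t ≤ 4 * N * D :=
        pr.trans (mul_le_mul_of_nonneg_right (by linarith) hD.le)
      have e1 := mul_le_mul_of_nonneg_left pr2 (show 0 ≤ (KK s N M+(M+1)) * D^s * ρ⁻¹^(b-a-1) * (4 * (M+1)) / D by positivity)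
      have e2 : (KK s N M+(M+1)) * D^s * ρ⁻¹^(b-a-1) * (4 * (M+1)) / D * (4 * N * D) =
        16 * ((M+1) * N * (KK s N M+(M+1))) * (ρ⁻¹^(b-a-1) * D^s) := by field_simp; ring
      have e3 : s / 2 * KK s N (M+1) * ρ⁻¹^(b-a-1) * D^s =
        18 * ((M+1) * N * (KK s N M+(M+1))) * (ρ⁻¹^(b-a-1) * D^s) := by
        simp only [KK]; field_simp; ring
      have e4 : KK s N M ≤ (M+1) * N * (KK s N M+(M+1)) := by
        have : (1:ℝ) ≤ (M+1) * N := by nlinarith [show (0:ℝ) ≤ M by positivity]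
        have : 0 ≤ (M:ℝ) := by positivity
        nlinarith
      have e5 := mul_le_mul_of_nonneg_right e4 (show 0 ≤ ρ⁻¹^(b-a-1) * D^s by positivity)
      rw [e3]
      rw [e2] at e1
      linarith
    have hRp : 0 < ρ⁻¹^(b-a-1) := by positivity
    by_cases hex : ∃ τ, t ≤ τ ∧ τ < T ∧ x τ b - x τ (a+1) < D/2
    · classical
      obtain ⟨q1, q2, q3⟩ := Nat.find_spec hex
      have q4 : ∀ τ, t ≤ τ → τ < Nat.find hex → D/2 ≤ x τ b - x τ (a+1) := by
        intro τ r1 r2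
        by_contra r3
        exact Nat.find_min hex r2 ⟨r1, by omega, not_le.mp r3⟩
      generalize Nat.find hex = t' at *
      have hne : t ≠ t' := by
        rintro rfl
        linarith
      have b1 := win t' q1 q2.le q4
      have b2 := ih (T - t') (by omega) t' (g.sub q1 le_rfl) rfl
      have hw1 := h.mono' t' (show a + 1 ≤ b by omega)
      have b3 : (x t' b - x t' (a+1))^s ≤ D^s * (1 - s/2) :=
        (Real.rpow_le_rpow (by linarith) q3.le hs.le).trans (half_rpow hs hs1 hD.le)
      have b4 := mul_le_mul_of_nonneg_left b3 (show 0 ≤ KK s N (M+1) * ρ⁻¹^(b-a-1) by positivity)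
      rw [← Finset.sum_Ico_consecutive _ q1 q2.le]
      nlinarith
    · push Not at hex
      refine (win T hlt.le le_rfl hex).trans ?_
      have : 0 ≤ KK s N (M+1) * ρ⁻¹^(b-a-1) * D^s := by positivity
      nlinarith

lemma KK_le {s : ℝ} (hs : 0 < s) (hs1 : s ≤ 1) (N : ℕ) (hN : 1 ≤ N) (m : ℕ) :
    KK s N m ≤ (72 * m * N / s)^m := by
  have hN' : (1:ℝ) ≤ N := by exact_mod_cast hN
  induction m with
  | zero => simp [KK]
  | succ m ih =>
    simp only [KK]
    have hb : ((m:ℝ)+1) ≤ 72 * (m+1) * N / s := by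
      rw [le_div_iff₀ hs]
      have : 0 ≤ (m:ℝ) := by positivity
      nlinarith
    have k1 : KK s N m ≤ (72 * (m+1) * N / s)^m := by
      refine ih.trans (pow_le_pow_left₀ (by positivity) ?_ m)
      gcongr; linarith
    have k2 : (m:ℝ)+1 ≤ (72 * (m+1) * N / s)^m := by
      rcases Nat.eq_zero_or_pos m with rfl | hm
      · simp
      · refine hb.trans (le_self_pow₀ ?_ (by omega))
        refine le_trans ?_ hb
        have : 0 ≤ (m:ℝ) := by positivity
        linarith
    push_cast
    rw [pow_succ]
    generalize (72 * ((m:ℝ)+1) * N / s)^m = Z at *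
    calc 36 / s * (m+1) * N * (KK s N m + (m+1)) ≤ 36 / s * (m+1) * N * (Z + Z) := by gcongr
      _ = _ := by ring

end Tw

namespace Srt

noncomputable def srt {n : ℕ} (X : Fin n → ℝ) (j : ℕ) : ℝ :=
  if h : 1 ≤ j ∧ j ≤ n then X (Tuple.sort X ⟨j-1, by omega⟩) else if j = 0 then -1 else 2

def covd {n : ℕ} (E : Fin n → Fin n → Prop) (X : Fin n → ℝ) (j : ℕ) : Prop :=
  ∃ a b, E a b ∧ X a ≤ srt X j ∧ srt X (j+1) ≤ X b

open Classical in
noncomputable def loF {n : ℕ} (E : Fin n → Fin n → Prop) (X : Fin n → ℝ) : ℕ → ℝ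
  | 0 => srt X 0
  | (j+1) => if covd E X j then loF E X j else srt X (j+1)

noncomputable def hiF {n : ℕ} (E : Fin n → Fin n → Prop) (X : Fin n → ℝ) (j : ℕ) : ℝ :=
  srt X (sInf {k | j ≤ k ∧ ¬ covd E X k})

variable {n : ℕ} {X : Fin n → ℝ} {E : Fin n → Fin n → Prop}

lemma srt_zero : srt X 0 = -1 := by simp [srt]
lemma srt_big {j : ℕ} (h : n < j) : srt X j = 2 := by
  unfold srt
  rw [dif_neg (by omega), if_neg (by omega)]

lemma srt_idx (r : Fin n) : srt X (r.1+1) = X (Tuple.sort X r) := by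
  unfold srt
  rw [dif_pos ⟨by omega, by omega⟩]
  rfl

lemma srt_ex {j : ℕ} (h1 : 1 ≤ j) (h2 : j ≤ n) : ∃ r : Fin n, r.1 + 1 = j :=
  ⟨⟨j-1, by omega⟩, by simp; omega⟩

lemma srt_mono (hX : ∀ i, X i ∈ Set.Icc (0:ℝ) 1) : Monotone (srt X) := by
  apply monotone_nat_of_le_succ
  intro j
  rcases Nat.eq_zero_or_pos j with rfl | hj
  · rw [srt_zero]
    rcases Nat.lt_or_ge n 1 with hn | hn
    · rw [srt_big (by omega)]; norm_num
    · obtain ⟨r, hr⟩ := srt_ex (n := n) le_rfl hn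
      rw [show 0 + 1 = r.1 + 1 by omega, srt_idx]
      linarith [(hX (Tuple.sort X r)).1]
  · rcases Nat.lt_or_ge n (j+1) with hn | hn
    · rw [srt_big hn]
      rcases Nat.lt_or_ge n j with hn' | hn'
      · rw [srt_big hn']
      · obtain ⟨r, hr⟩ := srt_ex hj hn'
        rw [← hr, srt_idx]
        linarith [(hX (Tuple.sort X r)).2]
    · obtain ⟨r, hr⟩ := srt_ex hj (show j ≤ n by omega)
      obtain ⟨r', hr'⟩ := srt_ex (show 1 ≤ j+1 by omega) hn
      rw [← hr', ← hr, srt_idx, srt_idx]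
      exact Tuple.monotone_sort X (show r ≤ r' by rw [Fin.le_def]; omega)

lemma exists_idx (i : Fin n) : ∃ j, 1 ≤ j ∧ j ≤ n ∧ srt X j = X i := by
  refine ⟨((Tuple.sort X).symm i).1 + 1, by omega, by omega, ?_⟩
  rw [srt_idx]; simp

lemma exists_ag {j : ℕ} (h1 : 1 ≤ j) (h2 : j ≤ n) : ∃ i, X i = srt X j := by
  obtain ⟨r, rfl⟩ := srt_ex h1 h2
  exact ⟨_, (srt_idx r).symm⟩

lemma dichot (hX : ∀ i, X i ∈ Set.Icc (0:ℝ) 1) (i : Fin n) (j : ℕ) : X i ≤ srt X j ∨ srt X (j+1) ≤ X i := by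
  obtain ⟨r, h1, h2, h3⟩ := exists_idx (X := X) i
  rw [← h3]
  rcases Nat.lt_or_ge j r with h | h
  · right; exact srt_mono hX (by omega)
  · left; exact srt_mono hX h

lemma srt_ge (hX : ∀ i, X i ∈ Set.Icc (0:ℝ) 1) (A : Finset (Fin n)) (θ : ℝ) {j : ℕ} (h1 : 1 ≤ j) (h2 : j ≤ n)
    (hc : n + 1 ≤ A.card + j) (hA : ∀ i ∈ A, θ ≤ X i) : θ ≤ srt X j := by
  classical
  let B : Finset (Fin n) := ((Finset.univ.filter (fun r : Fin n => r.1 < j))).map (Tuple.sort X).toEmbedding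
  have hB : B.card = j := by
    rw [Finset.card_map, Fin.card_filter_val_lt]; omega
  have : ¬ Disjoint A B := by
    intro hd
    have := Finset.card_union_of_disjoint hd
    have h3 := Finset.card_le_univ (A ∪ B)
    rw [Fintype.card_fin] at h3
    omega
  rw [Finset.not_disjoint_iff] at this
  obtain ⟨i, hi1, hi2⟩ := this
  simp only [B, Finset.mem_map, Finset.mem_filter, Finset.mem_univ, true_and] at hi2
  obtain ⟨r, hr, rfl⟩ := hi2
  refine (hA _ hi1).trans ?_
  simp only [Equiv.coe_toEmbedding]
  rw [← srt_idx (X := X)]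
  exact srt_mono hX (by omega)

lemma srt_le (hX : ∀ i, X i ∈ Set.Icc (0:ℝ) 1) (A : Finset (Fin n)) (θ : ℝ) {j : ℕ} (h1 : 1 ≤ j) (h2 : j ≤ n)
    (hc : j ≤ A.card) (hA : ∀ i ∈ A, X i ≤ θ) : srt X j ≤ θ := by
  classical
  let B : Finset (Fin n) := ((Finset.univ.filter (fun r : Fin n => j ≤ r.1 + 1))).map (Tuple.sort X).toEmbedding
  have hB : n + 1 ≤ B.card + j := by
    rw [Finset.card_map]
    have e := Finset.card_filter_add_card_filter_not (s := (Finset.univ : Finset (Fin n))) (fun r : Fin n => j ≤ r.1 + 1)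
    have e2 : (Finset.univ.filter (fun r : Fin n => ¬ j ≤ r.1 + 1)) = Finset.univ.filter (fun r : Fin n => r.1 < j - 1) := by
      ext r; simp; omega
    rw [e2, Fin.card_filter_val_lt, Finset.card_univ, Fintype.card_fin] at e
    omega
  have : ¬ Disjoint A B := by
    intro hd
    have := Finset.card_union_of_disjoint hd
    have h3 := Finset.card_le_univ (A ∪ B)
    rw [Fintype.card_fin] at h3
    omega
  rw [Finset.not_disjoint_iff] at this
  obtain ⟨i, hi1, hi2⟩ := this
  simp only [B, Finset.mem_map, Finset.mem_filter, Finset.mem_univ, true_and] at hi2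
  obtain ⟨r, hr, rfl⟩ := hi2
  refine le_trans ?_ (hA _ hi1)
  simp only [Equiv.coe_toEmbedding]
  rw [← srt_idx (X := X)]
  exact srt_mono hX (by omega)

/-- number of agents at or above the `j`-th position -/
lemma card_ge (hX : ∀ i, X i ∈ Set.Icc (0:ℝ) 1) {j : ℕ} (h1 : 1 ≤ j) (A : Finset (Fin n))
    (hA : ∀ r : Fin n, j ≤ r.1 + 1 → Tuple.sort X r ∈ A) : n + 1 ≤ A.card + j := by
  classical
  let B : Finset (Fin n) := ((Finset.univ.filter (fun r : Fin n => j ≤ r.1 + 1))).map (Tuple.sort X).toEmbedding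
  have hB : n + 1 ≤ B.card + j := by
    rw [Finset.card_map]
    have e := Finset.card_filter_add_card_filter_not (s := (Finset.univ : Finset (Fin n))) (fun r : Fin n => j ≤ r.1 + 1)
    have e2 : (Finset.univ.filter (fun r : Fin n => ¬ j ≤ r.1 + 1)) = Finset.univ.filter (fun r : Fin n => r.1 < j - 1) := by
      ext r; simp; omega
    rw [e2, Fin.card_filter_val_lt, Finset.card_univ, Fintype.card_fin] at e
    omega
  have : B ⊆ A := by
    intro i hi
    simp only [B, Finset.mem_map, Finset.mem_filter, Finset.mem_univ, true_and] at hi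
    obtain ⟨r, hr, rfl⟩ := hi
    exact hA r hr
  have := Finset.card_le_card this
  omega

lemma card_le (hX : ∀ i, X i ∈ Set.Icc (0:ℝ) 1) {j : ℕ} (h1 : j ≤ n) (A : Finset (Fin n))
    (hA : ∀ r : Fin n, r.1 < j → Tuple.sort X r ∈ A) : j ≤ A.card := by
  classical
  let B : Finset (Fin n) := ((Finset.univ.filter (fun r : Fin n => r.1 < j))).map (Tuple.sort X).toEmbedding
  have hB : B.card = j := by
    rw [Finset.card_map, Fin.card_filter_val_lt]; omega
  have : B ⊆ A := by
    intro i hi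
    simp only [B, Finset.mem_map, Finset.mem_filter, Finset.mem_univ, true_and] at hi
    obtain ⟨r, hr, rfl⟩ := hi
    exact hA r hr
  have := Finset.card_le_card this
  omega

lemma cov_range (hX : ∀ i, X i ∈ Set.Icc (0:ℝ) 1) {j : ℕ} (h : covd E X j) : 1 ≤ j ∧ j + 1 ≤ n := by
  obtain ⟨a, b, _, h1, h2⟩ := h
  constructor
  · by_contra hj
    have : j = 0 := by omega
    subst this
    rw [srt_zero] at h1
    linarith [(hX a).1]
  · by_contra hj
    rw [srt_big (by omega)] at h2
    linarith [(hX b).2]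

lemma unc_n (hX : ∀ i, X i ∈ Set.Icc (0:ℝ) 1) : ¬ covd E X n := fun h => by
  have := (cov_range hX h).2; omega

lemma unc_0 (hX : ∀ i, X i ∈ Set.Icc (0:ℝ) 1) : ¬ covd E X 0 := fun h => by
  have := (cov_range hX h).1; omega

lemma unc_lt (hX : ∀ i, X i ∈ Set.Icc (0:ℝ) 1) (hr : ∀ i, E i i) {j : ℕ} (hj : j ≤ n)
    (h : ¬ covd E X j) : srt X j < srt X (j+1) := by
  rcases Nat.eq_zero_or_pos j with rfl | hj0
  · rw [srt_zero]
    rcases Nat.eq_zero_or_pos n with h0 | h0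
    · rw [srt_big (by omega)]; norm_num
    · obtain ⟨i, hi⟩ := exists_ag (X := X) (le_refl 1) h0
      rw [zero_add, ← hi]; linarith [(hX i).1]
  · obtain ⟨i, hi⟩ := exists_ag (X := X) hj0 hj
    by_contra hlt
    exact h ⟨i, i, hr i, hi.le, by linarith⟩

lemma lo_le (hX : ∀ i, X i ∈ Set.Icc (0:ℝ) 1) (j : ℕ) : loF E X j ≤ srt X j := by
  induction j with
  | zero => exact le_rfl
  | succ j ih =>
    simp only [loF]
    split_ifs
    · exact ih.trans (srt_mono hX (by omega))
    · exact le_rfl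

lemma hi_spec (hX : ∀ i, X i ∈ Set.Icc (0:ℝ) 1) (j : ℕ) :
    j ≤ sInf {k | j ≤ k ∧ ¬ covd E X k} ∧ ¬ covd E X (sInf {k | j ≤ k ∧ ¬ covd E X k}) := by
  have : (sInf {k | j ≤ k ∧ ¬ covd E X k}) ∈ {k | j ≤ k ∧ ¬ covd E X k} := by
    apply Nat.sInf_mem
    refine ⟨n + j, by omega, fun h => ?_⟩
    have := (cov_range hX h).2; omega
  exact this

lemma edge_lo (hX : ∀ i, X i ∈ Set.Icc (0:ℝ) 1) (hs : ∀ i j, E i j → E j i) (j : ℕ) :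
    ∀ k l, E k l → loF E X j ≤ X k → loF E X j ≤ X l := by
  induction j with
  | zero => intro k l _ _; simp only [loF, srt_zero]; linarith [(hX l).1]
  | succ j ih =>
    simp only [loF]
    split_ifs with hc
    · exact ih
    · intro k l hkl hk
      rcases dichot hX l j with h | h
      · exact absurd ⟨l, k, hs _ _ hkl, h, hk⟩ hc
      · exact h

lemma edge_hi (hX : ∀ i, X i ∈ Set.Icc (0:ℝ) 1) (j : ℕ) :
    ∀ k l, E k l → X k ≤ hiF E X j → X l ≤ hiF E X j := by
  intro k l hkl hk
  have := (hi_spec (E := E) hX j).2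
  rcases dichot hX l (sInf {k | j ≤ k ∧ ¬ covd E X k}) with h | h
  · exact h
  · exact absurd ⟨k, l, hkl, hk, h⟩ this

lemma avg_ge (p : Fin n → ℝ) (hp : ∀ l, 0 ≤ p l) (hsum : ∑ l, p l = 1) {ρ lam mu : ℝ} (b : Fin n)
    (hl : ∀ l, p l ≠ 0 → lam ≤ X l) (hb : ρ ≤ p b) (hρ : 0 ≤ ρ) (hm : mu ≤ X b) (hlm : lam ≤ mu) :
    (1-ρ) * lam + ρ * mu ≤ ∑ l, p l * X l := by
  have e : ∑ l, p l * X l = lam + ∑ l, p l * (X l - lam) := by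
    simp only [mul_sub, Finset.sum_sub_distrib, ← Finset.sum_mul, hsum]; ring
  have : p b * (X b - lam) ≤ ∑ l, p l * (X l - lam) := by
    refine Finset.single_le_sum (f := fun l => p l * (X l - lam)) ?_ (Finset.mem_univ b)
    intro l _
    by_cases h : p l = 0
    · simp [h]
    · exact mul_nonneg (hp l) (by linarith [hl l h])
  have h2 : ρ * (mu - lam) ≤ p b * (X b - lam) := mul_le_mul hb (by linarith) (by linarith) (hp b)
  rw [e]; linarith

lemma avg_le (p : Fin n → ℝ) (hp : ∀ l, 0 ≤ p l) (hsum : ∑ l, p l = 1) {ρ lam mu : ℝ} (b : Fin n)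
    (hl : ∀ l, p l ≠ 0 → X l ≤ lam) (hb : ρ ≤ p b) (hρ : 0 ≤ ρ) (hm : X b ≤ mu) (hlm : mu ≤ lam) :
    ∑ l, p l * X l ≤ (1-ρ) * lam + ρ * mu := by
  have := avg_ge (X := fun i => - X i) p hp hsum (ρ := ρ) (lam := -lam) (mu := -mu) b
    (fun l h => by linarith [hl l h]) hb hρ (by linarith) (by linarith)
  simp only [mul_neg, Finset.sum_neg_distrib] at this
  linarith

lemma uses (Y : Fin n → ℝ) (P : Matrix (Fin n) (Fin n) ℝ) {ρ : ℝ} (h0 : 0 < ρ)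
    (hX : ∀ i, X i ∈ Set.Icc (0:ℝ) 1) (hY : ∀ i, Y i ∈ Set.Icc (0:ℝ) 1)
    (hp : ∀ i l, 0 ≤ P i l) (hsum : ∀ i, ∑ l, P i l = 1) (hd : ∀ i, 0 < P i i)
    (hs : ∀ i j, P i j = 0 ↔ P j i = 0) (hth : ∀ i j, P i j ≠ 0 → ρ ≤ P i j)
    (hup : Y = P.mulVec X) (j : ℕ) :
    (loF (fun a b => P a b ≠ 0) X j ≤ srt Y j ∧ srt Y j ≤ hiF (fun a b => P a b ≠ 0) X j) ∧
    (covd (fun a b => P a b ≠ 0) X j →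
      (1-ρ) * loF (fun a b => P a b ≠ 0) X j + ρ * srt X (j+1) ≤ srt Y j ∧
      srt Y (j+1) ≤ (1-ρ) * hiF (fun a b => P a b ≠ 0) X (j+1) + ρ * srt X j) := by
  classical
  set E : Fin n → Fin n → Prop := fun a b => P a b ≠ 0 with hE
  have hsE : ∀ i j, E i j → E j i := fun i j h h' => h ((hs j i).1 h')
  have hY' : ∀ i, Y i = ∑ l, P i l * X l := fun i => by rw [hup]; rfl
  have hlo := lo_le (E := E) hX
  have hhi : ∀ j, srt X j ≤ hiF E X j := fun j => srt_mono hX (hi_spec hX j).1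
  refine ⟨⟨?_, ?_⟩, ?_⟩
  · rcases Nat.eq_zero_or_pos j with rfl | hj
    · simp [loF, srt_zero]
    rcases Nat.lt_or_ge n j with hn | hn
    · rw [srt_big (X := Y) hn, ← srt_big (X := X) hn]; exact hlo j
    refine srt_ge hY (Finset.univ.filter (fun i => srt X j ≤ X i)) _ hj hn
      (card_ge hX hj _ (fun r hr => ?_)) ?_
    · simp; rw [← srt_idx (X := X)]; exact srt_mono hX hr
    · intro i hi
      simp at hi
      have hi' : loF E X j ≤ X i := (hlo j).trans hi
      rw [hY']
      have := avg_ge (X := X) (P i) (hp i) (hsum i) (ρ := ρ) (lam := loF E X j) (mu := loF E X j) i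
        (fun l h => edge_lo hX hsE j i l h hi') (hth i i (hd i).ne') h0.le hi' le_rfl
      linarith
  · rcases Nat.eq_zero_or_pos j with rfl | hj
    · have := hhi 0
      rw [srt_zero] at this ⊢; exact this
    rcases Nat.lt_or_ge n j with hn | hn
    · rw [srt_big (X := Y) hn, ← srt_big (X := X) hn]; exact hhi j
    refine srt_le hY (Finset.univ.filter (fun i => X i ≤ srt X j)) _ hj hn
      (card_le hX hn _ (fun r hr => ?_)) ?_
    · simp; rw [← srt_idx (X := X)]; exact srt_mono hX hr
    · intro i hi
      simp at hi
      have hi' : X i ≤ hiF E X j := hi.trans (hhi j)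
      rw [hY']
      have := avg_le (X := X) (P i) (hp i) (hsum i) (ρ := ρ) (lam := hiF E X j) (mu := hiF E X j) i
        (fun l h => edge_hi hX j i l h hi') (hth i i (hd i).ne') h0.le hi' le_rfl
      linarith
  · intro hc
    obtain ⟨hj1, hj2⟩ := cov_range hX hc
    obtain ⟨a, b, hab, ha, hb⟩ := hc
    have hrefl : ∀ i, E i i := fun i => (hd i).ne'
    have hm := srt_mono hX (show j ≤ j+1 by omega)
    constructor
    · refine srt_ge hY (Finset.univ.filter (fun i => ∃ b, E i b ∧ srt X (j+1) ≤ X b)) _ hj1 (by omega) ?_ ?_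
      · have haA : a ∈ Finset.univ.filter (fun i => ∃ b, E i b ∧ srt X (j+1) ≤ X b) := by
          simp; exact ⟨b, hab, hb⟩
        by_cases hlt : X a < srt X (j+1)
        · have := card_ge hX (show 1 ≤ j+1 by omega)
            ((Finset.univ.filter (fun i => ∃ b, E i b ∧ srt X (j+1) ≤ X b)).erase a) (fun r hr => by
              have hge : srt X (j+1) ≤ X (Tuple.sort X r) := by
                rw [← srt_idx (X := X)]; exact srt_mono hX hr
              simp
              refine ⟨fun h => ?_, _, hrefl _, hge⟩
              rw [h] at hge; linarith)
          rw [Finset.card_erase_of_mem haA] at this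
          have := Finset.card_pos.2 ⟨a, haA⟩
          omega
        · refine card_ge hX hj1 _ (fun r hr => ?_)
          simp
          refine ⟨_, hrefl _, ?_⟩
          rw [← srt_idx (X := X)]
          have := srt_mono hX hr
          linarith
      · intro i hi
        simp at hi
        obtain ⟨b', hb1, hb2⟩ := hi
        have q1 : loF E X j ≤ X b' := by linarith [hlo j]
        have q2 := edge_lo hX hsE j b' i (hsE _ _ hb1) q1
        rw [hY']
        exact avg_ge (X := X) (P i) (hp i) (hsum i) b'
          (fun l h => edge_lo hX hsE j i l h q2) (hth i b' hb1) h0.le hb2 (by linarith [hlo j])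
    · refine srt_le hY (Finset.univ.filter (fun i => ∃ b, E i b ∧ X b ≤ srt X j)) _ (by omega) hj2 ?_ ?_
      · have haA : b ∈ Finset.univ.filter (fun i => ∃ b, E i b ∧ X b ≤ srt X j) := by
          simp; exact ⟨a, hsE _ _ hab, ha⟩
        by_cases hlt : srt X j < X b
        · have := card_le hX (show j ≤ n by omega)
            ((Finset.univ.filter (fun i => ∃ b, E i b ∧ X b ≤ srt X j)).erase b) (fun r hr => by
              have hge : X (Tuple.sort X r) ≤ srt X j := by
                rw [← srt_idx (X := X)]; exact srt_mono hX hr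
              simp
              refine ⟨fun h => ?_, _, hrefl _, hge⟩
              rw [h] at hge; linarith)
          rw [Finset.card_erase_of_mem haA] at this
          have := Finset.card_pos.2 ⟨b, haA⟩
          omega
        · refine card_le hX hj2 _ (fun r hr => ?_)
          simp
          refine ⟨_, hrefl _, ?_⟩
          rw [← srt_idx (X := X)]
          have := srt_mono hX (show r.1 + 1 ≤ j + 1 by omega)
          linarith
      · intro i hi
        simp at hi
        obtain ⟨b', hb1, hb2⟩ := hi
        have q0 := hhi (j+1)
        have q1 : X b' ≤ hiF E X (j+1) := by linarith
        have q2 := edge_hi hX (j+1) b' i (hsE _ _ hb1) q1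
        rw [hY']
        exact avg_le (X := X) (P i) (hp i) (hsum i) b'
          (fun l h => edge_hi hX (j+1) i l h q2) (hth i b' hb1) h0.le hb2 (by linarith)

lemma hi_cov {j : ℕ} (hc : covd E X j) : hiF E X j = hiF E X (j+1) := by
  unfold hiF
  congr 2
  ext k
  simp only [Set.mem_ofPred_eq]
  constructor
  · rintro ⟨h1, h2⟩
    refine ⟨?_, h2⟩
    rcases h1.eq_or_lt with rfl | h
    · exact absurd hc h2
    · exact h
  · rintro ⟨h1, h2⟩
    exact ⟨by omega, h2⟩

lemma hi_unc (hX : ∀ i, X i ∈ Set.Icc (0:ℝ) 1) {j : ℕ} (hc : ¬ covd E X j) : hiF E X j = srt X j := by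
  unfold hiF
  congr 1
  apply le_antisymm
  · exact Nat.sInf_le ⟨le_rfl, hc⟩
  · exact (hi_spec hX j).1

lemma card_unc (hX : ∀ i, X i ∈ Set.Icc (0:ℝ) 1) (hr : ∀ i, E i i) (hn : 1 ≤ n) {m : ℕ}
    (c : Fin n → Fin m) (hc : ∀ i j, c i = c j → Relation.ReflTransGen E i j)
    (A : Finset ℕ) (hA : ∀ j ∈ A, (0 < j ∧ j < n) ∧ ¬ covd E X j) : A.card + 1 ≤ m := by
  classical
  have hnA : n ∉ A := fun h => by have := (hA n h).1.2; omega
  rw [← Finset.card_insert_of_notMem hnA]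
  have hA' : ∀ j ∈ insert n A, (1 ≤ j ∧ j ≤ n) ∧ ¬ covd E X j := by
    intro j hj
    rcases Finset.mem_insert.1 hj with rfl | h
    · exact ⟨⟨hn, le_rfl⟩, unc_n hX⟩
    · have := hA j h; exact ⟨⟨by omega, by omega⟩, this.2⟩
  have hag : ∀ j, ∃ i : Fin n, (1 ≤ j ∧ j ≤ n) → X i = srt X j := by
    intro j
    by_cases h : 1 ≤ j ∧ j ≤ n
    · obtain ⟨i, hi⟩ := exists_ag (X := X) h.1 h.2
      exact ⟨i, fun _ => hi⟩
    · exact ⟨⟨0, by omega⟩, fun h' => absurd h' h⟩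
  choose ag hag using hag
  have key : ∀ j ∈ insert n A, ∀ k ∈ insert n A, j < k → c (ag j) ≠ c (ag k) := by
    intro j hj k hk hjk he
    obtain ⟨hj1, hj2⟩ := hA' j hj
    obtain ⟨hk1, hk2⟩ := hA' k hk
    have path := hc _ _ he
    have : X (ag k) ≤ srt X j := by
      generalize ag k = w at path
      induction path with
      | refl => exact (hag j hj1).le
      | @tail u v _ hbc ih =>
        rcases dichot hX v j with h | h
        · exact h
        · exact absurd ⟨u, v, hbc, ih, h⟩ hj2
    rw [hag k hk1] at this
    have h1 := unc_lt hX hr hj1.2 hj2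
    have h2 := srt_mono hX (show j + 1 ≤ k by omega)
    linarith
  have := Finset.card_le_card_of_injOn (s := insert n A) (t := (Finset.univ : Finset (Fin m)))
    (fun j => c (ag j)) (fun _ _ => Finset.mem_coe.2 (Finset.mem_univ _)) (by
      intro j hj k hk he
      rcases lt_trichotomy j k with h | h | h
      · exact absurd he (key j hj k hk h)
      · exact h
      · exact absurd he.symm (key k hk j hj h))
  simpa using this

def EU (E : Fin n → Fin n → Prop) (X : Fin n → ℝ) : Set ℝ :=
  ⋃ (i : Fin n) (j : Fin n) (_ : E i j), Set.uIcc (X i) (X j)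

lemma mem_EU {z : ℝ} (hs : ∀ i j, E i j → E j i) : z ∈ EU E X ↔ ∃ i j, E i j ∧ X i ≤ z ∧ z ≤ X j := by
  simp only [EU, Set.mem_iUnion, Set.mem_uIcc, exists_prop]
  constructor
  · rintro ⟨i, j, h, h1 | h1⟩
    · exact ⟨i, j, h, h1⟩
    · exact ⟨j, i, hs _ _ h, h1⟩
  · rintro ⟨i, j, h, h1⟩
    exact ⟨i, j, h, Or.inl h1⟩

lemma gap_empty (hX : ∀ i, X i ∈ Set.Icc (0:ℝ) 1) (hs : ∀ i j, E i j → E j i) {j : ℕ}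
    (hc : ¬ covd E X j) {z : ℝ} (hz : z ∈ EU E X) : z ≤ srt X j ∨ srt X (j+1) ≤ z := by
  obtain ⟨a, b, hab, h1, h2⟩ := (mem_EU hs).1 hz
  rcases dichot hX a j with h | h
  · rcases dichot hX b j with h' | h'
    · left; linarith
    · exact absurd ⟨a, b, hab, h, h'⟩ hc
  · right; linarith

lemma conn_up (hX : ∀ i, X i ∈ Set.Icc (0:ℝ) 1) (hs : ∀ i j, E i j → E j i) (hr : ∀ i, E i i) {j : ℕ}
    (hj : j ≤ n) (hc : ¬ covd E X j) {C : Set ℝ} (hC : IsPreconnected C) (hCU : C ⊆ EU E X)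
    {p z : ℝ} (hp : p ∈ C) (hz : z ∈ C) (hpj : p ≤ srt X j) : z ≤ srt X j := by
  rcases gap_empty hX hs hc (hCU hz) with h | h
  · exact h
  · exfalso
    have hlt := unc_lt hX hr hj hc
    have : (srt X j + srt X (j+1))/2 ∈ C := hC.Icc_subset hp hz ⟨by linarith, by linarith⟩
    rcases gap_empty hX hs hc (hCU this) with h | h <;> linarith

lemma conn_lo (hX : ∀ i, X i ∈ Set.Icc (0:ℝ) 1) (hs : ∀ i j, E i j → E j i) (hr : ∀ i, E i i) {j : ℕ}
    (hj : j ≤ n) {C : Set ℝ} (hC : IsPreconnected C) (hCU : C ⊆ EU E X)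
    {p z : ℝ} (hp : p ∈ C) (hz : z ∈ C) (hpj : loF E X j ≤ p) : loF E X j ≤ z := by
  induction j with
  | zero =>
    obtain ⟨a, b, hab, h1, h2⟩ := (mem_EU hs).1 (hCU hz)
    simp only [loF, srt_zero]; linarith [(hX a).1]
  | succ j ih =>
    simp only [loF] at hpj ⊢
    split_ifs at hpj ⊢ with hc
    · exact ih (by omega) hpj
    · by_contra hlt
      push Not at hlt
      have h1 : z ≤ srt X j := by
        rcases gap_empty hX hs hc (hCU hz) with h | h
        · exact h
        · linarith
      have := conn_up hX hs hr (by omega) hc hC hCU hz hp h1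
      have := unc_lt hX hr (by omega) hc
      linarith

lemma comp_eq (hX : ∀ i, X i ∈ Set.Icc (0:ℝ) 1) (hs : ∀ i j, E i j → E j i)
    {p : ℝ} (hp : p ∈ EU E X) : ∃ j, 1 ≤ j ∧ j ≤ n ∧ ¬ covd E X j ∧
      connectedComponentIn (EU E X) p = connectedComponentIn (EU E X) (srt X j) := by
  classical
  have hex : ∃ j, 1 ≤ j ∧ j ≤ n ∧ ¬ covd E X j ∧ p ≤ srt X j := by
    obtain ⟨a, b, hab, h1, h2⟩ := (mem_EU hs).1 hp
    obtain ⟨r, hr1, hr2, hr3⟩ := exists_idx (X := X) b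
    exact ⟨n, by omega, le_rfl, unc_n hX, h2.trans (hr3 ▸ srt_mono hX hr2)⟩
  obtain ⟨h1, h2, h3, h4⟩ := Nat.find_spec hex
  have hmin : ∀ i, i < Nat.find hex → 1 ≤ i → ¬ covd E X i → srt X i < p := by
    intro i hi hi1 hi2
    by_contra hcon
    exact Nat.find_min hex hi ⟨hi1, by omega, hi2, not_lt.1 hcon⟩
  generalize Nat.find hex = j at *
  refine ⟨j, h1, h2, h3, ?_⟩
  have sub : Set.Icc p (srt X j) ⊆ EU E X := by
    rintro z ⟨hz1, hz2⟩
    -- smallest index k with z ≤ srt k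
    have hex2 : ∃ k, z ≤ srt X k := ⟨j, hz2⟩
    have f1 := Nat.find_spec hex2
    have f2 : ∀ i, i < Nat.find hex2 → srt X i < z := fun i hi => not_le.1 (Nat.find_min hex2 hi)
    have f3 : Nat.find hex2 ≤ j := Nat.find_min' hex2 hz2
    generalize Nat.find hex2 = k at *
    obtain ⟨a, b, hab, hp1, hp2⟩ := (mem_EU hs).1 hp
    have hk : k ≠ 0 := by
      rintro rfl
      rw [srt_zero] at f1
      linarith [(hX a).1]
    obtain ⟨i, rfl⟩ : ∃ i, k = i + 1 := ⟨k-1, by omega⟩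
    have hiz := f2 i (by omega)
    by_cases hc : covd E X i
    · obtain ⟨u, v, huv, hu, hv⟩ := hc
      exact (mem_EU hs).2 ⟨u, v, huv, by linarith, by linarith⟩
    · rcases gap_empty hX hs hc hp with h | h
      · rcases Nat.eq_zero_or_pos i with rfl | hi
        · rw [srt_zero] at h; linarith [(hX a).1]
        · linarith [hmin i (by omega) hi hc]
      · have : z = p := by linarith
        rw [this]; exact hp
  apply connectedComponentIn_eq
  exact (isPreconnected_Icc.subset_connectedComponentIn (Set.left_mem_Icc.2 h4) sub) (Set.right_mem_Icc.2 h4)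

open Classical in
lemma energy_le (hX : ∀ i, X i ∈ Set.Icc (0:ℝ) 1) (hs : ∀ i j, E i j → E j i) (hr : ∀ i, E i i)
    {s : ℝ} (hs0 : 0 < s) : stepEnergy s (EU E X) ≤
      ENNReal.ofReal (∑ j ∈ Finset.Ioc 0 n with ¬ covd E X j, (srt X j - loF E X j)^s) := by
  set A := Finset.filter (fun j => ¬ covd E X j) (Finset.Ioc 0 n) with hA
  have hsub : blockSet (EU E X) ⊆ ((A.image (fun j => connectedComponentIn (EU E X) (srt X j)) : Finset (Set ℝ)) : Set (Set ℝ)) := by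
    rintro C ⟨p, hp, rfl⟩
    obtain ⟨j, h1, h2, h3, h4⟩ := comp_eq hX hs hp
    rw [Finset.coe_image]
    exact ⟨j, by simp [hA]; exact ⟨⟨by omega, h2⟩, h3⟩, h4.symm⟩
  have hdiam : ∀ j ∈ A, Metric.diam (connectedComponentIn (EU E X) (srt X j)) ≤ srt X j - loF E X j := by
    intro j hj
    simp [hA] at hj
    have hlo := lo_le (E := E) hX j
    by_cases hm : srt X j ∈ EU E X
    · have hme := mem_connectedComponentIn hm
      have : connectedComponentIn (EU E X) (srt X j) ⊆ Set.Icc (loF E X j) (srt X j) := by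
        intro z hz
        exact ⟨conn_lo hX hs hr hj.1.2 isPreconnected_connectedComponentIn
            (connectedComponentIn_subset _ _) hme hz hlo,
          conn_up hX hs hr hj.1.2 hj.2 isPreconnected_connectedComponentIn
            (connectedComponentIn_subset _ _) hme hz le_rfl⟩
      refine (Metric.diam_mono this (Metric.isBounded_Icc _ _)).trans ?_
      rw [Real.diam_Icc hlo]
    · rw [connectedComponentIn_eq_empty hm, Metric.diam_empty]; linarith
  unfold stepEnergy
  calc ∑' C : blockSet (EU E X), ENNReal.ofReal (Metric.diam (C : Set ℝ) ^ s)
      ≤ ∑' C : ((A.image (fun j => connectedComponentIn (EU E X) (srt X j)) : Finset (Set ℝ)) : Set (Set ℝ)),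
          ENNReal.ofReal (Metric.diam (C : Set ℝ) ^ s) :=
        ENNReal.tsum_mono_subtype (fun C : Set ℝ => ENNReal.ofReal (Metric.diam C ^ s)) hsub
    _ = ∑ C ∈ A.image (fun j => connectedComponentIn (EU E X) (srt X j)), ENNReal.ofReal (Metric.diam C ^ s) :=
        Finset.tsum_subtype' _ (fun C : Set ℝ => ENNReal.ofReal (Metric.diam C ^ s))
    _ ≤ ∑ j ∈ A, ENNReal.ofReal (Metric.diam (connectedComponentIn (EU E X) (srt X j)) ^ s) :=
        Finset.sum_image_le_of_nonneg (fun _ _ => zero_le)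
    _ ≤ ∑ j ∈ A, ENNReal.ofReal ((srt X j - loF E X j)^s) := by
        refine Finset.sum_le_sum fun j hj => ENNReal.ofReal_le_ofReal ?_
        exact Real.rpow_le_rpow Metric.diam_nonneg (hdiam j hj) hs0.le
    _ = _ := by
        rw [ENNReal.ofReal_sum_of_nonneg]
        intro j _
        exact Real.rpow_nonneg (by linarith [lo_le (E := E) hX j]) _

end Srt

theorem maxSEnergy_le :
    ∃ a : ℝ, 0 < a ∧
      ∀ (n m : ℕ) (ρ s : ℝ), 2 ≤ n → 0 < ρ → ρ ≤ 1 / 2 → 0 < s → s ≤ 1 →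
        1 ≤ m → m ≤ n - 1 →
        ∀ S : AvgSystem n ρ, (∀ i, S.x 0 i ∈ Set.Icc (0 : ℝ) 1) →
          S.componentsLE m →
          S.energy s ≤ ENNReal.ofReal ((a * m * n / s) ^ m * (1 / ρ) ^ (n - 1)) := by
  refine ⟨72, by norm_num, ?_⟩
  intro n m ρ s hn h0 h1 hs hs1 hm hmn S hx0 hcomp
  classical
  have hX : ∀ t i, S.x t i ∈ Set.Icc (0:ℝ) 1 := by
    intro t
    induction t with
    | zero => exact hx0
    | succ t ih =>
      intro i
      have e : S.x (t+1) i = ∑ l, S.P t i l * S.x t l := by rw [S.update]; rfl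
      rw [e]
      constructor
      · exact Finset.sum_nonneg fun l _ => mul_nonneg (S.nonneg t i l) (ih l).1
      · calc ∑ l, S.P t i l * S.x t l ≤ ∑ l, S.P t i l :=
              Finset.sum_le_sum fun l _ => mul_le_of_le_one_right (S.nonneg t i l) (ih l).2
          _ = 1 := S.rowSum t i
  have hU := fun t => Srt.uses (S.x (t+1)) (S.P t) h0 (hX t) (hX (t+1)) (S.nonneg t) (S.rowSum t)
    (S.diagPos t) (S.symm t) (S.threshold t) (S.update t)
  have hT : Tw ρ (fun t => Srt.srt (S.x t)) (fun t => Srt.loF (fun a b => S.P t a b ≠ 0) (S.x t))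
      (fun t => Srt.hiF (fun a b => S.P t a b ≠ 0) (S.x t))
      (fun t => Srt.covd (fun a b => S.P t a b ≠ 0) (S.x t)) :=
    { mono := fun t j => Srt.srt_mono (hX t) (Nat.le_succ j)
      lo_le := fun t j => Srt.lo_le (hX t) j
      le_hi := fun t j => Srt.srt_mono (hX t) (Srt.hi_spec (hX t) j).1
      lo_cov := fun t j h => by simp only [Srt.loF]; rw [if_pos h]
      hi_cov := fun t j h => Srt.hi_cov h
      lo_unc := fun t j h => by simp only [Srt.loF]; rw [if_neg h]
      hi_unc := fun t j h => Srt.hi_unc (hX t) h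
      step_lo := fun t j => (hU t j).1.1
      step_hi := fun t j => (hU t j).1.2
      push_lo := fun t j h => ((hU t j).2 h).1
      push_hi := fun t j h => ((hU t j).2 h).2 }
  have hr : ∀ t i, S.P t i i ≠ 0 := fun t i => (S.diagPos t i).ne'
  have hsy : ∀ t i j, S.P t i j ≠ 0 → S.P t j i ≠ 0 := fun t i j h h' => h ((S.symm t j i).1 h')
  have hG : ∀ T, Tw.Good (fun t => Srt.covd (fun a b => S.P t a b ≠ 0) (S.x t)) 0 n 0 T m := by
    intro T τ _ _
    obtain ⟨c, _, hc⟩ := hcomp τ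
    refine ⟨Srt.unc_0 (hX τ), Srt.unc_n (hX τ), ?_⟩
    refine Srt.card_unc (E := fun a b => S.P τ a b ≠ 0) (hX τ) (hr τ) (by omega) c hc _ ?_
    intro j hj
    simpa using hj
  have hstep : ∀ t, stepEnergy s (S.edgeUnion t) ≤ ENNReal.ofReal
      (Tw.en (fun t => Srt.srt (S.x t)) (fun t => Srt.loF (fun a b => S.P t a b ≠ 0) (S.x t))
      (fun t => Srt.covd (fun a b => S.P t a b ≠ 0) (S.x t)) s 0 n t) := fun t =>
    Srt.energy_le (E := fun a b => S.P t a b ≠ 0) (hX t) (hsy t) (hr t) hs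
  unfold AvgSystem.energy
  rw [ENNReal.tsum_eq_iSup_nat]
  refine iSup_le fun T => ?_
  refine (Finset.sum_le_sum fun t _ => hstep t).trans ?_
  rw [← ENNReal.ofReal_sum_of_nonneg (fun t _ => hT.en_nonneg _ _ _ _)]
  apply ENNReal.ofReal_le_ofReal
  have hmain := hT.main h0 h1 hs hs1 n m 0 n 0 T (by omega) (by omega) (hG T)
  rw [← Finset.range_eq_Ico] at hmain
  refine hmain.trans ?_
  have hw : (Srt.srt (S.x 0) n - Srt.srt (S.x 0) (0+1))^s ≤ 1 := by
    obtain ⟨i, hi⟩ := Srt.exists_ag (X := S.x 0) (show 1 ≤ n by omega) le_rfl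
    obtain ⟨k, hk⟩ := Srt.exists_ag (X := S.x 0) (le_refl 1) (show 1 ≤ n by omega)
    have hle := Srt.srt_mono (hX 0) (show 0+1 ≤ n by omega)
    apply Real.rpow_le_one (by linarith) _ hs.le
    rw [zero_add, ← hi, ← hk]
    linarith [(hX 0 i).2, (hX 0 k).1]
  have hK := Tw.KK_le hs hs1 n (by omega) m
  have hK0 := Tw.KK_nonneg hs n m
  have hp : 0 ≤ ρ⁻¹ ^ (n-1) := by positivity
  rw [one_div, Nat.sub_zero]
  calc _ ≤ Tw.KK s n m * ρ⁻¹ ^ (n-1) * 1 := mul_le_mul_of_nonneg_left hw (mul_nonneg hK0 hp)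
    _ = Tw.KK s n m * ρ⁻¹ ^ (n-1) := mul_one _
    _ ≤ _ := mul_le_mul_of_nonneg_right hK hp
end

section
/- There is an absolute constant c > 0 such that for every n ≥ 2, every ρ ∈ (0,1/2], every s ∈ (0,1], and every m with 1 ≤ m ≤ n−1, the maximum s-energy of reversible averaging systems satisfies 𝓔^rev_{m,s} ≤ (c·n²/(ρ·s))^m. -/
open scoped BigOperators ENNReal

/-- A reversible averaging system: `P t = diag(q)⁻¹ · M t`, where each `M t` is a
symmetric nonnegative matrix whose nonzero entries are at least `1`, and
`q = M t · 𝟏` is the same vector for all `t`, with `q i ≤ 1/ρ`. -/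
structure RevAvgSystem (n : ℕ) (ρ : ℝ) extends AvgSystem n ρ where
  q : Fin n → ℝ
  M : ℕ → Matrix (Fin n) (Fin n) ℝ
  M_symm : ∀ t i j, M t i j = M t j i
  M_nonneg : ∀ t i j, 0 ≤ M t i j
  M_ge_one : ∀ t i j, M t i j ≠ 0 → 1 ≤ M t i j
  q_def : ∀ t i, q i = ∑ j, M t i j
  q_le : ∀ i, q i ≤ 1 / ρ
  P_eq : ∀ t i j, P t i j = M t i j / q i

/-- The initial scaled variance `∑ i, q i (x i − μ)² ≤ 1`, where
`μ = (∑ i, q i x i)/(∑ i, q i)`. -/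
def initVarLEOne {n : ℕ} (q x : Fin n → ℝ) : Prop :=
  ∑ i, q i * (x i - (∑ j, q j * x j) / (∑ j, q j)) ^ 2 ≤ 1

namespace RevE

variable {n : ℕ} {ρ : ℝ}

/-- `A` is closed under edges at time `t`. -/
def Cl (S : RevAvgSystem n ρ) (t : ℕ) (A : Finset (Fin n)) : Prop :=
  ∀ i ∈ A, ∀ j, S.P t i j ≠ 0 → j ∈ A

/-- scaled variance on `A` about `μ`. -/
noncomputable def W (S : RevAvgSystem n ρ) (A : Finset (Fin n)) (μ : ℝ) (t : ℕ) : ℝ :=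
  ∑ i ∈ A, S.q i * (S.x t i - μ) ^ 2

lemma M_diag (S : RevAvgSystem n ρ) (t : ℕ) (i : Fin n) : 1 ≤ S.M t i i := by
  apply S.M_ge_one
  intro h
  have := S.diagPos t i
  rw [S.P_eq, h] at this
  simp at this

lemma q_ge_one (S : RevAvgSystem n ρ) (i : Fin n) : 1 ≤ S.q i := by
  rw [S.q_def 0 i]
  exact (M_diag S 0 i).trans
    (Finset.single_le_sum (fun j _ => S.M_nonneg 0 i j) (Finset.mem_univ i))

lemma P_ne (S : RevAvgSystem n ρ) (t : ℕ) (i j : Fin n) : S.P t i j ≠ 0 ↔ S.M t i j ≠ 0 := by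
  have := q_ge_one S i
  rw [S.P_eq]
  have h : S.q i ≠ 0 := by positivity
  simp [h]

lemma x_succ (S : RevAvgSystem n ρ) (t : ℕ) (i : Fin n) :
    S.x (t + 1) i = ∑ j, S.P t i j * S.x t j := by
  rw [S.update]; rfl

lemma q_x_succ (S : RevAvgSystem n ρ) (t : ℕ) (i : Fin n) :
    S.q i * S.x (t + 1) i = ∑ j, S.M t i j * S.x t j := by
  have := q_ge_one S i
  have h : S.q i ≠ 0 := by positivity
  rw [x_succ, Finset.mul_sum]
  refine Finset.sum_congr rfl fun j _ => ?_
  rw [S.P_eq]; field_simp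

lemma W_eq (S : RevAvgSystem n ρ) (A : Finset (Fin n)) (μ : ℝ) (t : ℕ) (hA : Cl S t A) :
    W S A μ t = ∑ i ∈ A, ∑ j, S.M t i j * (S.x t j - μ) ^ 2 := by
  have h1 : ∀ i ∈ A, ∀ f : Fin n → ℝ, ∑ j, S.M t i j * f j = ∑ j ∈ A, S.M t i j * f j := by
    intro i hi f
    symm
    apply Finset.sum_subset (Finset.subset_univ A)
    intro j _ hj
    have : S.M t i j = 0 := by
      by_contra h
      exact hj (hA i hi j ((P_ne S t i j).2 h))
    simp [this]
  rw [Finset.sum_congr rfl (fun i hi => h1 i hi _), Finset.sum_comm, W]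
  refine Finset.sum_congr rfl fun i hi => ?_
  rw [S.q_def t i, Finset.sum_mul, h1 i hi (fun _ => (S.x t i - μ)^2)]
  refine Finset.sum_congr rfl fun j _ => ?_
  rw [S.M_symm]

lemma local_eq (S : RevAvgSystem n ρ) (μ : ℝ) (t : ℕ) (i : Fin n) :
    ∑ j, S.M t i j * (S.x t j - μ) ^ 2 = S.q i * (S.x (t+1) i - μ) ^ 2 +
      ∑ j, S.M t i j * (S.x t j - S.x (t+1) i) ^ 2 := by
  have h1 := q_x_succ S t i
  have h2 := S.q_def t i
  have e : ∀ ν : ℝ, ∑ j, S.M t i j * (S.x t j - ν) ^ 2 =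
      ∑ j, S.M t i j * (S.x t j) ^ 2 - 2 * ν * (S.q i * S.x (t+1) i) + ν ^ 2 * S.q i := by
    intro ν
    rw [h1, h2, Finset.mul_sum, Finset.mul_sum, ← Finset.sum_sub_distrib, ← Finset.sum_add_distrib]
    refine Finset.sum_congr rfl fun j _ => ?_
    ring
  rw [e, e]; ring

lemma local_ge (S : RevAvgSystem n ρ) (t : ℕ) (i j k : Fin n) (z : ℝ)
    (hj : S.P t i j ≠ 0) (hk : S.P t i k ≠ 0) :
    (S.x t k - S.x t j) ^ 2 / 2 ≤ ∑ l, S.M t i l * (S.x t l - z) ^ 2 := by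
  have hn : ∀ l ∈ Finset.univ, 0 ≤ S.M t i l * (S.x t l - z) ^ 2 :=
    fun l _ => mul_nonneg (S.M_nonneg t i l) (sq_nonneg _)
  by_cases h : j = k
  · subst h
    simpa using Finset.sum_nonneg hn
  · have h1 : ∑ l ∈ {j, k}, S.M t i l * (S.x t l - z) ^ 2 ≤ ∑ l, S.M t i l * (S.x t l - z) ^ 2 :=
      Finset.sum_le_sum_of_subset_of_nonneg (Finset.subset_univ _) (fun l hl _ => hn l (Finset.mem_univ l))
    rw [Finset.sum_pair h] at h1
    have a1 := S.M_ge_one t i j ((P_ne S t i j).1 hj)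
    have a2 := S.M_ge_one t i k ((P_ne S t i k).1 hk)
    have b1 : (S.x t j - z)^2 ≤ S.M t i j * (S.x t j - z) ^ 2 := le_mul_of_one_le_left (sq_nonneg _) a1
    have b2 : (S.x t k - z)^2 ≤ S.M t i k * (S.x t k - z) ^ 2 := le_mul_of_one_le_left (sq_nonneg _) a2
    nlinarith [sq_nonneg (S.x t j - z + (S.x t k - z))]

lemma gaps_le (y : ℕ → ℝ) (hy : Monotone y) (r : ℕ) (Z : Finset ℕ) (hZ : Z ⊆ Finset.range r)
    (a b : ℝ) (hab : a ≤ b) (h : ∀ k ∈ Z, a ≤ y k ∧ y (k+1) ≤ b) :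
    ∑ k ∈ Z, (y (k+1) - y k) ^ 2 ≤ (b - a) ^ 2 := by
  have hm : ∀ k, y k ≤ y (k+1) := fun k => hy (Nat.le_succ k)
  let φ : ℝ → ℝ := fun z => max a (min b z)
  have hφ : Monotone φ := by
    intro u v huv; simp only [φ]; gcongr
  have h1 : ∑ k ∈ Z, (y (k+1) - y k) = ∑ k ∈ Z, (φ (y (k+1)) - φ (y k)) := by
    refine Finset.sum_congr rfl fun k hk => ?_
    obtain ⟨h1, h2⟩ := h k hk
    have := hm k
    simp only [φ]
    rw [min_eq_right h2, min_eq_right (this.trans h2), max_eq_right h1, max_eq_right (h1.trans this)]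
  have h2 : ∑ k ∈ Z, (φ (y (k+1)) - φ (y k)) ≤ ∑ k ∈ Finset.range r, (φ (y (k+1)) - φ (y k)) :=
    Finset.sum_le_sum_of_subset_of_nonneg hZ (fun k _ _ => sub_nonneg.2 (hφ (hm k)))
  rw [Finset.sum_range_sub (fun k => φ (y k))] at h2
  have h3 : φ (y r) ≤ b := max_le hab (min_le_left _ _)
  have h4 : a ≤ φ (y 0) := le_max_left _ _
  have h5 : 0 ≤ ∑ k ∈ Z, (y (k+1) - y k) := Finset.sum_nonneg fun k _ => sub_nonneg.2 (hm k)
  have h6 : ∑ k ∈ Z, (y (k+1) - y k) ^ 2 ≤ (∑ k ∈ Z, (y (k+1) - y k)) ^ 2 :=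
    Finset.sum_sq_le_sq_sum_of_nonneg fun k _ => sub_nonneg.2 (hm k)
  refine h6.trans (pow_le_pow_left₀ h5 (by linarith) 2)

lemma drop_step (S : RevAvgSystem n ρ) (A : Finset (Fin n)) (μ : ℝ) (t : ℕ) (hA : Cl S t A)
    (y : ℕ → ℝ) (hy : Monotone y) (r : ℕ) (Z : Finset ℕ) (hZ : Z ⊆ Finset.range r)
    (h : ∀ k ∈ Z, ∃ i ∈ A, ∃ j, S.P t i j ≠ 0 ∧ S.x t i ≤ y k ∧ y (k+1) ≤ S.x t j) :
    W S A μ (t+1) + (∑ k ∈ Z, (y (k+1) - y k) ^ 2) / 2 ≤ W S A μ t := by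
  rw [W_eq S A μ t hA, Finset.sum_congr rfl (fun i _ => local_eq S μ t i), Finset.sum_add_distrib]
  refine add_le_add le_rfl ?_
  classical
  by_cases hZe : Z = ∅
  · subst hZe
    simp only [Finset.sum_empty, zero_div]
    exact Finset.sum_nonneg fun i _ => Finset.sum_nonneg fun j _ =>
      mul_nonneg (S.M_nonneg t i j) (sq_nonneg _)
  obtain ⟨k0, hk0⟩ := Finset.nonempty_iff_ne_empty.2 hZe
  obtain ⟨i0, -⟩ := h k0 hk0
  have h' : ∀ k, ∃ i, k ∈ Z → i ∈ A ∧ ∃ j, S.P t i j ≠ 0 ∧ S.x t i ≤ y k ∧ y (k+1) ≤ S.x t j := by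
    intro k
    by_cases hk : k ∈ Z
    · obtain ⟨i, hi, hh⟩ := h k hk
      exact ⟨i, fun _ => ⟨hi, hh⟩⟩
    · exact ⟨i0, fun h => absurd h hk⟩
  choose w hw using h'
  rw [← Finset.sum_fiberwise_of_maps_to (g := w) (t := A) (fun k hk => (hw k hk).1), Finset.sum_div]
  refine Finset.sum_le_sum fun i hi => ?_
  have hii : S.P t i i ≠ 0 := (S.diagPos t i).ne'
  let B : Finset (Fin n) := Finset.univ.filter fun j => S.P t i j ≠ 0
  have hB : i ∈ B := by simp [B, hii]
  obtain ⟨b, hb, hb'⟩ := Finset.exists_max_image B (S.x t) ⟨i, hB⟩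
  have hPb : S.P t i b ≠ 0 := by simpa [B] using hb
  refine le_trans ?_ (local_ge S t i i b _ hii hPb)
  gcongr
  apply gaps_le y hy r
  · exact (Finset.filter_subset _ _).trans hZ
  · exact hb' i hB
  · intro k hk
    obtain ⟨hk1, hk2⟩ := Finset.mem_filter.1 hk
    obtain ⟨-, j, hj, hj1, hj2⟩ := hw k hk1
    rw [hk2] at hj hj1
    exact ⟨hj1, hj2.trans (hb' j (by simp [B, hj]))⟩

lemma W_mono (S : RevAvgSystem n ρ) (A : Finset (Fin n)) (μ : ℝ) (t : ℕ) (hA : Cl S t A) :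
    W S A μ (t+1) ≤ W S A μ t := by
  have := drop_step S A μ t hA (fun _ => 0) (fun _ _ _ => le_rfl) 0 ∅ (by simp) (by simp)
  simpa using this

lemma avg_le (S : RevAvgSystem n ρ) (t : ℕ) (A : Finset (Fin n)) (hA : Cl S t A) (z : ℝ)
    (h : ∀ i ∈ A, S.x t i ≤ z) : ∀ i ∈ A, S.x (t+1) i ≤ z := by
  intro i hi
  rw [x_succ]
  calc ∑ j, S.P t i j * S.x t j ≤ ∑ j, S.P t i j * z := by
        refine Finset.sum_le_sum fun j _ => ?_
        by_cases hj : S.P t i j = 0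
        · simp [hj]
        · exact mul_le_mul_of_nonneg_left (h j (hA i hi j hj)) (S.nonneg t i j)
    _ = z := by rw [← Finset.sum_mul, S.rowSum, one_mul]

lemma le_avg (S : RevAvgSystem n ρ) (t : ℕ) (A : Finset (Fin n)) (hA : Cl S t A) (z : ℝ)
    (h : ∀ i ∈ A, z ≤ S.x t i) : ∀ i ∈ A, z ≤ S.x (t+1) i := by
  intro i hi
  rw [x_succ]
  calc z = ∑ j, S.P t i j * z := by rw [← Finset.sum_mul, S.rowSum, one_mul]
    _ ≤ ∑ j, S.P t i j * S.x t j := by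
        refine Finset.sum_le_sum fun j _ => ?_
        by_cases hj : S.P t i j = 0
        · simp [hj]
        · exact mul_le_mul_of_nonneg_left (h j (hA i hi j hj)) (S.nonneg t i j)

lemma avg_le_iter (S : RevAvgSystem n ρ) (t0 N : ℕ) (A : Finset (Fin n))
    (hA : ∀ t, t0 ≤ t → t < t0 + N → Cl S t A) (z : ℝ)
    (h : ∀ i ∈ A, S.x t0 i ≤ z) : ∀ i ∈ A, S.x (t0 + N) i ≤ z := by
  induction N with
  | zero => simpa using h
  | succ N ih =>
    exact avg_le S (t0 + N) A (hA _ (by omega) (by omega)) z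
      (ih fun t h1 h2 => hA t h1 (by omega))

lemma le_avg_iter (S : RevAvgSystem n ρ) (t0 N : ℕ) (A : Finset (Fin n))
    (hA : ∀ t, t0 ≤ t → t < t0 + N → Cl S t A) (z : ℝ)
    (h : ∀ i ∈ A, z ≤ S.x t0 i) : ∀ i ∈ A, z ≤ S.x (t0 + N) i := by
  induction N with
  | zero => simpa using h
  | succ N ih =>
    exact le_avg S (t0 + N) A (hA _ (by omega) (by omega)) z
      (ih fun t h1 h2 => hA t h1 (by omega))

/-- sorted values -/
lemma exists_sorted (A : Finset (Fin n)) (hA : A.Nonempty) (f : Fin n → ℝ) :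
    ∃ (r : ℕ) (y : ℕ → ℝ), r + 1 ≤ n ∧ Monotone y ∧ (∀ k < r, y k < y (k+1)) ∧
      (∀ i ∈ A, y 0 ≤ f i ∧ f i ≤ y r) ∧ (∀ k ≤ r, ∃ i ∈ A, f i = y k) ∧
      (∀ k < r, ∀ i ∈ A, f i ≤ y k ∨ y (k+1) ≤ f i) := by
  classical
  let Y := A.image f
  have hY : Y.Nonempty := hA.image f
  obtain ⟨r, hr⟩ : ∃ r, Y.card = r + 1 := ⟨Y.card - 1, by have := hY.card_pos; omega⟩
  let e := Y.orderEmbOfFin hr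
  have hmem : ∀ i ∈ A, ∃ k : Fin (r+1), e k = f i := by
    intro i hi
    have : f i ∈ Set.range e := by
      rw [Finset.range_orderEmbOfFin]; exact Finset.mem_coe.2 (Finset.mem_image_of_mem f hi)
    exact this
  have hmem' : ∀ k, ∃ i ∈ A, f i = e k := by
    intro k
    have := Finset.orderEmbOfFin_mem Y hr k
    obtain ⟨i, hi, h⟩ := Finset.mem_image.1 this
    exact ⟨i, hi, h⟩
  refine ⟨r, fun k => e ⟨min k r, by omega⟩, ?_, ?_, ?_, ?_, ?_, ?_⟩
  · rw [← hr]
    exact (Finset.card_image_le.trans (Finset.card_le_univ A)).trans (by simp)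
  · intro a b hab
    apply e.monotone
    simp only [Fin.mk_le_mk]; omega
  · intro k hk
    apply e.strictMono
    simp only [Fin.mk_lt_mk]; omega
  · intro i hi
    obtain ⟨k, hk⟩ := hmem i hi
    rw [← hk]
    constructor
    · apply e.monotone; rw [Fin.le_def]; simp
    · apply e.monotone; rw [Fin.le_def]; simp; omega
  · intro k _
    exact hmem' _
  · intro k hk i hi
    obtain ⟨l, hl⟩ := hmem i hi
    rw [← hl]
    rcases Nat.lt_or_ge k l.1 with h | h
    · right; apply e.monotone; rw [Fin.le_def]; simp; omega
    · left; apply e.monotone; rw [Fin.le_def]; simp; omega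

end RevE
namespace RevE

variable {n : ℕ} {ρ : ℝ}

/-- lower part of `A` at time `t0` below level `z` -/
noncomputable def Lo (S : RevAvgSystem n ρ) (A : Finset (Fin n)) (t0 : ℕ) (z : ℝ) :
    Finset (Fin n) :=
  A.filter fun i => S.x t0 i ≤ z

lemma cl_sdiff (S : RevAvgSystem n ρ) (t : ℕ) (A B : Finset (Fin n)) (hA : Cl S t A)
    (hB : Cl S t B) : Cl S t (A \ B) := by
  intro i hi j hj
  rw [Finset.mem_sdiff] at hi ⊢
  refine ⟨hA i hi.1 j hj, fun h => hi.2 (hB j h i ?_)⟩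
  intro h0
  exact hj ((S.symm t i j).2 h0)

lemma phase_drop (S : RevAvgSystem n ρ) (A : Finset (Fin n)) (μ : ℝ) (t0 J : ℕ)
    (hA : ∀ d < J + 1, Cl S (t0 + d) A) (r : ℕ) (y : ℕ → ℝ) (hy : Monotone y)
    (hsep : ∀ k < r, ∀ i ∈ A, S.x t0 i ≤ y k ∨ y (k+1) ≤ S.x t0 i)
    (hcr : ∀ k < r, ∃ d < J + 1, ¬ Cl S (t0 + d) (Lo S A t0 (y k))) :
    W S A μ (t0 + (J + 1)) + (∑ k ∈ Finset.range r, (y (k+1) - y k) ^ 2) / 2 ≤ W S A μ t0 := by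
  classical
  have hτ : ∀ k, ∃ τ, k < r → τ < J + 1 ∧ ¬ Cl S (t0 + τ) (Lo S A t0 (y k)) ∧
      ∀ d < τ, Cl S (t0 + d) (Lo S A t0 (y k)) := by
    intro k
    by_cases hk : k < r
    · have hex : ∃ d, ¬ Cl S (t0 + d) (Lo S A t0 (y k)) := by
        obtain ⟨d, -, h⟩ := hcr k hk
        exact ⟨d, h⟩
      refine ⟨Nat.find hex, fun _ => ⟨?_, Nat.find_spec hex, fun d hd => ?_⟩⟩
      · obtain ⟨d, h1, h⟩ := hcr k hk
        exact (Nat.find_min' hex h).trans_lt h1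
      · by_contra h
        exact Nat.find_min hex hd h
    · exact ⟨0, fun h => absurd h hk⟩
  choose τ hτ using hτ
  have key : ∀ d ≤ J + 1, W S A μ (t0 + d) +
      (∑ k ∈ (Finset.range r).filter (fun k => τ k < d), (y (k+1) - y k) ^ 2) / 2 ≤ W S A μ t0 := by
    intro d
    induction d with
    | zero => intro _; simp
    | succ d ih =>
      intro hd
      have h1 := ih (by omega)
      have h2 := drop_step S A μ (t0 + d) (hA d (by omega)) y hy r
        ((Finset.range r).filter (fun k => τ k = d)) (Finset.filter_subset _ _) (by
          intro k hk
          obtain ⟨hk1, hk2⟩ := Finset.mem_filter.1 hk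
          have hk1 := Finset.mem_range.1 hk1
          obtain ⟨a1, a2, a3⟩ := hτ k hk1
          rw [hk2] at a2 a3
          unfold Cl at a2
          push Not at a2
          obtain ⟨i, hi, j, hj, hj2⟩ := a2
          have hiA : i ∈ A := (Finset.mem_filter.1 hi).1
          have hjA : j ∈ A := hA d (by omega) i hiA j hj
          refine ⟨i, hiA, j, hj, ?_, ?_⟩
          · refine avg_le_iter S t0 d (Lo S A t0 (y k)) ?_ (y k)
              (fun i hi => (Finset.mem_filter.1 hi).2) i hi
            intro t ht1 ht2
            have := a3 (t - t0) (by omega)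
            rwa [Nat.add_sub_cancel' ht1] at this
          · refine le_avg_iter S t0 d (A \ Lo S A t0 (y k)) ?_ (y (k+1)) ?_ j
              (Finset.mem_sdiff.2 ⟨hjA, hj2⟩)
            · intro t ht1 ht2
              have := cl_sdiff S _ A _ (hA (t - t0) (by omega)) (a3 (t - t0) (by omega))
              rwa [Nat.add_sub_cancel' ht1] at this
            · intro l hl
              rw [Finset.mem_sdiff] at hl
              rcases hsep k hk1 l hl.1 with h | h
              · exact absurd (Finset.mem_filter.2 ⟨hl.1, h⟩) hl.2
              · exact h)
      have h3 : (Finset.range r).filter (fun k => τ k < d + 1) =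
          (Finset.range r).filter (fun k => τ k < d) ∪ (Finset.range r).filter (fun k => τ k = d) := by
        ext k; simp only [Finset.mem_filter, Finset.mem_union]
        have : τ k < d + 1 ↔ τ k < d ∨ τ k = d := by omega
        rw [this]; tauto
      rw [h3, Finset.sum_union]
      · rw [← add_assoc t0 d 1]; linarith
      · rw [Finset.disjoint_left]
        intro k h1 h2
        have := (Finset.mem_filter.1 h1).2
        have := (Finset.mem_filter.1 h2).2
        omega
  have h := key (J + 1) le_rfl
  rwa [Finset.filter_true_of_mem (fun k hk => (hτ k (Finset.mem_range.1 hk)).1)] at h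

lemma W_nonneg (S : RevAvgSystem n ρ) (A : Finset (Fin n)) (μ : ℝ) (t : ℕ) : 0 ≤ W S A μ t :=
  Finset.sum_nonneg fun i _ => mul_nonneg (by linarith [q_ge_one S i]) (sq_nonneg _)

lemma W_subset (S : RevAvgSystem n ρ) (A B : Finset (Fin n)) (h : A ⊆ B) (μ : ℝ) (t : ℕ) :
    W S A μ t ≤ W S B μ t :=
  Finset.sum_le_sum_of_subset_of_nonneg h
    fun i _ _ => mul_nonneg (by linarith [q_ge_one S i]) (sq_nonneg _)

lemma W_clamp (S : RevAvgSystem n ρ) (A : Finset (Fin n)) (μ a b : ℝ) (t : ℕ) (hab : a ≤ b)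
    (h : ∀ i ∈ A, a ≤ S.x t i ∧ S.x t i ≤ b) :
    W S A (max a (min b μ)) t ≤ W S A μ t := by
  refine Finset.sum_le_sum fun i hi => mul_le_mul_of_nonneg_left ?_ (by linarith [q_ge_one S i])
  obtain ⟨h1, h2⟩ := h i hi
  rcases le_total b μ with h3 | h3
  · rw [min_eq_left h3, max_eq_right hab]; nlinarith
  · rw [min_eq_right h3]
    rcases le_total a μ with h4 | h4
    · rw [max_eq_right h4]
    · rw [max_eq_left h4]; nlinarith

lemma W_le_diam (S : RevAvgSystem n ρ) (hρ : 0 < ρ) (A : Finset (Fin n)) (μ a b : ℝ) (t : ℕ)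
    (ha : a ≤ μ) (hb : μ ≤ b)
    (h : ∀ i ∈ A, a ≤ S.x t i ∧ S.x t i ≤ b) :
    W S A μ t ≤ n * (1 / ρ * (b - a) ^ 2) := by
  have h1 : W S A μ t ≤ ∑ i ∈ A, 1 / ρ * (b - a) ^ 2 := by
    refine Finset.sum_le_sum fun i hi => ?_
    obtain ⟨h1, h2⟩ := h i hi
    refine mul_le_mul (S.q_le i) ?_ (sq_nonneg _) (by positivity)
    apply sq_le_sq'
    · linarith
    · linarith
  rw [Finset.sum_const, nsmul_eq_mul] at h1
  refine h1.trans (mul_le_mul_of_nonneg_right ?_ (by positivity))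
  have := Finset.card_le_univ A
  rw [Fintype.card_fin] at this
  exact_mod_cast this

/-- diameter of a label class -/
noncomputable def dm (S : RevAvgSystem n ρ) {m0 : ℕ} (c : ℕ → Fin n → Fin m0) (t : ℕ)
    (a : Fin m0) : ℝ :=
  Metric.diam (S.x t '' {i | c t i = a})

/-- surrogate energy -/
noncomputable def en (S : RevAvgSystem n ρ) {m0 : ℕ} (c : ℕ → Fin n → Fin m0) (s : ℝ)
    (A : Finset (Fin n)) (t : ℕ) : ℝ :=
  ∑ a ∈ A.image (c t), dm S c t a ^ s

lemma en_nonneg (S : RevAvgSystem n ρ) {m0 : ℕ} (c : ℕ → Fin n → Fin m0) (s : ℝ)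
    (A : Finset (Fin n)) (t : ℕ) : 0 ≤ en S c s A t :=
  Finset.sum_nonneg fun _ _ => Real.rpow_nonneg Metric.diam_nonneg _

lemma cl_label (S : RevAvgSystem n ρ) {m0 : ℕ} (c : ℕ → Fin n → Fin m0)
    (hc : ∀ t i j, c t i = c t j → Relation.ReflTransGen (fun a b => S.P t a b ≠ 0) i j)
    (t : ℕ) (A : Finset (Fin n)) (hA : Cl S t A) (i j : Fin n) (hi : i ∈ A)
    (h : c t i = c t j) : j ∈ A := by
  have := hc t i j h
  induction this with
  | refl => exact hi
  | tail h1 h2 ih => 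
    rename_i b d
    by_cases hb : b ∈ A
    · exact hA b hb d h2
    · exfalso
      clear ih h h2
      induction h1 with
      | refl => exact hb hi
      | tail h1 h2 ih => exact ih fun h => hb (hA _ h _ h2)

lemma en_le (S : RevAvgSystem n ρ) {m0 : ℕ} (c : ℕ → Fin n → Fin m0)
    (hc : ∀ t i j, c t i = c t j → Relation.ReflTransGen (fun a b => S.P t a b ≠ 0) i j)
    (s : ℝ) (hs : 0 < s) (hs1 : s ≤ 1)
    (t : ℕ) (A : Finset (Fin n)) (hA : Cl S t A) (μ v : ℝ) (hW : W S A μ t ≤ v) :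
    en S c s A t ≤ (A.image (c t)).card * (2 * v ^ (s / 2)) := by
  have hv : 0 ≤ v := (W_nonneg S A μ t).trans hW
  rw [← nsmul_eq_mul]
  apply Finset.sum_le_card_nsmul
  intro a ha
  obtain ⟨i0, hi0, hia⟩ := Finset.mem_image.1 ha
  have h1 : dm S c t a ≤ Real.sqrt (2 * v) := by
    apply Metric.diam_le_of_forall_dist_le (Real.sqrt_nonneg _)
    rintro _ ⟨i, hi, rfl⟩ _ ⟨j, hj, rfl⟩
    have hi' : i ∈ A := cl_label S c hc t A hA i0 i hi0 (hia.trans hi.symm)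
    have hj' : j ∈ A := cl_label S c hc t A hA i0 j hi0 (hia.trans hj.symm)
    rw [Real.dist_eq]
    apply Real.abs_le_sqrt
    by_cases hij : i = j
    · subst hij; simpa using hv
    have h2 : W S {i, j} μ t ≤ W S A μ t := W_subset S _ _ (by
      intro l hl; simp at hl; rcases hl with rfl | rfl <;> assumption) μ t
    rw [W, Finset.sum_pair hij] at h2
    have b1 : (S.x t i - μ)^2 ≤ S.q i * (S.x t i - μ) ^ 2 :=
      le_mul_of_one_le_left (sq_nonneg _) (q_ge_one S i)
    have b2 : (S.x t j - μ)^2 ≤ S.q j * (S.x t j - μ) ^ 2 :=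
      le_mul_of_one_le_left (sq_nonneg _) (q_ge_one S j)
    nlinarith [sq_nonneg (S.x t i - μ + (S.x t j - μ))]
  calc dm S c t a ^ s ≤ (Real.sqrt (2 * v)) ^ s :=
        Real.rpow_le_rpow Metric.diam_nonneg h1 hs.le
    _ = 2 ^ (s/2) * v ^ (s/2) := by
        rw [Real.sqrt_eq_rpow, ← Real.rpow_mul (by positivity), Real.mul_rpow (by norm_num) hv]
        congr 2 <;> ring
    _ ≤ 2 * v ^ (s/2) := by
        gcongr
        calc (2:ℝ) ^ (s/2) ≤ 2 ^ (1:ℝ) := Real.rpow_le_rpow_of_exponent_le (by norm_num) (by linarith)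
          _ = 2 := by simp

lemma split_label (S : RevAvgSystem n ρ) {m0 : ℕ} (c : ℕ → Fin n → Fin m0)
    (hc : ∀ t i j, c t i = c t j → Relation.ReflTransGen (fun a b => S.P t a b ≠ 0) i j)
    (s : ℝ) (t : ℕ) (A B : Finset (Fin n)) (hBA : B ⊆ A) (hB : Cl S t B) :
    (A.image (c t)).card = (B.image (c t)).card + ((A \ B).image (c t)).card ∧
    en S c s A t = en S c s B t + en S c s (A \ B) t := by
  classical
  have h1 : A.image (c t) = B.image (c t) ∪ (A \ B).image (c t) := by
    rw [← Finset.image_union, Finset.union_sdiff_of_subset hBA]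
  have h2 : Disjoint (B.image (c t)) ((A \ B).image (c t)) := by
    rw [Finset.disjoint_left]
    intro a ha ha'
    obtain ⟨i, hi, hia⟩ := Finset.mem_image.1 ha
    obtain ⟨j, hj, hja⟩ := Finset.mem_image.1 ha'
    exact (Finset.mem_sdiff.1 hj).2 (cl_label S c hc t B hB i j hi (hia.trans hja.symm))
  constructor
  · rw [h1, Finset.card_union_of_disjoint h2]
  · unfold en; rw [h1, Finset.sum_union h2]

lemma main_bound (S : RevAvgSystem n ρ) (hρ : 0 < ρ) (hρ1 : ρ ≤ 1/2) (hn : 2 ≤ n)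
    {m0 : ℕ} (c : ℕ → Fin n → Fin m0)
    (hc : ∀ t i j, c t i = c t j → Relation.ReflTransGen (fun a b => S.P t a b ≠ 0) i j)
    (s : ℝ) (hs : 0 < s) (hs1 : s ≤ 1) (m : ℕ) :
    ∀ (N t0 : ℕ) (A : Finset (Fin n)) (v μ : ℝ),
      (∀ d < N, Cl S (t0 + d) A ∧ (A.image (c (t0 + d))).card ≤ m) → W S A μ t0 ≤ v →
      ∑ d ∈ Finset.range N, en S c s A (t0 + d) ≤ v ^ (s/2) * (16 * n ^ 2 / (ρ * s)) ^ m := by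
  classical
  have hn' : (2:ℝ) ≤ n := by exact_mod_cast hn
  set K : ℝ := 16 * n ^ 2 / (ρ * s) with hK
  have hKn : (n:ℝ) ≤ K := by
    rw [hK, le_div_iff₀ (by positivity)]
    have : ρ * s ≤ 1 := by nlinarith
    nlinarith
  have hK2 : 2 ≤ K := hn'.trans hKn
  have hK0 : 0 < K := by linarith
  set δ : ℝ := ρ / (2 * n ^ 2) with hδ
  have hδ0 : 0 < δ := by positivity
  have hδ1 : δ ≤ 1 := by
    rw [hδ, div_le_one (by positivity)]; nlinarith
  have hKδ : K * (δ * (s / 2)) = 4 := by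
    rw [hK, hδ]; field_simp; norm_num
  induction m with
  | zero =>
    intro N t0 A v μ h hW
    have hv : 0 ≤ v := (W_nonneg S A μ t0).trans hW
    rw [Finset.sum_eq_zero]
    · positivity
    · intro d hd
      have := (h d (Finset.mem_range.1 hd)).2
      have h0 := Finset.card_eq_zero.1 (Nat.le_zero.1 this)
      simp [en, h0]
  | succ m ihm =>
    intro N
    induction N using Nat.strong_induction_on with
    | _ N ihN =>
    intro t0 A v μ0 h hW0
    have hv : 0 ≤ v := (W_nonneg S A μ0 t0).trans hW0
    have hu : 0 ≤ v ^ (s/2) := by positivity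
    by_cases hAe : A.Nonempty
    swap
    · rw [Finset.not_nonempty_iff_eq_empty] at hAe
      subst hAe
      rw [Finset.sum_eq_zero]
      · positivity
      · intro d hd; simp [en]
    obtain ⟨r, y, hrn, hy, hyl, hyr, hyA, hsep⟩ := exists_sorted A hAe (S.x t0)
    have hy0r : y 0 ≤ y r := hy (Nat.zero_le r)
    have hW := (W_clamp S A μ0 (y 0) (y r) t0 hy0r hyr).trans hW0
    have hμ1 : y 0 ≤ max (y 0) (min (y r) μ0) := le_max_left _ _
    have hμ2 : max (y 0) (min (y r) μ0) ≤ y r := max_le hy0r (min_le_left _ _)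
    generalize max (y 0) (min (y r) μ0) = μ at hW hμ1 hμ2
    let Good : ℕ → Prop := fun j => j = 0 ∨ ∃ k < r, ∀ d < j, Cl S (t0 + d) (Lo S A t0 (y k))
    have split : ∀ j ≤ N, Good j →
        ∑ d ∈ Finset.range j, en S c s A (t0 + d) ≤ 2 * (v ^ (s/2) * K ^ m) := by
      intro j hj hg
      rcases hg with rfl | ⟨k, hk, hcl⟩
      · simp; positivity
      · set B := Lo S A t0 (y k) with hB
        have hBA : B ⊆ A := Finset.filter_subset _ _
        have hBne : B.Nonempty := by
          obtain ⟨i, hi, hik⟩ := hyA k hk.le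
          exact ⟨i, Finset.mem_filter.2 ⟨hi, hik.le⟩⟩
        have hCne : (A \ B).Nonempty := by
          obtain ⟨i, hi, hik⟩ := hyA (k+1) hk
          refine ⟨i, Finset.mem_sdiff.2 ⟨hi, fun hh => ?_⟩⟩
          have := (Finset.mem_filter.1 hh).2
          have := hyl k hk
          linarith
        have hcards : ∀ d < j, (B.image (c (t0+d))).card ≤ m ∧ ((A \ B).image (c (t0+d))).card ≤ m := by
          intro d hd
          have h1 := (split_label S c hc s (t0+d) A B hBA (hcl d hd)).1
          have h2 := (h d (by omega)).2
          have h3 := (hBne.image (c (t0+d))).card_pos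
          have h4 := (hCne.image (c (t0+d))).card_pos
          omega
        have e1 := ihm j t0 B v μ (fun d hd => ⟨hcl d hd, (hcards d hd).1⟩)
          ((W_subset S B A hBA μ t0).trans hW)
        have e2 := ihm j t0 (A \ B) v μ
          (fun d hd => ⟨cl_sdiff S _ A B (h d (by omega)).1 (hcl d hd), (hcards d hd).2⟩)
          ((W_subset S _ A Finset.sdiff_subset μ t0).trans hW)
        rw [Finset.sum_congr rfl (fun d hd =>
          (split_label S c hc s (t0+d) A B hBA (hcl d (Finset.mem_range.1 hd))).2),
          Finset.sum_add_distrib]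
        linarith
    by_cases hgN : Good N
    · refine (split N le_rfl hgN).trans ?_
      have : 0 ≤ v ^ (s/2) * K ^ m := by positivity
      rw [pow_succ]
      nlinarith
    · have hex : ∃ j, ¬ Good j := ⟨N, hgN⟩
      have hf1 := Nat.find_spec hex
      have hf2 : ∀ j < Nat.find hex, Good j := fun j hj => by
        by_contra hh; exact Nat.find_min hex hj hh
      have hf3 : Nat.find hex ≤ N := Nat.find_min' hex hgN
      generalize Nat.find hex = f at hf1 hf2 hf3
      obtain ⟨J, rfl⟩ : ∃ J, f = J + 1 := by
        cases f with
        | zero => exact absurd (Or.inl rfl) hf1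
        | succ J => exact ⟨J, rfl⟩
      have hgJ := hf2 J (by omega)
      have hcr : ∀ k < r, ∃ d < J + 1, ¬ Cl S (t0 + d) (Lo S A t0 (y k)) := by
        intro k hk
        by_contra hh
        push Not at hh
        exact hf1 (Or.inr ⟨k, hk, hh⟩)
      have hdrop := phase_drop S A μ t0 J (fun d hd => (h d (by omega)).1) r y hy hsep hcr
      have hWd := W_le_diam S hρ A μ (y 0) (y r) t0 hμ1 hμ2 hyr
      have hcs : (y r - y 0) ^ 2 ≤ n * ∑ k ∈ Finset.range r, (y (k+1) - y k) ^ 2 := by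
        have := sq_sum_le_card_mul_sum_sq (s := Finset.range r) (f := fun k => y (k+1) - y k)
        rw [Finset.sum_range_sub, Finset.card_range] at this
        refine this.trans (mul_le_mul_of_nonneg_right ?_ (Finset.sum_nonneg fun _ _ => sq_nonneg _))
        exact_mod_cast (by omega : r ≤ n)
      have hnew : W S A μ (t0 + (J+1)) ≤ (1 - δ) * v := by
        have h1 : δ * W S A μ t0 ≤ (∑ k ∈ Finset.range r, (y (k+1) - y k) ^ 2) / 2 := by
          calc δ * W S A μ t0 ≤ δ * (n * (1 / ρ * (y r - y 0) ^ 2)) := by gcongr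
            _ = (y r - y 0) ^ 2 / (2 * n) := by rw [hδ]; field_simp
            _ ≤ (n * ∑ k ∈ Finset.range r, (y (k+1) - y k) ^ 2) / (2 * n) := by gcongr
            _ = _ := by field_simp
        nlinarith
      have hWJ : ∀ d ≤ J, W S A μ (t0 + d) ≤ v := by
        intro d
        induction d with
        | zero => intro _; simpa using hW
        | succ d ih => 
          intro hd
          exact (W_mono S A μ (t0 + d) (h d (by omega)).1).trans (ih (by omega))
      have hstep := en_le S c hc s hs hs1 (t0 + J) A (h J (by omega)).1 μ v (hWJ J le_rfl)
      have hcard : ((A.image (c (t0 + J))).card : ℝ) ≤ K ^ m := by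
        rcases Nat.eq_zero_or_pos m with rfl | hm
        · have := (h J (by omega)).2
          simp only [pow_zero]
          exact_mod_cast this
        · have h1 : (A.image (c (t0 + J))).card ≤ n :=
            (Finset.card_image_le.trans (Finset.card_le_univ A)).trans (by simp)
          have h2 : ((A.image (c (t0 + J))).card : ℝ) ≤ n := by exact_mod_cast h1
          exact (h2.trans hKn).trans (le_self_pow₀ (by linarith) (by omega))
      obtain ⟨N', rfl⟩ : ∃ N', N = (J + 1) + N' := ⟨N - (J+1), by omega⟩
      have htail := ihN N' (by omega) (t0 + (J+1)) A ((1 - δ) * v) μ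
        (fun d hd => by rw [add_assoc]; exact h _ (by omega)) hnew
      have hpow : ((1 - δ) * v) ^ (s/2) ≤ (1 - δ * (s/2)) * v ^ (s/2) := by
        rw [Real.mul_rpow (by linarith) hv]
        gcongr
        have := _root_.rpow_one_add_le_one_add_mul_self (s := -δ) (by linarith) (p := s/2)
          (by positivity) (by linarith)
        calc (1 - δ) ^ (s/2) = (1 + -δ) ^ (s/2) := by ring_nf
          _ ≤ 1 + s/2 * -δ := this
          _ = _ := by ring
      rw [Finset.sum_range_add, Finset.sum_range_succ]
      have e0 := split J (by omega) hgJ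
      have e1 : ∑ x ∈ Finset.range N', en S c s A (t0 + (J + 1 + x)) ≤
          (1 - δ * (s/2)) * v ^ (s/2) * K ^ (m+1) := by
        simp only [← add_assoc] at htail ⊢
        exact htail.trans (by gcongr)
      have e2 : en S c s A (t0 + J) ≤ K ^ m * (2 * v ^ (s/2)) := hstep.trans (by gcongr)
      have e3 : (1 - δ * (s/2)) * v ^ (s/2) * K ^ (m+1) =
          v ^ (s/2) * K ^ (m+1) - v ^ (s/2) * K ^ m * (K * (δ * (s/2))) := by ring
      rw [e3, hKδ] at e1
      linarith

end RevE
namespace RevE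

variable {n : ℕ} {ρ : ℝ}

lemma rpow_sum_le {ι : Type*} (A : Finset ι) (f : ι → ℝ) (hf : ∀ i, 0 ≤ f i) (s : ℝ)
    (hs : 0 < s) (hs1 : s ≤ 1) : (∑ i ∈ A, f i) ^ s ≤ ∑ i ∈ A, f i ^ s := by
  classical
  induction A using Finset.induction_on with
  | empty => simp [Real.zero_rpow hs.ne']
  | insert a A ha ih =>
    rw [Finset.sum_insert ha, Finset.sum_insert ha]
    refine (Real.rpow_add_le_add_rpow (hf a) (Finset.sum_nonneg fun i _ => hf i) hs.le hs1).trans ?_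
    gcongr

lemma edge_sub (S : RevAvgSystem n ρ) (t : ℕ) (i j : Fin n) (h : S.P t i j ≠ 0) :
    Set.uIcc (S.x t i) (S.x t j) ⊆ S.toAvgSystem.edgeUnion t := by
  intro z hz
  simp only [AvgSystem.edgeUnion, Set.mem_iUnion]
  exact ⟨i, j, h, hz⟩

lemma x_mem (S : RevAvgSystem n ρ) (t : ℕ) (i : Fin n) : S.x t i ∈ S.toAvgSystem.edgeUnion t :=
  edge_sub S t i i (S.diagPos t i).ne' Set.left_mem_uIcc

lemma step_le (S : RevAvgSystem n ρ) {m0 : ℕ} (c : ℕ → Fin n → Fin m0)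
    (hc1 : ∀ t i j, S.P t i j ≠ 0 → c t i = c t j)
    (hc : ∀ t i j, c t i = c t j → Relation.ReflTransGen (fun a b => S.P t a b ≠ 0) i j)
    (s : ℝ) (hs : 0 < s) (hs1 : s ≤ 1) (t : ℕ) :
    stepEnergy s (S.toAvgSystem.edgeUnion t) ≤ ENNReal.ofReal (en S c s Finset.univ t) := by
  classical
  set U := S.toAvgSystem.edgeUnion t with hU
  have hdm : ∀ a, 0 ≤ dm S c t a := fun a => Metric.diam_nonneg
  have hCsame : ∀ i j, S.P t i j ≠ 0 →
      connectedComponentIn U (S.x t i) = connectedComponentIn U (S.x t j) := by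
    intro i j h
    apply connectedComponentIn_eq
    exact (isPreconnected_uIcc.subset_connectedComponentIn Set.left_mem_uIcc (edge_sub S t i j h))
      Set.right_mem_uIcc
  have hlab : ∀ i j, c t i = c t j →
      connectedComponentIn U (S.x t i) = connectedComponentIn U (S.x t j) := by
    intro i j h
    have := hc t i j h
    clear h
    induction this with
    | refl => rfl
    | tail _ h2 ih => exact ih.trans (hCsame _ _ h2)
  have hblk : ∀ C ∈ blockSet U, ∀ z ∈ C, C = connectedComponentIn U z := by
    rintro C ⟨a, _, rfl⟩ z hz
    exact connectedComponentIn_eq hz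
  -- labels in a block
  let T : Set ℝ → Finset (Fin m0) := fun C =>
    (Finset.univ.image (c t)).filter fun a => ∃ i, c t i = a ∧ S.x t i ∈ C
  have hdiam : ∀ C ∈ blockSet U, Metric.diam C ≤ ∑ a ∈ T C, dm S c t a := by
    intro C hC
    have hcov : C ⊆ ⋃ a ∈ T C, Set.Icc (sInf (S.x t '' {i | c t i = a}))
        (sSup (S.x t '' {i | c t i = a})) := by
      intro z hz
      have hCz := hblk C hC z hz
      have hzU : z ∈ U := by
        rw [hCz] at hz; exact connectedComponentIn_subset _ _ hz
      simp only [hU, AvgSystem.edgeUnion, Set.mem_iUnion] at hzU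
      obtain ⟨i, j, hij, hzij⟩ := hzU
      have hxi : S.x t i ∈ C := by
        rw [hCz]
        exact (isPreconnected_uIcc.subset_connectedComponentIn hzij (edge_sub S t i j hij))
          Set.left_mem_uIcc
      simp only [Set.mem_iUnion]
      refine ⟨c t i, Finset.mem_filter.2 ⟨Finset.mem_image_of_mem _ (Finset.mem_univ i), i, rfl, hxi⟩, ?_⟩
      have hfin : (S.x t '' {l | c t l = c t i}).Finite := Set.toFinite _
      have mi : S.x t i ∈ S.x t '' {l | c t l = c t i} := ⟨i, rfl, rfl⟩
      have mj : S.x t j ∈ S.x t '' {l | c t l = c t i} := ⟨j, (hc1 t i j hij).symm, rfl⟩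
      have : Set.uIcc (S.x t i) (S.x t j) ⊆ Set.Icc (sInf (S.x t '' {l | c t l = c t i}))
          (sSup (S.x t '' {l | c t l = c t i})) :=
        Set.uIcc_subset_Icc ⟨csInf_le hfin.bddBelow mi, le_csSup hfin.bddAbove mi⟩
          ⟨csInf_le hfin.bddBelow mj, le_csSup hfin.bddAbove mj⟩
      exact this hzij
    have hvol : MeasureTheory.volume C ≤ ENNReal.ofReal (∑ a ∈ T C, dm S c t a) := by
      refine (MeasureTheory.measure_mono hcov).trans ?_
      refine (MeasureTheory.measure_biUnion_finset_le _ _).trans ?_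
      rw [ENNReal.ofReal_sum_of_nonneg (fun a _ => hdm a)]
      refine Finset.sum_le_sum fun a _ => ?_
      rw [Real.volume_Icc, dm, Real.diam_eq (Set.toFinite _).isBounded]
    have hsn : 0 ≤ ∑ a ∈ T C, dm S c t a := Finset.sum_nonneg fun a _ => Metric.diam_nonneg
    have hord : C.OrdConnected := by
      obtain ⟨a, _, rfl⟩ := hC
      exact isPreconnected_connectedComponentIn.ordConnected
    apply Metric.diam_le_of_forall_dist_le hsn
    have aux : ∀ z ∈ C, ∀ w ∈ C, w - z ≤ ∑ a ∈ T C, dm S c t a := by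
      intro z hz w hw
      have h1 : MeasureTheory.volume (Set.Icc z w) ≤ MeasureTheory.volume C :=
        MeasureTheory.measure_mono (hord.out hz hw)
      rw [Real.volume_Icc] at h1
      exact (ENNReal.ofReal_le_ofReal_iff hsn).1 (h1.trans hvol)
    intro z hz w hw
    rw [Real.dist_eq, abs_le]
    constructor
    · linarith [aux z hz w hw]
    · exact aux w hw z hz
  have hterm : ∀ C : blockSet U, ENNReal.ofReal (Metric.diam (C : Set ℝ) ^ s) ≤
      ∑ a ∈ Finset.univ.image (c t), if ∃ i, c t i = a ∧ S.x t i ∈ (C : Set ℝ)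
        then ENNReal.ofReal (dm S c t a ^ s) else 0 := by
    intro C
    rw [← Finset.sum_filter]
    rw [← ENNReal.ofReal_sum_of_nonneg (fun a _ => Real.rpow_nonneg (hdm a) _)]
    apply ENNReal.ofReal_le_ofReal
    refine (Real.rpow_le_rpow Metric.diam_nonneg (hdiam C C.2) hs.le).trans ?_
    exact rpow_sum_le _ _ (fun a => Metric.diam_nonneg) s hs hs1
  unfold stepEnergy
  refine (ENNReal.tsum_le_tsum hterm).trans ?_
  rw [Summable.tsum_finsetSum (fun _ _ => ENNReal.summable), en,
    ENNReal.ofReal_sum_of_nonneg (fun a _ => Real.rpow_nonneg (hdm a) _)]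
  refine Finset.sum_le_sum fun a ha => ?_
  obtain ⟨i, -, hia⟩ := Finset.mem_image.1 ha
  rw [tsum_eq_single (⟨connectedComponentIn U (S.x t i), S.x t i, x_mem S t i, rfl⟩ : blockSet U)]
  · split_ifs
    · exact le_rfl
    · exact zero_le
  · intro C hC
    rw [if_neg]
    rintro ⟨j, hj, hjC⟩
    apply hC
    apply Subtype.ext
    rw [hblk C C.2 _ hjC]
    exact hlab j i (hj.trans hia.symm)

end RevE

/-- There is an absolute constant `c > 0` such that for every `n ≥ 2`,
every `ρ ∈ (0,1/2]`, every `s ∈ (0,1]`, and every `m` with `1 ≤ m ≤ n-1`, the maximum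
`s`-energy of reversible averaging systems satisfies `𝓔^rev_{m,s} ≤ (c·n²/(ρ·s))^m`. -/
theorem maxRevSEnergy_le :
    ∃ c : ℝ, 0 < c ∧
      ∀ (n m : ℕ) (ρ s : ℝ), 2 ≤ n → 0 < ρ → ρ ≤ 1 / 2 → 0 < s → s ≤ 1 →
        1 ≤ m → m ≤ n - 1 →
        ∀ S : RevAvgSystem n ρ,
          S.toAvgSystem.componentsLE m →
          initVarLEOne S.q (S.x 0) →
          S.toAvgSystem.energy s ≤ ENNReal.ofReal ((c * n ^ 2 / (ρ * s)) ^ m) := by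
  refine ⟨16, by norm_num, ?_⟩
  intro n m ρ s hn hρ hρ1 hs hs1 hm hmn S hcomp hvar
  choose c hc1 hc using hcomp
  unfold AvgSystem.energy
  rw [ENNReal.tsum_eq_iSup_nat]
  refine iSup_le fun N => ?_
  refine (Finset.sum_le_sum fun t _ => RevE.step_le S c hc1 hc s hs hs1 t).trans ?_
  rw [← ENNReal.ofReal_sum_of_nonneg (fun t _ => RevE.en_nonneg S c s _ t)]
  apply ENNReal.ofReal_le_ofReal
  have := RevE.main_bound S hρ hρ1 hn c hc s hs hs1 m N 0 Finset.univ 1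
    ((∑ j, S.q j * S.x 0 j) / (∑ j, S.q j))
    (fun d _ => ⟨fun i _ j _ => Finset.mem_univ j, (Finset.card_le_univ _).trans (by simp)⟩) hvar
  simpa using this
end

section
/- There is an absolute constant a > 0 such that for every expanding averaging system with connected graphs (m = 1), degree d, Cheeger constant h, and every s ∈ (0,1], the maximum s-energy satisfies 𝓔^exp_{1,s} ≤ a·d³/(s·h²). -/
open scoped BigOperators ENNReal

/-- An expanding averaging system of degree `d` and Cheeger constant `h`:
`P t = (1/d)·M t` where `M t` is the 0/1 adjacency matrix of `G t` (self-loops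
included, every vertex having degree exactly `d` counting its self-loop), and every
connected component of each `G t` is a `d`-regular expander with Cheeger constant `h`. -/
structure ExpSystem (n d : ℕ) (h : ℝ) where
  M : ℕ → Matrix (Fin n) (Fin n) ℝ
  x : ℕ → Fin n → ℝ
  M_01 : ∀ t i j, M t i j = 0 ∨ M t i j = 1
  M_symm : ∀ t i j, M t i j = M t j i
  M_diag : ∀ t i, M t i i = 1
  M_deg : ∀ t i, ∑ j, M t i j = d
  /-- Cheeger-constant condition for every connected component: for every vertex `v`,
  every subset `X` of the connected component of `v` containing at most half of the
  component's vertices has at least `h·|X|` edges with exactly one endpoint in `X`. -/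
  expander : ∀ t (v : Fin n) (X : Set (Fin n)),
    (∀ a ∈ X, Relation.ReflTransGen (fun b c => M t b c ≠ 0) v a) →
    2 * X.ncard ≤ {a | Relation.ReflTransGen (fun b c => M t b c ≠ 0) v a}.ncard →
    h * X.ncard ≤
      ({e : Fin n × Fin n | e.1 ∈ X ∧ e.2 ∉ X ∧ e.1 ≠ e.2 ∧ M t e.1 e.2 ≠ 0}.ncard : ℝ)
  update : ∀ t i, x (t + 1) i = (1 / (d : ℝ)) * ∑ j, M t i j * x t j

/-- The union of the embedded edges of `G t` on the real line. -/
def ExpSystem.edgeUnion {n d : ℕ} {h : ℝ} (S : ExpSystem n d h) (t : ℕ) : Set ℝ :=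
  ⋃ (i : Fin n) (j : Fin n) (_ : S.M t i j ≠ 0), Set.uIcc (S.x t i) (S.x t j)

/-- The `s`-energy of an expanding averaging system. -/
noncomputable def ExpSystem.energy {n d : ℕ} {h : ℝ} (S : ExpSystem n d h) (s : ℝ) : ℝ≥0∞ :=
  ∑' t : ℕ, stepEnergy s (S.edgeUnion t)

/-- Every graph `G t` of the system has at most `m` connected components. -/
def ExpSystem.componentsLE {n d : ℕ} {h : ℝ} (S : ExpSystem n d h) (m : ℕ) : Prop :=
  ∀ t : ℕ, ∃ c : Fin n → Fin m,
    (∀ i j, S.M t i j ≠ 0 → c i = c j) ∧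
    (∀ i j, c i = c j → Relation.ReflTransGen (fun a b => S.M t a b ≠ 0) i j)

/-- Initial scaled variance at most one: `d·∑ i (x i − μ)² ≤ 1` with `μ = (1/n)∑ i x i`. -/
def ExpSystem.initVarLEOne {n d : ℕ} {h : ℝ} (S : ExpSystem n d h) : Prop :=
  (d : ℝ) * ∑ i, (S.x 0 i - (∑ j, S.x 0 j) / n) ^ 2 ≤ 1

lemma aux_coarea {n : ℕ} (M : Fin n → Fin n → ℝ) (h : ℝ)
    (H : ∀ X : Finset (Fin n), 2 * X.card ≤ n →
      h * X.card ≤ ∑ i, ∑ j, M i j * |(if i ∈ X then (1:ℝ) else 0) - (if j ∈ X then (1:ℝ) else 0)|) :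
    ∀ (k : ℕ) (g : Fin n → ℝ), (∀ i, 0 ≤ g i) → (Finset.univ.filter (fun i => 0 < g i)).card ≤ k →
      2 * (Finset.univ.filter (fun i => 0 < g i)).card ≤ n →
      h * ∑ i, g i ≤ ∑ i, ∑ j, M i j * |g i - g j| := by
  intro k
  induction k with
  | zero =>
    intro g hg hk _
    have h0 : ∀ i, g i = 0 := by
      intro i
      by_contra hne
      have : i ∈ Finset.univ.filter (fun i => 0 < g i) := by
        simp; exact lt_of_le_of_ne (hg i) (Ne.symm hne)
      have := Finset.card_pos.mpr ⟨i, this⟩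
      omega
    simp [h0]
  | succ k ih =>
    intro g hg hk hn
    set X := Finset.univ.filter (fun i => 0 < g i) with hX
    have memX : ∀ i, i ∈ X ↔ 0 < g i := by intro i; simp [hX]
    rcases X.eq_empty_or_nonempty with he | hne
    · exact ih g hg (by rw [← hX, he]; simp) hn
    obtain ⟨i₀, hi₀, hmin⟩ := Finset.exists_min_image X g hne
    set c := g i₀ with hc
    have hcpos : 0 < c := (memX i₀).1 hi₀
    set g' : Fin n → ℝ := fun i => g i - c * (if i ∈ X then (1:ℝ) else 0) with hg'
    have hout : ∀ i, i ∉ X → g i = 0 := by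
      intro i hi
      rw [memX] at hi
      exact le_antisymm (not_lt.1 hi) (hg i)
    have hg'0 : ∀ i, 0 ≤ g' i := by
      intro i
      by_cases hi : i ∈ X
      · have := hmin i hi
        simp [hg', hi]; linarith
      · simp [hg', hi, hg i]
    have hsub : Finset.univ.filter (fun i => 0 < g' i) ⊂ X := by
      rw [Finset.ssubset_iff_of_subset]
      · refine ⟨i₀, hi₀, ?_⟩
        simp [hg', hi₀, hc]
      · intro i hi
        by_contra hiX
        simp [hg', hiX, hout i hiX] at hi
    have hcard := Finset.card_lt_card hsub
    have h1 := ih g' hg'0 (by omega) (by omega)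
    have h2 := H X hn
    have hpt : ∀ i j, |g i - g j| = |g' i - g' j| +
        c * |(if i ∈ X then (1:ℝ) else 0) - (if j ∈ X then (1:ℝ) else 0)| := by
      intro i j
      have a1 := hg'0 i
      have a2 := hg'0 j
      by_cases hi : i ∈ X <;> by_cases hj : j ∈ X
      · simp [hg', hi, hj]
      · simp only [hg', hi, hj, hout j hj, if_true, if_false] at a1 ⊢
        rw [abs_of_nonneg (by linarith [hg i]), abs_of_nonneg (by linarith)]
        simp
      · simp only [hg', hi, hj, hout i hi, if_true, if_false] at a2 ⊢
        rw [abs_of_nonpos (by linarith [hg j]), abs_of_nonpos (by linarith)]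
        simp
      · simp [hg', hi, hj]
    have hs : ∑ i, g i = ∑ i, g' i + c * X.card := by
      simp [hg', Finset.sum_sub_distrib]; ring
    have hr : ∑ i, ∑ j, M i j * |g i - g j| = ∑ i, ∑ j, M i j * |g' i - g' j| +
        c * ∑ i, ∑ j, M i j * |(if i ∈ X then (1:ℝ) else 0) - (if j ∈ X then (1:ℝ) else 0)| := by
      rw [Finset.mul_sum, ← Finset.sum_add_distrib]
      refine Finset.sum_congr rfl fun i _ => ?_
      rw [Finset.mul_sum, ← Finset.sum_add_distrib]
      refine Finset.sum_congr rfl fun j _ => ?_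
      rw [hpt]; ring
    rw [hs, hr]
    have := mul_le_mul_of_nonneg_left h2 hcpos.le
    linarith

lemma aux_cheeger_half {n : ℕ} (M : Fin n → Fin n → ℝ) (h d : ℝ) (hh : 0 < h)
    (M0 : ∀ i j, 0 ≤ M i j) (Ms : ∀ i j, M i j = M j i) (Md : ∀ i, ∑ j, M i j = d)
    (H : ∀ X : Finset (Fin n), 2 * X.card ≤ n →
      h * X.card ≤ ∑ i, ∑ j, M i j * |(if i ∈ X then (1:ℝ) else 0) - (if j ∈ X then (1:ℝ) else 0)|)
    (f : Fin n → ℝ) (hf : ∀ i, 0 ≤ f i)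
    (hn : 2 * (Finset.univ.filter (fun i => 0 < f i)).card ≤ n) :
    h ^ 2 * ∑ i, f i ^ 2 ≤ 4 * d * ∑ i, ∑ j, M i j * (f i - f j) ^ 2 := by
  have hfil : (Finset.univ.filter (fun i => 0 < f i ^ 2)) = (Finset.univ.filter (fun i => 0 < f i)) := by
    ext i
    simp only [Finset.mem_filter, Finset.mem_univ, true_and]
    constructor
    · intro hp
      rcases (hf i).eq_or_lt with h0 | h0
      · rw [← h0] at hp; simp at hp
      · exact h0
    · intro hp; positivity
  have h1 := aux_coarea M h H _ (fun i => f i ^ 2) (fun i => sq_nonneg _) le_rfl (by rw [hfil]; exact hn)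
  set F := ∑ i, f i ^ 2 with hF
  have hF0 : 0 ≤ F := Finset.sum_nonneg fun i _ => sq_nonneg _
  set A := ∑ i, ∑ j, M i j * (f i - f j) ^ 2 with hA
  have hA0 : 0 ≤ A := Finset.sum_nonneg fun i _ => Finset.sum_nonneg fun j _ =>
    mul_nonneg (M0 i j) (sq_nonneg _)
  have hrow : ∑ i, ∑ j, M i j * f i ^ 2 = d * F := by
    rw [hF, Finset.mul_sum]
    refine Finset.sum_congr rfl fun i _ => ?_
    rw [← Finset.sum_mul, Md]
  have hcol : ∑ i, ∑ j, M i j * f j ^ 2 = d * F := by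
    rw [Finset.sum_comm, ← hrow]
    refine Finset.sum_congr rfl fun i _ => Finset.sum_congr rfl fun j _ => ?_
    rw [Ms]
  have hB : ∑ i, ∑ j, M i j * (f i + f j) ^ 2 ≤ 4 * d * F := by
    calc ∑ i, ∑ j, M i j * (f i + f j) ^ 2 
        ≤ ∑ i, ∑ j, (2 * (M i j * f i ^ 2) + 2 * (M i j * f j ^ 2)) := by
          refine Finset.sum_le_sum fun i _ => Finset.sum_le_sum fun j _ => ?_
          nlinarith [mul_nonneg (M0 i j) (sq_nonneg (f i - f j))]
      _ = 4 * d * F := by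
          simp only [Finset.sum_add_distrib, ← Finset.mul_sum, hrow, hcol]; ring
  have hCS : (∑ i, ∑ j, M i j * |f i ^ 2 - f j ^ 2|) ^ 2 ≤ A * ∑ i, ∑ j, M i j * (f i + f j) ^ 2 := by
    simp only [hA, ← Finset.sum_product']
    apply Finset.sum_sq_le_sum_mul_sum_of_sq_le_mul
    · intro p _; exact mul_nonneg (M0 _ _) (sq_nonneg _)
    · intro p _; exact mul_nonneg (M0 _ _) (sq_nonneg _)
    · intro p _
      rw [mul_pow, sq_abs]; apply le_of_eq; ring
  have h2 : (h * F) ^ 2 ≤ A * (4 * d * F) := by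
    calc (h * F) ^ 2 ≤ _ := pow_le_pow_left₀ (by positivity) h1 2
      _ ≤ _ := hCS
      _ ≤ _ := mul_le_mul_of_nonneg_left hB hA0
  rcases hF0.eq_or_lt with h0 | h0
  · rw [← h0]
    rcases isEmpty_or_nonempty (Fin n) with hem | ⟨⟨i⟩⟩
    · simp [hA]
    have : 0 ≤ d := by rw [← Md i]; exact Finset.sum_nonneg fun j _ => M0 i j
    simp; positivity
  · refine le_of_mul_le_mul_right ?_ h0
    nlinarith

lemma aux_median {n : ℕ} (hn : 0 < n) (x : Fin n → ℝ) : ∃ m : ℝ,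
    2 * (Finset.univ.filter (fun i => m < x i)).card ≤ n ∧
    2 * (Finset.univ.filter (fun i => x i < m)).card ≤ n := by
  haveI : Nonempty (Fin n) := ⟨⟨0, hn⟩⟩
  let S := Finset.univ.filter (fun k => 2 * (Finset.univ.filter (fun i => x k < x i)).card ≤ n)
  have hS : S.Nonempty := by
    obtain ⟨k, hk⟩ := Finite.exists_max x
    refine ⟨k, ?_⟩
    have : Finset.univ.filter (fun i => x k < x i) = ∅ := by
      ext i; simpa using hk i
    simp [S, this]
  obtain ⟨k, hkS, hk⟩ := Finset.exists_min_image S x hS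
  refine ⟨x k, by simpa [S] using hkS, ?_⟩
  rcases (Finset.univ.filter (fun i => x i < x k)).eq_empty_or_nonempty with he | hne
  · rw [he]; simp
  obtain ⟨l, hl, hlmax⟩ := Finset.exists_max_image _ x hne
  have hl' : x l < x k := by simpa using hl
  have hlS : l ∉ S := fun hlS => absurd (hk l hlS) (not_le.2 hl')
  have h1 : n < 2 * (Finset.univ.filter (fun i => x l < x i)).card := by
    simpa [S] using hlS
  have h2 : Disjoint (Finset.univ.filter (fun i => x l < x i)) (Finset.univ.filter (fun i => x i < x k)) := by
    rw [Finset.disjoint_left]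
    intro i hi hi'
    have := hlmax i hi'
    simp at hi
    linarith
  have h3 := Finset.card_le_univ (Finset.disjUnion _ _ h2)
  rw [Finset.card_disjUnion, Fintype.card_fin] at h3
  omega

lemma aux_cheeger {n : ℕ} (hn : 0 < n) (M : Fin n → Fin n → ℝ) (h d : ℝ) (hh : 0 < h)
    (M0 : ∀ i j, 0 ≤ M i j) (Ms : ∀ i j, M i j = M j i) (Md : ∀ i, ∑ j, M i j = d)
    (H : ∀ X : Finset (Fin n), 2 * X.card ≤ n →
      h * X.card ≤ ∑ i, ∑ j, M i j * |(if i ∈ X then (1:ℝ) else 0) - (if j ∈ X then (1:ℝ) else 0)|)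
    (y : Fin n → ℝ) (hy : ∑ i, y i = 0) :
    h ^ 2 * ∑ i, y i ^ 2 ≤ 4 * d * ∑ i, ∑ j, M i j * (y i - y j) ^ 2 := by
  obtain ⟨m, hm1, hm2⟩ := aux_median hn y
  have d0 : 0 ≤ d := by rw [← Md ⟨0, hn⟩]; exact Finset.sum_nonneg fun j _ => M0 _ j
  have p1 := aux_cheeger_half M h d hh M0 Ms Md H (fun i => max (y i - m) 0) (fun i => le_max_right _ _)
    (by simpa using hm1)
  have p2 := aux_cheeger_half M h d hh M0 Ms Md H (fun i => max (m - y i) 0) (fun i => le_max_right _ _)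
    (by simpa using hm2)
  have e1 : ∑ i, y i ^ 2 ≤ ∑ i, (max (y i - m) 0) ^ 2 + ∑ i, (max (m - y i) 0) ^ 2 := by
    have : ∑ i, (max (y i - m) 0) ^ 2 + ∑ i, (max (m - y i) 0) ^ 2 = ∑ i, (y i ^ 2 - 2 * m * y i + m ^ 2) := by
      rw [← Finset.sum_add_distrib]
      refine Finset.sum_congr rfl fun i _ => ?_
      rcases le_total (y i) m with hc | hc
      · rw [max_eq_right (by linarith), max_eq_left (by linarith)]; ring
      · rw [max_eq_left (by linarith), max_eq_right (by linarith)]; ring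
    rw [this, Finset.sum_add_distrib, Finset.sum_sub_distrib, ← Finset.mul_sum, hy]
    simp; positivity
  have e2 : ∑ i, ∑ j, M i j * (max (y i - m) 0 - max (y j - m) 0) ^ 2 + 
      ∑ i, ∑ j, M i j * (max (m - y i) 0 - max (m - y j) 0) ^ 2 ≤ ∑ i, ∑ j, M i j * (y i - y j) ^ 2 := by
    rw [← Finset.sum_add_distrib]
    refine Finset.sum_le_sum fun i _ => ?_
    rw [← Finset.sum_add_distrib]
    refine Finset.sum_le_sum fun j _ => ?_
    rw [← mul_add]
    refine mul_le_mul_of_nonneg_left ?_ (M0 i j)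
    rcases le_total (y i) m with hi | hi <;> rcases le_total (y j) m with hj | hj
    · rw [max_eq_right (by linarith : y i - m ≤ 0), max_eq_right (by linarith : y j - m ≤ 0), max_eq_left (by linarith : 0 ≤ m - y i), max_eq_left (by linarith : 0 ≤ m - y j)]
      nlinarith
    · rw [max_eq_right (by linarith : y i - m ≤ 0), max_eq_left (by linarith : 0 ≤ y j - m), max_eq_left (by linarith : 0 ≤ m - y i), max_eq_right (by linarith : m - y j ≤ 0)]
      nlinarith
    · rw [max_eq_left (by linarith : 0 ≤ y i - m), max_eq_right (by linarith : y j - m ≤ 0), max_eq_right (by linarith : m - y i ≤ 0), max_eq_left (by linarith : 0 ≤ m - y j)]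
      nlinarith
    · rw [max_eq_left (by linarith : 0 ≤ y i - m), max_eq_left (by linarith : 0 ≤ y j - m), max_eq_right (by linarith : m - y i ≤ 0), max_eq_right (by linarith : m - y j ≤ 0)]
      nlinarith
  have e3 := mul_le_mul_of_nonneg_left e1 (sq_nonneg h)
  have e4 := mul_le_mul_of_nonneg_left e2 (by positivity : 0 ≤ 4 * d)
  linarith

/-- variance drop -/
lemma aux_drop {n : ℕ} (M : Fin n → Fin n → ℝ) (d : ℝ) 
    (M0 : ∀ i j, 0 ≤ M i j) (Ms : ∀ i j, M i j = M j i) (Md : ∀ i, ∑ j, M i j = d)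
    (M1 : ∀ i, M i i = 1) (y : Fin n → ℝ) :
    ∑ i, ∑ j, M i j * (y i - y j) ^ 2 ≤ d ^ 2 * ∑ i, y i ^ 2 - ∑ i, (∑ j, M i j * y j) ^ 2 := by
  have key : ∀ i, ∑ j, M i j * (y i - y j) ^ 2 ≤ d * ∑ j, M i j * y j ^ 2 - (∑ j, M i j * y j) ^ 2 := by
    intro i
    -- z j = y j - y i
    have hz1 : ∑ j, M i j * y j = ∑ j, M i j * (y j - y i) + d * y i := by
      rw [← Md i, Finset.sum_mul, ← Finset.sum_add_distrib]
      exact Finset.sum_congr rfl fun j _ => by ring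
    have hz2 : ∑ j, M i j * y j ^ 2 = ∑ j, M i j * (y i - y j) ^ 2 + 2 * y i * ∑ j, M i j * (y j - y i) + d * y i ^ 2 := by
      rw [← Md i, Finset.sum_mul, Finset.mul_sum, ← Finset.sum_add_distrib, ← Finset.sum_add_distrib]
      exact Finset.sum_congr rfl fun j _ => by ring
    have hcs : (∑ j, M i j * (y j - y i)) ^ 2 ≤ (d - 1) * ∑ j, M i j * (y i - y j) ^ 2 := by
      have a1 : ∑ j, M i j * (y j - y i) = ∑ j ∈ Finset.univ.erase i, M i j * (y j - y i) := by
        rw [← Finset.add_sum_erase _ _ (Finset.mem_univ i)]; simp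
      have a2 : ∑ j, M i j * (y i - y j) ^ 2 = ∑ j ∈ Finset.univ.erase i, M i j * (y i - y j) ^ 2 := by
        rw [← Finset.add_sum_erase _ _ (Finset.mem_univ i)]; simp
      have a3 : d - 1 = ∑ j ∈ Finset.univ.erase i, M i j := by
        rw [← Md i, ← Finset.add_sum_erase _ _ (Finset.mem_univ i), M1]; ring
      rw [a1, a2, a3]
      apply Finset.sum_sq_le_sum_mul_sum_of_sq_le_mul
      · intro j _; exact M0 _ _
      · intro j _; exact mul_nonneg (M0 _ _) (sq_nonneg _)
      · intro j _; apply le_of_eq; ring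
    rw [hz1, hz2]
    nlinarith
  have hcol : ∑ i, ∑ j, M i j * y j ^ 2 = d * ∑ i, y i ^ 2 := by
    rw [Finset.sum_comm, Finset.mul_sum]
    refine Finset.sum_congr rfl fun j _ => ?_
    rw [← Finset.sum_mul, ← Md j]
    congr 1
    exact Finset.sum_congr rfl fun i _ => Ms _ _
  calc _ ≤ ∑ i, (d * ∑ j, M i j * y j ^ 2 - (∑ j, M i j * y j) ^ 2) := Finset.sum_le_sum fun i _ => key i
    _ = _ := by rw [Finset.sum_sub_distrib, ← Finset.mul_sum, hcol]; ring

lemma aux_H {n d : ℕ} {h : ℝ} (S : ExpSystem n d h) (t : ℕ)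
    (hc : ∀ i j, Relation.ReflTransGen (fun b c => S.M t b c ≠ 0) i j)
    (X : Finset (Fin n)) (hX : 2 * X.card ≤ n) :
    h * X.card ≤ ∑ i, ∑ j, S.M t i j * |(if i ∈ X then (1:ℝ) else 0) - (if j ∈ X then (1:ℝ) else 0)| := by
  classical
  rcases isEmpty_or_nonempty (Fin n) with hem | ⟨⟨v⟩⟩
  · simp [Finset.eq_empty_of_isEmpty X]
  have h1 := S.expander t v (X : Set (Fin n)) (fun a _ => hc v a) (by
    have : {a | Relation.ReflTransGen (fun b c => S.M t b c ≠ 0) v a} = Set.univ := by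
      ext a; simpa using hc v a
    rw [this, Set.ncard_univ, Set.ncard_coe_finset]; simpa using hX)
  rw [Set.ncard_coe_finset] at h1
  refine h1.trans ?_
  have : {e : Fin n × Fin n | e.1 ∈ (X : Set (Fin n)) ∧ e.2 ∉ (X : Set (Fin n)) ∧ e.1 ≠ e.2 ∧ S.M t e.1 e.2 ≠ 0}
     = ((Finset.univ.filter fun e : Fin n × Fin n => e.1 ∈ X ∧ e.2 ∉ X ∧ e.1 ≠ e.2 ∧ S.M t e.1 e.2 ≠ 0 : Finset _) : Set _) := by
    ext e; simp
  rw [this, Set.ncard_coe_finset, ← Finset.sum_product', Finset.card_filter]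
  push_cast
  rw [← Finset.univ_product_univ]
  refine Finset.sum_le_sum fun e _ => ?_
  split_ifs with ha hb hc hd <;> rcases S.M_01 t e.1 e.2 with h0 | h0 <;> simp_all

lemma aux_step {n d : ℕ} {h : ℝ} (S : ExpSystem n d h) (hd : 1 ≤ d)
    (hc : ∀ t i j, Relation.ReflTransGen (fun b c => S.M t b c ≠ 0) i j) (hh : 0 < h) (hn : 0 < n)
    (μ : ℝ) (t : ℕ) (hμ : ∑ i, (S.x t i - μ) = 0) :
    ∑ i, (S.x (t+1) i - μ) = 0 ∧
    ∑ i, (S.x (t+1) i - μ) ^ 2 ≤ (1 - h ^ 2 / (4 * d ^ 3)) * ∑ i, (S.x t i - μ) ^ 2 := by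
  have d0 : (0:ℝ) < d := by exact_mod_cast hd
  have M0 : ∀ i j, 0 ≤ S.M t i j := by
    intro i j; rcases S.M_01 t i j with h0 | h0 <;> rw [h0]; norm_num
  have hup : ∀ i, S.x (t+1) i - μ = (1 / (d:ℝ)) * ∑ j, S.M t i j * (S.x t j - μ) := by
    intro i
    rw [S.update]
    simp only [mul_sub, Finset.sum_sub_distrib, ← Finset.sum_mul, S.M_deg]
    field_simp
  constructor
  · simp only [hup]
    rw [← Finset.mul_sum, Finset.sum_comm]
    have : ∀ j, ∑ i, S.M t i j * (S.x t j - μ) = d * (S.x t j - μ) := by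
      intro j
      rw [← Finset.sum_mul, ← S.M_deg t j]
      congr 1
      exact Finset.sum_congr rfl fun i _ => S.M_symm t _ _
    simp only [this, ← Finset.mul_sum, hμ, mul_zero]
  · have c1 := aux_cheeger hn (S.M t) h d hh M0 (S.M_symm t) (S.M_deg t) (aux_H S t (hc t)) (fun i => S.x t i - μ) hμ
    have c2 := aux_drop (S.M t) d M0 (S.M_symm t) (S.M_deg t) (S.M_diag t) (fun i => S.x t i - μ)
    have c3 : ∑ i, (S.x (t+1) i - μ) ^ 2 = (1 / (d:ℝ)^2) * ∑ i, (∑ j, S.M t i j * (S.x t j - μ)) ^ 2 := by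
      simp only [hup, mul_pow, ← Finset.mul_sum]; simp
    rw [c3]
    set B := ∑ i, (∑ j, S.M t i j * (S.x t j - μ)) ^ 2
    set V := ∑ i, (S.x t i - μ) ^ 2
    set A := ∑ i, ∑ j, S.M t i j * (S.x t i - μ - (S.x t j - μ)) ^ 2
    have c4 : h ^ 2 * V ≤ 4 * d * (d ^ 2 * V - B) := c1.trans (mul_le_mul_of_nonneg_left c2 (by positivity))
    have : (1 - h ^ 2 / (4 * (d:ℝ) ^ 3)) * V - (1 / (d:ℝ)^2) * B = (4 * d * (d ^ 2 * V - B) - h ^ 2 * V) / (4 * d ^ 3) := by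
      field_simp
      ring
    have h5 : 0 ≤ (4 * d * (d ^ 2 * V - B) - h ^ 2 * V) / (4 * (d:ℝ) ^ 3) := div_nonneg (by linarith) (by positivity)
    linarith

lemma aux_energy {n d : ℕ} {h : ℝ} (S : ExpSystem n d h) (hn : 0 < n) (t : ℕ)
    (hc : ∀ i j, Relation.ReflTransGen (fun b c => S.M t b c ≠ 0) i j) (μ R s : ℝ) (hs : 0 < s)
    (hR : 0 ≤ R) (hV : ∑ i, (S.x t i - μ) ^ 2 ≤ R ^ 2) :
    stepEnergy s (S.edgeUnion t) ≤ ENNReal.ofReal ((2 * R) ^ s) := by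
  set U := S.edgeUnion t with hU
  let v : Fin n := ⟨0, hn⟩
  have hsub : ∀ i j, S.M t i j ≠ 0 → Set.uIcc (S.x t i) (S.x t j) ⊆ U := by
    intro i j hij p hp
    simp only [hU, ExpSystem.edgeUnion, Set.mem_iUnion]
    exact ⟨i, j, hij, hp⟩
  have hvU : ∀ i, S.x t i ∈ U := fun i =>
    hsub i i (by rw [S.M_diag]; norm_num) Set.left_mem_uIcc
  have hedge : ∀ i j, S.M t i j ≠ 0 → ∀ p ∈ Set.uIcc (S.x t i) (S.x t j),
      connectedComponentIn U (S.x t i) = connectedComponentIn U p := by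
    intro i j hij p hp
    apply connectedComponentIn_eq
    exact isPreconnected_uIcc.subset_connectedComponentIn Set.left_mem_uIcc (hsub i j hij) hp
  have hv : ∀ i, connectedComponentIn U (S.x t v) = connectedComponentIn U (S.x t i) := by
    intro i
    induction hc v i with
    | refl => rfl
    | tail _ hbc ih => exact ih.trans (hedge _ _ hbc _ Set.right_mem_uIcc)
  have hall : ∀ C ∈ blockSet U, C = connectedComponentIn U (S.x t v) := by
    rintro C ⟨a, ha, rfl⟩
    have ha' := ha
    simp only [hU, ExpSystem.edgeUnion, Set.mem_iUnion] at ha'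
    obtain ⟨i, j, hij, hp⟩ := ha'
    rw [hv i, hedge i j hij a hp]
  have hx : ∀ i, S.x t i ∈ Set.Icc (μ - R) (μ + R) := by
    intro i
    have h1 : (S.x t i - μ) ^ 2 ≤ R ^ 2 := 
      (Finset.single_le_sum (f := fun i => (S.x t i - μ) ^ 2) (fun i _ => sq_nonneg _) (Finset.mem_univ i)).trans hV
    have := abs_le.1 (abs_le_of_sq_le_sq h1 hR)
    constructor <;> linarith [this.1, this.2]
  have hUI : U ⊆ Set.Icc (μ - R) (μ + R) := by
    intro p hp
    simp only [hU, ExpSystem.edgeUnion, Set.mem_iUnion] at hp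
    obtain ⟨i, j, hij, hp⟩ := hp
    exact Set.uIcc_subset_Icc (hx i) (hx j) hp
  have hdiam : Metric.diam (connectedComponentIn U (S.x t v)) ≤ 2 * R := by
    apply Metric.diam_le_of_forall_dist_le (by positivity)
    intro p hp q hq
    have hp := hUI (connectedComponentIn_subset _ _ hp)
    have hq := hUI (connectedComponentIn_subset _ _ hq)
    rw [Real.dist_eq, abs_le]
    constructor <;> linarith [hp.1, hp.2, hq.1, hq.2]
  have hmem : connectedComponentIn U (S.x t v) ∈ blockSet U := ⟨_, hvU v, rfl⟩
  unfold stepEnergy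
  rw [tsum_eq_single (⟨_, hmem⟩ : blockSet U) (fun b hb => absurd (Subtype.ext (hall b b.2)) hb)]
  exact ENNReal.ofReal_le_ofReal (Real.rpow_le_rpow Metric.diam_nonneg hdiam hs.le)

/-- There is an absolute constant `a > 0` such that for every expanding
averaging system with connected graphs (`m = 1`), degree `d`, Cheeger constant `h`, and
every `s ∈ (0,1]`, the maximum `s`-energy satisfies `𝓔^exp_{1,s} ≤ a·d³/(s·h²)`. -/
theorem expSEnergy_connected_le :
    ∃ a : ℝ, 0 < a ∧
      ∀ (n d : ℕ) (h s : ℝ), 2 ≤ n → 1 ≤ d → 0 < h → 0 < s → s ≤ 1 →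
        ∀ S : ExpSystem n d h,
          (∀ t i j, Relation.ReflTransGen (fun b c => S.M t b c ≠ 0) i j) →
          S.initVarLEOne →
          S.energy s ≤ ENNReal.ofReal (a * d ^ 3 / (s * h ^ 2)) := by
  refine ⟨16, by norm_num, ?_⟩
  intro n d h s hn hd hh hs hs1 S hc hinit
  have d0 : (0:ℝ) < d := by exact_mod_cast hd
  have hd1 : (1:ℝ) ≤ d := by exact_mod_cast hd
  have hn0 : 0 < n := by omega
  set μ := (∑ j, S.x 0 j) / n with hμ
  set δ := h ^ 2 / (4 * (d:ℝ) ^ 3) with hδ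
  have hδ0 : 0 < δ := by positivity
  have hmean : ∀ t, ∑ i, (S.x t i - μ) = 0 := by
    intro t
    induction t with
    | zero =>
      have : (n:ℝ) ≠ 0 := by positivity
      simp [Finset.sum_sub_distrib, hμ]
      field_simp
      ring
    | succ t ih => exact (aux_step S hd hc hh hn0 μ t ih).1
  have hstep : ∀ t, ∑ i, (S.x (t+1) i - μ) ^ 2 ≤ (1 - δ) * ∑ i, (S.x t i - μ) ^ 2 :=
    fun t => (aux_step S hd hc hh hn0 μ t (hmean t)).2
  have hV0 : ∀ t, 0 ≤ ∑ i, (S.x t i - μ) ^ 2 := fun t => Finset.sum_nonneg fun i _ => sq_nonneg _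
  unfold ExpSystem.energy
  rcases lt_or_ge 1 δ with hδ1 | hδ1
  · have hz : ∀ t, stepEnergy s (S.edgeUnion t) = 0 := by
      intro t
      have h1 := hstep t
      have h2 := hV0 t
      have h3 := hV0 (t+1)
      have := aux_energy S hn0 t (hc t) μ 0 s hs le_rfl (by nlinarith)
      simpa [Real.zero_rpow hs.ne'] using this
    simp [hz]
  · set r := 1 - δ with hr
    have hr0 : 0 ≤ r := by linarith
    have hV : ∀ t, ∑ i, (S.x t i - μ) ^ 2 ≤ r ^ t := by
      intro t
      induction t with
      | zero =>
        unfold ExpSystem.initVarLEOne at hinit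
        have := hV0 0
        simp only [pow_zero]
        nlinarith
      | succ t ih =>
        rw [pow_succ, mul_comm]
        exact (hstep t).trans (mul_le_mul_of_nonneg_left ih hr0)
    set q := r ^ (s / 2) with hq
    have hq0 : 0 ≤ q := Real.rpow_nonneg hr0 _
    have hq1 : q ≤ 1 - s * δ / 2 := by
      have := rpow_one_add_le_one_add_mul_self (s := -δ) (by linarith) (p := s / 2) (by linarith) (by linarith)
      rw [hq, hr, sub_eq_add_neg]
      linarith
    have hsd : 0 < s * δ := by positivity
    have hE : ∀ t, stepEnergy s (S.edgeUnion t) ≤ ENNReal.ofReal (2 * q ^ t) := by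
      intro t
      refine (aux_energy S hn0 t (hc t) μ (Real.sqrt (r ^ t)) s hs (Real.sqrt_nonneg _) ?_).trans ?_
      · rw [Real.sq_sqrt (by positivity)]; exact hV t
      · apply ENNReal.ofReal_le_ofReal
        rw [Real.mul_rpow (by norm_num) (Real.sqrt_nonneg _)]
        have e1 : (Real.sqrt (r ^ t)) ^ s = q ^ t := by
          rw [hq, Real.sqrt_eq_rpow, ← Real.rpow_natCast, ← Real.rpow_natCast, ← Real.rpow_mul hr0, ← Real.rpow_mul hr0, ← Real.rpow_mul hr0]
          congr 1; ring
        rw [e1]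
        refine mul_le_mul_of_nonneg_right ?_ (by positivity)
        calc (2:ℝ) ^ s ≤ 2 ^ (1:ℝ) := Real.rpow_le_rpow_of_exponent_le (by norm_num) hs1
          _ = 2 := by simp
    have hqlt : q < 1 := by linarith
    have hsum : Summable fun t => 2 * q ^ t := (summable_geometric_of_lt_one hq0 hqlt).mul_left 2
    calc _ ≤ ∑' t, ENNReal.ofReal (2 * q ^ t) := ENNReal.tsum_le_tsum hE
      _ = ENNReal.ofReal (∑' t, 2 * q ^ t) := (ENNReal.ofReal_tsum_of_nonneg (fun t => by positivity) hsum).symm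
      _ ≤ _ := by
        apply ENNReal.ofReal_le_ofReal
        rw [tsum_mul_left, tsum_geometric_of_lt_one hq0 hqlt]
        have e : 16 * (d:ℝ) ^ 3 / (s * h ^ 2) = 2 * (s * δ / 2)⁻¹ := by
          rw [hδ]; field_simp; norm_num
        rw [e]
        refine mul_le_mul_of_nonneg_left ?_ (by norm_num)
        exact inv_anti₀ (by positivity) (by linarith)
end
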